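/- For each positive integer K let C_K = (0,K)³ ⊂ ℝ³ and N_K = K³. There exists a real number e such that, as K → ∞, both E_Ind^{(N_K)}(1_{C_K}) / K³ → e and ( inf_{x_1,…,x_{N_K} ∈ ℝ³} E_Jel(C_K; x_1,…,x_{N_K}) ) / K³ → e. That is, the thermodynamic limit of the Uniform Electron Gas energy per unit volume coincides with the thermodynamic limit of the Jellium ground state energy per unit volume. -/

import Mathlib

open MeasureTheory Real Set Filter Classical
open scoped ENNReal Pointwise BigOperators Topology

noncomputable section

/-- Three-dimensional Euclidean space. -/
abbrev E3 := EuclideanSpace ℝ (Fin 3)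

/-- Coulomb kernel `|x-y|⁻¹`, interpreted as `+∞` when the points coincide. -/
def coulK (x y : E3) : EReal := if x = y then ⊤ else ((‖x - y‖⁻¹ : ℝ) : EReal)

/-- Total pair interaction `∑_{j<k} |x_j - x_k|⁻¹`, valued in extended reals. -/
def pairEnergy {N : ℕ} (X : Fin N → E3) : EReal :=
  ∑ j : Fin N, ∑ k ∈ Finset.Ioi j, coulK (X j) (X k)

/-- Hartree energy `D(f,g) = ½∬ f(x) g(y) |x-y|⁻¹ dx dy`. -/
def hartree (f g : E3 → ℝ) : ℝ :=
  (1/2) * ∫ x, ∫ y, f x * g y * ‖x - y‖⁻¹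

/-- Jellium energy of points `X` in the background `Ω`, valued in extended reals. -/
def jelliumE (Ω : Set E3) {N : ℕ} (X : Fin N → E3) : EReal :=
  pairEnergy X - (((∑ j, ∫ y in Ω, ‖X j - y‖⁻¹) : ℝ) : EReal)
    + ((hartree (Ω.indicator 1) (Ω.indicator 1) : ℝ) : EReal)

/-- `P` has one-particle density `ρ`. -/
def HasDensity {N : ℕ} (P : Measure (Fin N → E3)) (ρ : E3 → ℝ) : Prop :=
  ∀ φ : E3 → ℝ, Measurable φ → (∃ C, ∀ x, |φ x| ≤ C) →
    ∫ z, (∑ j, φ (z j)) ∂P = ∫ x, φ x * ρ x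

/-- The positive part of an extended real, as an element of `ℝ≥0∞`. -/
def ERealPos (a : EReal) : ℝ≥0∞ := if a = ⊤ then ⊤ else ENNReal.ofReal a.toReal

/-- Integral of an extended-real-valued function: difference of the lower
integrals of the positive and negative parts. -/
def eintegral {α : Type*} [MeasurableSpace α] (P : Measure α) (f : α → EReal) : EReal :=
  ((∫⁻ z, ERealPos (f z) ∂P : ℝ≥0∞) : EReal) - ((∫⁻ z, ERealPos (-(f z)) ∂P : ℝ≥0∞) : EReal)

/-- Indirect (Levy-Lieb) energy of a density `ρ` for `N` particles. -/
def indirectEnergy (N : ℕ) (ρ : E3 → ℝ) : EReal :=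
  sInf {e : EReal | ∃ P : Measure (Fin N → E3), IsProbabilityMeasure P ∧ HasDensity P ρ ∧
    e = eintegral P pairEnergy - ((hartree ρ ρ : ℝ) : EReal)}

/-- Convolution `f ∗ g`. -/
def conv (f g : E3 → ℝ) (x : E3) : ℝ := ∫ y, f y * g (x - y)

end

noncomputable section

/-- The open cube `(0, K)³ ⊂ ℝ³`. -/
def cube0 (K : ℕ) : Set E3 := {y | ∀ i, y i ∈ Ioo (0 : ℝ) (K : ℝ)}

/-- The real-valued Coulomb kernel, equal to `0` on the diagonal. -/
def kap (x y : E3) : ℝ := ‖x - y‖⁻¹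

/-- The Coulomb kernel with values in `ℝ≥0∞`, equal to `∞` on the diagonal. -/
def kapE (x y : E3) : ℝ≥0∞ := ‖x - y‖ₑ⁻¹

lemma kap_nonneg (x y : E3) : 0 ≤ kap x y := inv_nonneg.2 (norm_nonneg _)

lemma measurable_kap : Measurable (Function.uncurry kap) := by
  unfold kap Function.uncurry; fun_prop

lemma measurable_kapE : Measurable (Function.uncurry kapE) := by
  unfold kapE Function.uncurry; fun_prop

lemma kap_comm (x y : E3) : kap x y = kap y x := by simp [kap, norm_sub_rev]

lemma kapE_comm (x y : E3) : kapE x y = kapE y x := by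
  simp [kapE, enorm_sub_rev]

lemma kapE_of_ne {x y : E3} (h : x ≠ y) : kapE x y = ENNReal.ofReal (kap x y) := by
  have : 0 < ‖x - y‖ := norm_pos_iff.2 (sub_ne_zero.2 h)
  rw [kap, kapE, ENNReal.ofReal_inv_of_pos this, ofReal_norm]

lemma ofReal_kap_le (x y : E3) : ENNReal.ofReal (kap x y) ≤ kapE x y := by
  by_cases h : x = y
  · simp [h, kap]
  · rw [kapE_of_ne h]

lemma exp_mul_kap_add_one (x y : E3) : kap x y ≤ rexp (-‖x - y‖) * kap x y + 1 := by
  by_cases h : x = y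
  · simp [h, kap]
  have h0 : 0 < ‖x - y‖ := norm_pos_iff.2 (sub_ne_zero.2 h)
  have h1 : 1 - ‖x - y‖ ≤ rexp (-‖x - y‖) := one_sub_le_exp_neg _
  have h2 : ‖x - y‖ * kap x y = 1 := mul_inv_cancel₀ h0.ne'
  nlinarith [kap_nonneg x y]

lemma kapE_le_exp (x y : E3) :
    kapE x y ≤ ENNReal.ofReal (rexp (-‖x - y‖)) * kapE x y + 1 := by
  by_cases h : x = y
  · subst h; simp [kapE]
  · rw [kapE_of_ne h, ← ENNReal.ofReal_mul (exp_pos _).le, ← ENNReal.ofReal_one,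
      ← ENNReal.ofReal_add (mul_nonneg (exp_pos _).le (kap_nonneg _ _)) zero_le_one]
    exact ENNReal.ofReal_le_ofReal (exp_mul_kap_add_one x y)

lemma integrable_yukawa : Integrable (fun y : E3 => rexp (-‖y‖) * ‖y‖⁻¹) := by
  have := (integrable_fun_norm_addHaar (volume : Measure E3)
    (f := fun r : ℝ => rexp (-r) * r⁻¹)).2 ?_
  · simpa using this
  · have h : IntegrableOn (fun x : ℝ => rexp (-x) * x ^ ((2:ℝ) - 1)) (Ioi 0) :=
      Real.GammaIntegral_convergent (by norm_num)
    refine h.congr_fun ?_ measurableSet_Ioi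
    intro x hx
    have hx : (0:ℝ) < x := hx
    norm_num
    field_simp

lemma ae_ne_point (x : E3) : ∀ᵐ y : E3, x ≠ y := by
  have : (volume : Measure E3) {x} = 0 := by simp
  filter_upwards [compl_mem_ae_iff.2 this] with y hy
  intro h; exact hy h.symm

/-- The total mass of the screened Coulomb potential. -/
def cYuk : ℝ := ∫ y : E3, rexp (-‖y‖) * ‖y‖⁻¹

lemma cYuk_nonneg : 0 ≤ cYuk := integral_nonneg fun y => by positivity

lemma lintegral_exp_kapE (x : E3) :
    ∫⁻ y, ENNReal.ofReal (rexp (-‖x - y‖)) * kapE x y = ENNReal.ofReal cYuk := by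
  have h1 : ∫⁻ y, ENNReal.ofReal (rexp (-‖x - y‖)) * kapE x y
      = ∫⁻ y, ENNReal.ofReal (rexp (-‖x - y‖) * ‖x - y‖⁻¹) := by
    refine lintegral_congr_ae ?_
    filter_upwards [ae_ne_point x] with y hy
    rw [kapE_of_ne hy, ← ENNReal.ofReal_mul (exp_pos _).le, kap]
  rw [h1, lintegral_sub_left_eq_self (fun y : E3 => ENNReal.ofReal (rexp (-‖y‖) * ‖y‖⁻¹)) x,
    cYuk, ofReal_integral_eq_lintegral_ofReal integrable_yukawa
      (Eventually.of_forall fun y => by positivity)]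

lemma lintegral_kapE_le {μ : Measure E3} (hμ : μ ≤ volume) (x : E3) :
    ∫⁻ y, kapE x y ∂μ ≤ ENNReal.ofReal cYuk + μ univ := by
  calc ∫⁻ y, kapE x y ∂μ
      ≤ ∫⁻ y, (ENNReal.ofReal (rexp (-‖x - y‖)) * kapE x y + 1) ∂μ :=
        lintegral_mono fun y => kapE_le_exp x y
    _ = ∫⁻ y, ENNReal.ofReal (rexp (-‖x - y‖)) * kapE x y ∂μ + μ univ := by
        rw [lintegral_add_right _ measurable_const]; simp
    _ ≤ _ := by
        gcongr
        rw [← lintegral_exp_kapE x]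
        exact lintegral_mono' hμ le_rfl

/-- Kernels that are measurable, nonnegative and at most as singular as the Coulomb kernel. -/
structure Adm (k : E3 → E3 → ℝ) : Prop where
  meas : Measurable (Function.uncurry k)
  nonneg : ∀ x y, 0 ≤ k x y
  bd : ∃ c, 0 ≤ c ∧ ∀ x y, k x y ≤ c + kap x y

/-- The energy of the points `X` in the background `C` for the interaction kernel `k`,
including the self-energy of the points. -/
def En (k : E3 → E3 → ℝ) (X : Finset E3) (C : Set E3) : ℝ :=
  (1/2) * ∑ x ∈ X, ∑ y ∈ X, k x y - ∑ x ∈ X, (∫ y in C, k x y)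
    + (1/2) * ∫ p, k p.1 p.2 ∂((volume.restrict C).prod (volume.restrict C))

lemma adm_kap : Adm kap := ⟨measurable_kap, kap_nonneg, 0, le_rfl, fun x y => by simp⟩

lemma Adm.meas_right {k : E3 → E3 → ℝ} (h : Adm k) (x : E3) : Measurable (k x) :=
  h.meas.comp measurable_prodMk_left

lemma Adm.of_le {k : E3 → E3 → ℝ} (hm : Measurable (Function.uncurry k)) (h0 : ∀ x y, 0 ≤ k x y)
    (h1 : ∀ x y, k x y ≤ kap x y) : Adm k := ⟨hm, h0, 0, le_rfl, fun x y => by simpa using h1 x y⟩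

lemma Adm.of_bdd {k : E3 → E3 → ℝ} (hm : Measurable (Function.uncurry k)) (h0 : ∀ x y, 0 ≤ k x y)
    (c : ℝ) (h1 : ∀ x y, k x y ≤ c) : Adm k := ⟨hm, h0, c, (h0 0 0).trans (h1 0 0), fun x y => by
      linarith [h1 x y, kap_nonneg x y]⟩

lemma Adm.add {k l : E3 → E3 → ℝ} (hk : Adm k) (c : ℝ) (hl : Measurable (Function.uncurry l))
    (h0 : ∀ x y, 0 ≤ l x y) (h1 : ∀ x y, l x y ≤ c) : Adm (fun x y => k x y + l x y) := by
  obtain ⟨a, ha, hb⟩ := hk.bd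
  refine ⟨hk.meas.add hl, fun x y => add_nonneg (hk.nonneg x y) (h0 x y), a + c,
    add_nonneg ha ((h0 0 0).trans (h1 0 0)), fun x y => ?_⟩
  linarith [hb x y, h1 x y]

lemma Adm.lintegral_le {k : E3 → E3 → ℝ} (h : Adm k) :
    ∃ c : ℝ≥0∞, c ≠ ⊤ ∧ ∀ x C, ∫⁻ y in C, ENNReal.ofReal (k x y) ≤ c * volume C
      + ENNReal.ofReal cYuk := by
  obtain ⟨c, hc, hb⟩ := h.bd
  refine ⟨ENNReal.ofReal c + 1, by finiteness, fun x C => ?_⟩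
  calc ∫⁻ y in C, ENNReal.ofReal (k x y) ≤ ∫⁻ y in C, (ENNReal.ofReal c + kapE x y) := by
        refine lintegral_mono fun y => ?_
        refine (ENNReal.ofReal_le_ofReal (hb x y)).trans ?_
        rw [ENNReal.ofReal_add hc (kap_nonneg _ _)]
        gcongr
        exact ofReal_kap_le x y
    _ = ENNReal.ofReal c * volume C + ∫⁻ y in C, kapE x y := by
        rw [lintegral_add_left measurable_const]; simp
    _ ≤ ENNReal.ofReal c * volume C + (ENNReal.ofReal cYuk + volume C) := by
        gcongr
        simpa using lintegral_kapE_le (μ := volume.restrict C) Measure.restrict_le_self x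
    _ = _ := by ring

lemma Adm.integrableOn {k : E3 → E3 → ℝ} (h : Adm k) {C : Set E3} (hC : volume C ≠ ⊤) (x : E3) :
    IntegrableOn (k x) C := by
  obtain ⟨c, hc, hb⟩ := h.lintegral_le
  refine ⟨(h.meas_right x).aestronglyMeasurable, ?_⟩
  rw [hasFiniteIntegral_iff_ofReal (Eventually.of_forall (h.nonneg x))]
  exact (hb x C).trans_lt (by finiteness)

lemma Adm.integrable_prod {k : E3 → E3 → ℝ} (h : Adm k) {C : Set E3} (hC : volume C ≠ ⊤) :
    Integrable (Function.uncurry k) ((volume.restrict C).prod (volume.restrict C)) := by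
  obtain ⟨c, hc, hb⟩ := h.lintegral_le
  refine ⟨h.meas.aestronglyMeasurable, ?_⟩
  rw [hasFiniteIntegral_iff_ofReal (f := Function.uncurry k)
      (Eventually.of_forall fun p => h.nonneg p.1 p.2),
    lintegral_prod _ h.meas.ennreal_ofReal.aemeasurable]
  calc _ ≤ ∫⁻ x in C, (c * volume C + ENNReal.ofReal cYuk) := lintegral_mono fun x => hb x C
    _ < ⊤ := by simp; finiteness

lemma integral_mix {Z W : Type*} [MeasurableSpace Z] [MeasurableSpace W] {L : Measure Z} [SFinite L]
    {ν : Measure W} [SFinite ν] {g : Z × W → ℝ} (hg : Measurable g) (h0 : ∀ p, 0 ≤ g p)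
    (hi : ∀ w, Integrable (fun z => g (z, w)) L)
    (hk : Integrable (fun w => ∫ z, g (z, w) ∂L) ν) :
    Integrable (fun z => ∫ w, g (z, w) ∂ν) L ∧
      ∫ z, ∫ w, g (z, w) ∂ν ∂L = ∫ w, ∫ z, g (z, w) ∂L ∂ν := by
  have h : Integrable g (L.prod ν) := by
    rw [integrable_prod_iff' hg.aestronglyMeasurable]
    refine ⟨Eventually.of_forall hi, ?_⟩
    simpa only [Real.norm_of_nonneg (h0 _)] using hk
  exact ⟨h.integral_prod_left, integral_integral_swap (f := fun z w => g (z, w)) h⟩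

/-- The energy of a mixture of kernels is the mixture of the energies. -/
lemma En_mix {Z : Type*} [MeasurableSpace Z] {L : Measure Z} [SFinite L] {f : Z → E3 → E3 → ℝ}
    {k : E3 → E3 → ℝ} (hk : Adm k)
    (hf : Measurable fun p : Z × E3 × E3 => f p.1 p.2.1 p.2.2) (h0 : ∀ z x y, 0 ≤ f z x y)
    (hi : ∀ x y, Integrable (fun z => f z x y) L) (he : ∀ x y, ∫ z, f z x y ∂L = k x y)
    (X : Finset E3) {C : Set E3} (hC : volume C ≠ ⊤) :
    Integrable (fun z => En (f z) X C) L ∧ ∫ z, En (f z) X C ∂L = En k X C := by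
  have A1 : ∀ x, Integrable (fun z => ∑ y ∈ X, f z x y) L :=
    fun x => integrable_finsetSum _ fun y _ => hi x y
  have A2 : Integrable (fun z => ∑ x ∈ X, ∑ y ∈ X, f z x y) L :=
    integrable_finsetSum _ fun x _ => A1 x
  have A3 : ∫ z, ∑ x ∈ X, ∑ y ∈ X, f z x y ∂L = ∑ x ∈ X, ∑ y ∈ X, k x y := by
    rw [integral_finsetSum _ fun x _ => A1 x]
    refine Finset.sum_congr rfl fun x _ => ?_
    rw [integral_finsetSum _ fun y _ => hi x y]
    exact Finset.sum_congr rfl fun y _ => he x y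
  have B : ∀ x, Integrable (fun z => ∫ y in C, f z x y) L ∧
      ∫ z, (∫ y in C, f z x y) ∂L = ∫ y in C, k x y := by
    intro x
    have hm : Measurable fun p : Z × E3 => (p.1, x, p.2) := by fun_prop
    have := integral_mix (L := L) (ν := volume.restrict C) (g := fun p : Z × E3 => f p.1 x p.2)
      (hf.comp hm) (fun p => h0 _ _ _) (fun w => hi x w)
      (by simp only [he]; exact hk.integrableOn hC x)
    simpa only [he] using this
  have D := integral_mix (L := L) (ν := (volume.restrict C).prod (volume.restrict C))
      (g := fun p : Z × E3 × E3 => f p.1 p.2.1 p.2.2) hf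
      (fun p => h0 _ _ _) (fun w => hi w.1 w.2)
      (by simp only [he]; exact hk.integrable_prod hC)
  simp only [he] at D
  have B2 : Integrable (fun z => ∑ x ∈ X, (∫ y in C, f z x y)) L :=
    integrable_finsetSum _ fun x _ => (B x).1
  refine ⟨((A2.const_mul _).sub B2).add (D.1.const_mul _), ?_⟩
  unfold En
  have A2' : Integrable (fun z => 1 / 2 * ∑ x ∈ X, ∑ y ∈ X, f z x y
      - ∑ x ∈ X, (∫ y in C, f z x y)) L := (A2.const_mul _).sub B2
  rw [integral_add A2' (D.1.const_mul _),
    integral_sub (A2.const_mul _) B2, integral_const_mul, integral_const_mul, A3, D.2,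
    integral_finsetSum _ fun x _ => (B x).1]
  simp only [(B _).2]

lemma En_add {k l : E3 → E3 → ℝ} (hk : Adm k) (hl : Adm l) (X : Finset E3) {C : Set E3}
    (hC : volume C ≠ ⊤) : En (fun x y => k x y + l x y) X C = En k X C + En l X C := by
  unfold En
  have h := integral_add (hk.integrable_prod hC) (hl.integrable_prod hC)
  simp only [Function.uncurry] at h
  rw [h]
  simp only [Finset.sum_add_distrib, integral_add (hk.integrableOn hC _) (hl.integrableOn hC _)]
  ring

lemma En_const_mul (c : ℝ) (k : E3 → E3 → ℝ) (X : Finset E3) (C : Set E3) :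
    En (fun x y => c * k x y) X C = c * En k X C := by
  unfold En
  simp only [integral_const_mul, ← Finset.mul_sum]
  ring

lemma En_diag (X : Finset E3) (C : Set E3) :
    En (fun x y => if x = y then 1 else 0) X C = (1/2) * X.card := by
  have h : ∀ x : E3, ∫ y in C, (if x = y then 1 else 0 : ℝ) = 0 := fun x => by
    refine integral_eq_zero_of_ae (ae_restrict_of_ae ?_)
    filter_upwards [ae_ne_point x] with y hy
    simp [hy]
  have hm : MeasurableSet {p : E3 × E3 | p.1 = p.2} :=
    measurableSet_eq_fun (by fun_prop) (by fun_prop)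
  have h2 : ∫ p, (if p.1 = p.2 then 1 else 0 : ℝ) ∂((volume.restrict C).prod (volume.restrict C))
      = 0 := by
    refine integral_eq_zero_of_ae ?_
    have : ∀ᵐ p ∂((volume.restrict C).prod (volume.restrict C)), ¬ (p.1 = p.2) := by
      rw [Measure.ae_prod_iff_ae_ae (p := fun p : E3 × E3 => ¬ p.1 = p.2) hm.compl]
      exact Eventually.of_forall fun x => ae_restrict_of_ae (ae_ne_point x)
    filter_upwards [this] with p hp
    simp [hp]
  unfold En
  simp only [h, h2]
  simp

/-- Kernels for which the energy of every configuration is nonnegative. -/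
def PD (k : E3 → E3 → ℝ) : Prop :=
  ∀ (X : Finset E3) (C : Set E3), MeasurableSet C → volume C ≠ ⊤ → 0 ≤ En k X C

lemma PD.mix {Z : Type*} [MeasurableSpace Z] {L : Measure Z} [SFinite L] {f : Z → E3 → E3 → ℝ}
    {k : E3 → E3 → ℝ} (hpd : ∀ z, PD (f z)) (hk : Adm k)
    (hf : Measurable fun p : Z × E3 × E3 => f p.1 p.2.1 p.2.2) (h0 : ∀ z x y, 0 ≤ f z x y)
    (hi : ∀ x y, Integrable (fun z => f z x y) L) (he : ∀ x y, ∫ z, f z x y ∂L = k x y) :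
    PD k := fun X C hC hC' => by
  rw [← (En_mix hk hf h0 hi he X hC').2]
  exact integral_nonneg fun z => hpd z X C hC hC'

lemma PD.rankOne (ψ : E3 → ℝ) : PD (fun x y => ψ x * ψ y) := fun X C _ _ => by
  unfold En
  rw [integral_prod_mul]
  simp only [integral_const_mul, ← Finset.mul_sum, ← Finset.sum_mul]
  nlinarith [sq_nonneg (∑ x ∈ X, ψ x - ∫ x in C, ψ x)]

lemma PD.const_mul {k : E3 → E3 → ℝ} (hk : PD k) {c : ℝ} (hc : 0 ≤ c) :
    PD (fun x y => c * k x y) := fun X C h1 h2 => by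
  rw [En_const_mul]; exact mul_nonneg hc (hk X C h1 h2)

lemma PD.indicator {k : E3 → E3 → ℝ} (hk : PD k) {A : Set E3} (hA : MeasurableSet A) :
    PD (fun x y => A.indicator 1 x * A.indicator 1 y * k x y) := fun X C h1 h2 => by
  have h := hk (X.filter (· ∈ A)) (A ∩ C) (hA.inter h1)
    (measure_ne_top_of_subset inter_subset_right h2)
  have e1 : ∀ x y, A.indicator (1 : E3 → ℝ) x * A.indicator 1 y * k x y
      = if x ∈ A then (if y ∈ A then k x y else 0) else 0 := by
    intro x y
    by_cases hx : x ∈ A <;> by_cases hy : y ∈ A <;> simp [hx, hy]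
  have e2 : ∀ x, ∫ y in C, (if x ∈ A then (if y ∈ A then k x y else 0) else 0)
      = if x ∈ A then ∫ y in A ∩ C, k x y else 0 := by
    intro x
    split_ifs
    · rw [← Measure.restrict_restrict hA, ← integral_indicator hA]; rfl
    · simp
  have e3 : ∫ p, (if p.1 ∈ A then (if p.2 ∈ A then k p.1 p.2 else 0) else 0)
      ∂((volume.restrict C).prod (volume.restrict C)) =
      ∫ p, k p.1 p.2 ∂((volume.restrict (A ∩ C)).prod (volume.restrict (A ∩ C))) := by
    rw [← Measure.restrict_restrict hA,
      Measure.prod_restrict (μ := volume.restrict C) (ν := volume.restrict C),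
      ← integral_indicator (hA.prod hA)]
    refine integral_congr_ae (Eventually.of_forall fun p => ?_)
    by_cases hx : p.1 ∈ A <;> by_cases hy : p.2 ∈ A <;> simp [hx, hy]
  unfold En at h ⊢
  simp only [e1, e2, e3]
  simp only [Finset.sum_filter, Finset.sum_ite_irrel, Finset.sum_const_zero] at h ⊢
  exact h

lemma integrable_gauss {a : ℝ} (ha : 0 < a) (m : E3) :
    Integrable (fun z : E3 => rexp (-a * ‖z - m‖ ^ 2)) := by
  have h := GaussianFourier.integrable_cexp_neg_mul_sq_norm_add (V := E3) (b := (a : ℂ))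
    (by simpa using ha) 0 0
  have h2 : Integrable (fun z : E3 => rexp (-a * ‖z‖ ^ 2)) := by
    refine h.norm.congr (Eventually.of_forall fun z => ?_)
    simp only [Complex.norm_exp]
    congr 1
    norm_cast
    simp
  exact h2.comp_sub_right m

lemma PD.gauss {a : ℝ} (ha : 0 ≤ a) : PD (fun x y => rexp (-(a * ‖x - y‖ ^ 2))) := by
  rcases ha.eq_or_lt with rfl | ha
  · simpa using PD.rankOne (fun _ => 1)
  have hc : 0 < ∫ z : E3, rexp (-(4 * a) * ‖z‖ ^ 2) := by
    have := integrable_gauss (a := 4 * a) (by positivity) 0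
    simp only [sub_zero] at this
    exact integral_exp_pos this
  set c := ∫ z : E3, rexp (-(4 * a) * ‖z‖ ^ 2) with hcdef
  have key : ∀ x y z : E3, rexp (-(2 * a * ‖x - z‖ ^ 2)) * rexp (-(2 * a * ‖y - z‖ ^ 2))
      = rexp (-(a * ‖x - y‖ ^ 2)) * rexp (-(4 * a) * ‖z - (1 / 2 : ℝ) • (x + y)‖ ^ 2) := by
    intro x y z
    have h := parallelogram_law_with_norm ℝ (x - z) (y - z)
    have e1 : x - z + (y - z) = (-2 : ℝ) • (z - (1 / 2 : ℝ) • (x + y)) := by module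
    have e2 : x - z - (y - z) = x - y := by abel
    rw [e1, e2, norm_smul] at h
    norm_num at h
    rw [← Real.exp_add, ← Real.exp_add]
    congr 1
    norm_num
    nlinarith
  refine PD.mix (L := (volume : Measure E3)) (f := fun z x y => c⁻¹ *
    (rexp (-(2 * a * ‖x - z‖ ^ 2)) * rexp (-(2 * a * ‖y - z‖ ^ 2)))) (fun z => ?_) ?_ ?_ ?_ ?_ ?_
  · exact PD.const_mul (PD.rankOne (fun x : E3 => rexp (-(2 * a * ‖x - z‖ ^ 2)))) (by positivity)
  · refine Adm.of_bdd (by unfold Function.uncurry; fun_prop) (fun x y => by positivity) 1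
      fun x y => ?_
    simp; positivity
  · fun_prop
  · intro z x y; positivity
  · intro x y
    simp only [key]
    exact ((integrable_gauss (by positivity) _).const_mul _).const_mul _
  · intro x y
    simp only [key]
    rw [integral_const_mul, integral_const_mul,
      integral_sub_right_eq_self (fun z : E3 => rexp (-(4 * a) * ‖z‖ ^ 2)), ← hcdef]
    field_simp

lemma image_div_Ioi {a : ℝ} (ha : 0 < a) : (fun u : ℝ => a / u) '' Ioi 0 = Ioi 0 := by
  ext v
  constructor
  · rintro ⟨u, hu, rfl⟩
    exact div_pos ha hu
  · intro hv
    exact ⟨a / v, div_pos ha hv, by field_simp⟩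

lemma image_sub_div_Ioi {a : ℝ} (ha : 0 < a) : (fun u : ℝ => u - a / u) '' Ioi 0 = univ := by
  refine eq_univ_of_forall fun v => ?_
  have h1 : 0 < v ^ 2 + 4 * a := by positivity
  have h2 : |v| < √(v ^ 2 + 4 * a) := by
    rw [← Real.sqrt_sq_eq_abs]; exact Real.sqrt_lt_sqrt (sq_nonneg v) (by linarith)
  have h3 := Real.sq_sqrt h1.le
  have h4 := neg_abs_le v
  have h5 : 0 < v + √(v ^ 2 + 4 * a) := by linarith
  refine ⟨(v + √(v ^ 2 + 4 * a)) / 2, by simpa using h5, ?_⟩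
  field_simp
  nlinarith

lemma integrableOn_exp_neg_sq_sub (a : ℝ) :
    IntegrableOn (fun u : ℝ => rexp (-u ^ 2) * rexp (-(a ^ 2 / u ^ 2))) (Ioi 0) := by
  have h := (integrable_exp_neg_mul_sq (b := 1) one_pos).integrableOn (s := Ioi 0)
  refine Integrable.mono' h (by fun_prop) (Eventually.of_forall fun u => ?_)
  rw [Real.norm_of_nonneg (by positivity)]
  have : rexp (-(a ^ 2 / u ^ 2)) ≤ 1 := by simp; positivity
  simpa using mul_le_of_le_one_right (exp_pos (-u ^ 2)).le this

lemma integral_exp_neg_sq_sub {a : ℝ} (ha : 0 ≤ a) :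
    ∫ u in Ioi (0 : ℝ), rexp (-u ^ 2) * rexp (-(a ^ 2 / u ^ 2)) = √π / 2 * rexp (-2 * a) := by
  rcases ha.eq_or_lt with rfl | ha
  · have := integral_gaussian_Ioi 1
    simpa using this
  set F : ℝ → ℝ := fun u => rexp (-u ^ 2) * rexp (-(a ^ 2 / u ^ 2)) with hF
  have hFi : IntegrableOn F (Ioi 0) := integrableOn_exp_neg_sq_sub a
  have hd1 : ∀ u ∈ Ioi (0 : ℝ), HasDerivWithinAt (fun u : ℝ => a / u) (-(a / u ^ 2)) (Ioi 0) u := by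
    intro u hu
    have hu : u ≠ 0 := (ne_of_gt hu)
    have h := ((hasDerivAt_inv hu).const_mul a).hasDerivWithinAt (s := Ioi 0)
    simpa only [div_eq_mul_inv, mul_neg] using h
  have hinj : InjOn (fun u : ℝ => a / u) (Ioi 0) := by
    intro u hu v hv h
    have hu : 0 < u := hu
    have hv : 0 < v := hv
    simp only at h
    field_simp at h
    linarith
  have e0 : ∀ u ∈ Ioi (0 : ℝ), |(-(a / u ^ 2))| • F (a / u) = a / u ^ 2 * F u := by
    intro u hu
    have hu : u ≠ 0 := (ne_of_gt hu)
    rw [abs_neg, abs_of_nonneg (by positivity), smul_eq_mul, hF]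
    simp only
    rw [mul_comm (rexp (-(a / u) ^ 2))]
    congr 3 <;> field_simp
  have e1 : ∫ u in Ioi (0 : ℝ), F u = ∫ u in Ioi (0 : ℝ), a / u ^ 2 * F u := by
    have := integral_image_eq_integral_abs_deriv_smul measurableSet_Ioi hd1 hinj F
    rw [image_div_Ioi ha] at this
    rw [this]
    exact setIntegral_congr_fun measurableSet_Ioi e0
  have e2 : IntegrableOn (fun u => a / u ^ 2 * F u) (Ioi 0) := by
    have := integrableOn_image_iff_integrableOn_abs_deriv_smul measurableSet_Ioi hd1 hinj F
    rw [image_div_Ioi ha] at this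
    exact (this.1 hFi).congr_fun e0 measurableSet_Ioi
  have hd2 : ∀ u ∈ Ioi (0 : ℝ),
      HasDerivWithinAt (fun u : ℝ => u - a / u) (1 + a / u ^ 2) (Ioi 0) u := by
    intro u hu
    have h := (hasDerivWithinAt_id u _).sub (hd1 u hu)
    rw [sub_neg_eq_add] at h
    exact h
  have hinj2 : InjOn (fun u : ℝ => u - a / u) (Ioi 0) := by
    intro u hu v hv h
    have hu : 0 < u := hu
    have hv : 0 < v := hv
    simp only at h
    field_simp at h
    have : (u - v) * (u * v + a) = 0 := by linarith
    rcases mul_eq_zero.1 this with h | h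
    · linarith
    · nlinarith [mul_pos hu hv]
  have e3 : ∫ v : ℝ, rexp (-v ^ 2)
      = ∫ u in Ioi (0 : ℝ), rexp (2 * a) * (F u + a / u ^ 2 * F u) := by
    have := integral_image_eq_integral_abs_deriv_smul measurableSet_Ioi hd2 hinj2
      (fun v => rexp (-v ^ 2))
    rw [image_sub_div_Ioi ha, setIntegral_univ] at this
    rw [this]
    refine setIntegral_congr_fun measurableSet_Ioi fun u hu => ?_
    have hu : 0 < u := hu
    simp only [smul_eq_mul, hF]
    rw [abs_of_nonneg (by positivity)]
    have : rexp (-(u - a / u) ^ 2) = rexp (2 * a) * (rexp (-u ^ 2) * rexp (-(a ^ 2 / u ^ 2))) := by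
      rw [← Real.exp_add, ← Real.exp_add]
      congr 1
      field_simp
      ring
    rw [this]; ring
  have e4 : ∫ v : ℝ, rexp (-v ^ 2) = √π := by simpa using integral_gaussian 1
  rw [e4, integral_const_mul, integral_add hFi e2, ← e1] at e3
  rw [e3]
  have : rexp (2 * a) * rexp (-2 * a) = 1 := by rw [← Real.exp_add]; simp
  linear_combination -(∫ u in Ioi (0 : ℝ), F u) * this

lemma PD.exp {b : ℝ} (hb : 0 ≤ b) : PD (fun x y => rexp (-(b * ‖x - y‖))) := by
  have key : ∀ u (x y : E3), rexp (-(b ^ 2 / (4 * u ^ 2) * ‖x - y‖ ^ 2))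
      = rexp (-((b * ‖x - y‖ / 2) ^ 2 / u ^ 2)) := by
    intro u x y; congr 2; ring
  have hpi : 0 < √π := by positivity
  refine PD.mix (L := volume.restrict (Ioi (0 : ℝ))) (f := fun u x y => (2 / √π * rexp (-u ^ 2)) *
    rexp (-(b ^ 2 / (4 * u ^ 2) * ‖x - y‖ ^ 2))) (fun z => ?_) ?_ ?_ ?_ ?_ ?_
  · exact PD.const_mul (PD.gauss (by positivity)) (by positivity)
  · refine Adm.of_bdd (by unfold Function.uncurry; fun_prop) (fun x y => by positivity) 1
      fun x y => ?_
    simp; positivity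
  · fun_prop
  · intro z x y; positivity
  · intro x y
    simp only [key, mul_assoc]
    exact (integrableOn_exp_neg_sq_sub _).const_mul _
  · intro x y
    simp only [key, mul_assoc]
    rw [integral_const_mul, integral_exp_neg_sq_sub (by positivity)]
    rw [show -2 * (b * ‖x - y‖ / 2) = -(b * ‖x - y‖) by ring]
    field_simp

/-- The kernel `(1 - e^{-br}) / r`, extended by continuity to the diagonal. -/
def kapLong (b : ℝ) (x y : E3) : ℝ := if x = y then b else (1 - rexp (-(b * ‖x - y‖))) * kap x y

lemma integral_exp_neg_mul (b : ℝ) (x y : E3) (hb : 0 ≤ b) :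
    ∫ s in Ioc 0 b, rexp (-(s * ‖x - y‖)) = kapLong b x y := by
  rw [← intervalIntegral.integral_of_le hb, kapLong]
  split_ifs with h
  · simp [h]
  · have h0 : ‖x - y‖ ≠ 0 := (norm_pos_iff.2 (sub_ne_zero.2 h)).ne'
    have := intervalIntegral.integral_comp_mul_right (a := 0) (b := b) (fun s => rexp s)
      (c := -‖x - y‖) (neg_ne_zero.2 h0)
    simp only [mul_neg] at this
    rw [this, integral_exp]
    simp [kap]
    field_simp
    ring

lemma kapLong_nonneg {b : ℝ} (hb : 0 ≤ b) (x y : E3) : 0 ≤ kapLong b x y := by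
  rw [← integral_exp_neg_mul b x y hb]
  exact integral_nonneg fun s => by positivity

lemma kapLong_le (b : ℝ) (x y : E3) : kapLong b x y ≤ b := by
  unfold kapLong
  split_ifs with h
  · rfl
  · have h0 : 0 < ‖x - y‖ := norm_pos_iff.2 (sub_ne_zero.2 h)
    have h1 : 1 - b * ‖x - y‖ ≤ rexp (-(b * ‖x - y‖)) := one_sub_le_exp_neg _
    rw [kap, ← div_eq_mul_inv, div_le_iff₀ h0]
    linarith

lemma measurable_kapLong (b : ℝ) : Measurable (Function.uncurry (kapLong b)) := by
  unfold Function.uncurry kapLong kap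
  exact Measurable.ite (measurableSet_eq_fun (by fun_prop) (by fun_prop)) (by fun_prop)
    (by fun_prop)

lemma adm_kapLong {b : ℝ} (hb : 0 ≤ b) : Adm (kapLong b) :=
  Adm.of_bdd (measurable_kapLong b) (kapLong_nonneg hb) b (kapLong_le b)

lemma PD.kapLong {b : ℝ} (hb : 0 ≤ b) : PD (kapLong b) := by
  refine PD.mix (L := volume.restrict (Ioc (0 : ℝ) b)) (f := fun s x y =>
    rexp (-(|s| * ‖x - y‖))) (fun z => PD.exp (abs_nonneg _)) (adm_kapLong hb) ?_ ?_ ?_ ?_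
  · fun_prop
  · intro z x y; positivity
  · intro x y
    refine Measure.integrableOn_of_bounded (M := 1) (by simp) (by fun_prop) ?_
    refine Eventually.of_forall fun s => ?_
    rw [Real.norm_of_nonneg (by positivity)]
    simp; positivity
  · intro x y
    rw [← integral_exp_neg_mul b x y hb]
    refine setIntegral_congr_fun measurableSet_Ioc fun s hs => ?_
    simp only [abs_of_pos hs.1]

lemma adm_exp_kap {b : ℝ} (hb : 0 ≤ b) : Adm (fun x y => rexp (-(b * ‖x - y‖)) * kap x y) := by
  refine Adm.of_le ?_ (fun x y => mul_nonneg (exp_pos _).le (kap_nonneg _ _)) fun x y => ?_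
  · unfold Function.uncurry kap; fun_prop
  · refine mul_le_of_le_one_left (kap_nonneg _ _) ?_
    simp; positivity

lemma kap_split (b : ℝ) (x y : E3) :
    kap x y + b * (if x = y then 1 else 0)
      = rexp (-(b * ‖x - y‖)) * kap x y + kapLong b x y := by
  unfold kapLong
  split_ifs with h
  · simp [h, kap]
  · ring

/-- The product of three triangle functions along the directions `v`. -/
def tri (v : Fin 3 → E3) (z : E3) : ℝ := ∏ i, max (1 - |inner ℝ (v i) z|) 0

lemma tri_nonneg (v : Fin 3 → E3) (z : E3) : 0 ≤ tri v z :=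
  Finset.prod_nonneg fun _ _ => le_max_right _ _

lemma tri_le_one (v : Fin 3 → E3) (z : E3) : tri v z ≤ 1 :=
  Finset.prod_le_one (fun _ _ => le_max_right _ _) fun i _ =>
    max_le (by linarith [abs_nonneg (inner ℝ (v i) z)]) zero_le_one

lemma tri_zero (v : Fin 3 → E3) : tri v 0 = 1 := by simp [tri]

lemma continuous_tri : Continuous fun p : (Fin 3 → E3) × E3 => tri p.1 p.2 := by
  unfold tri; fun_prop

lemma measurable_tri (v : Fin 3 → E3) : Measurable (tri v) :=
  (continuous_tri.comp (Continuous.prodMk_right v)).measurable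

/-- The Coulomb kernel localized by `tri v`. -/
def locK (v : Fin 3 → E3) (x y : E3) : ℝ := tri v (x - y) * kap x y

lemma locK_nonneg (v : Fin 3 → E3) (x y : E3) : 0 ≤ locK v x y :=
  mul_nonneg (tri_nonneg _ _) (kap_nonneg _ _)

lemma locK_le (v : Fin 3 → E3) (x y : E3) : locK v x y ≤ kap x y :=
  mul_le_of_le_one_left (kap_nonneg _ _) (tri_le_one _ _)

lemma measurable_locK : Measurable fun p : (Fin 3 → E3) × E3 × E3 => locK p.1 p.2.1 p.2.2 := by
  unfold locK kap
  refine Measurable.mul ?_ (by fun_prop)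
  exact continuous_tri.measurable.comp (g := fun p : (Fin 3 → E3) × E3 => tri p.1 p.2)
    (f := fun p : (Fin 3 → E3) × E3 × E3 => (p.1, p.2.1 - p.2.2)) (by fun_prop)

lemma adm_locK (v : Fin 3 → E3) : Adm (locK v) := by
  refine Adm.of_le ?_ (locK_nonneg v) (locK_le v)
  unfold Function.uncurry locK kap
  exact ((measurable_tri v).comp (by fun_prop : Measurable fun p : E3 × E3 => p.1 - p.2)).mul
    (by fun_prop)

lemma indicator_Ico_overlap (a b : ℝ) (s : ℝ) :
    (Ico (0 : ℝ) 1).indicator (1 : ℝ → ℝ) (a - s) * (Ico (0 : ℝ) 1).indicator 1 (b - s)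
      = (Ioc (max a b - 1) (min a b)).indicator 1 s := by
  simp only [indicator_apply, mem_Ico, mem_Ioc, Pi.one_apply]
  have h : (max a b - 1 < s ∧ s ≤ min a b) ↔
      ((0 ≤ a - s ∧ a - s < 1) ∧ (0 ≤ b - s ∧ b - s < 1)) := by
    rw [sub_lt_iff_lt_add, max_lt_iff, le_min_iff]
    constructor
    · rintro ⟨⟨h1, h2⟩, h3, h4⟩
      exact ⟨⟨by linarith, by linarith⟩, by linarith, by linarith⟩
    · rintro ⟨⟨h1, h2⟩, h3, h4⟩
      exact ⟨⟨by linarith, by linarith⟩, by linarith, by linarith⟩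
  rw [if_congr h rfl rfl]
  split_ifs <;> simp_all

lemma integrable_Ico_overlap (a b : ℝ) : Integrable fun s : ℝ =>
    (Ico (0 : ℝ) 1).indicator (1 : ℝ → ℝ) (a - s) * (Ico (0 : ℝ) 1).indicator 1 (b - s) := by
  simp only [indicator_Ico_overlap]
  exact (integrable_indicator_iff measurableSet_Ioc).2 (by simp [IntegrableOn, Pi.one_def])

lemma integral_Ico_overlap (a b : ℝ) : ∫ s : ℝ,
    (Ico (0 : ℝ) 1).indicator (1 : ℝ → ℝ) (a - s) * (Ico (0 : ℝ) 1).indicator 1 (b - s)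
      = max (1 - |a - b|) 0 := by
  simp only [indicator_Ico_overlap]
  rw [integral_indicator_one measurableSet_Ioc]
  simp only [Measure.real, Real.volume_Ioc, ENNReal.toReal_ofReal']
  congr 1
  rcases le_total a b with h | h
  · rw [max_eq_right h, min_eq_left h, abs_of_nonpos (by linarith)]; ring
  · rw [max_eq_left h, min_eq_right h, abs_of_nonneg (by linarith)]; ring

/-- The parallelepiped cell with corner `s` in the coordinates `v`. -/
def slabCell (v : Fin 3 → E3) (s : Fin 3 → ℝ) : Set E3 :=
  {x | ∀ i, inner ℝ (v i) x - s i ∈ Ico (0 : ℝ) 1}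

lemma slabCell_indicator (v : Fin 3 → E3) (s : Fin 3 → ℝ) (x : E3) :
    (slabCell v s).indicator (1 : E3 → ℝ) x
      = ∏ i, (Ico (0 : ℝ) 1).indicator 1 (inner ℝ (v i) x - s i) := by
  by_cases h : x ∈ slabCell v s
  · rw [indicator_of_mem h, Finset.prod_eq_one]
    · rfl
    · intro i _
      rw [indicator_of_mem (h i)]; rfl
  · rw [indicator_of_notMem h]
    simp only [slabCell, mem_ofPred_eq, not_forall] at h
    obtain ⟨i, hi⟩ := h
    rw [Finset.prod_eq_zero (Finset.mem_univ i)]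
    rw [indicator_of_notMem hi]

lemma measurableSet_slabCell (v : Fin 3 → E3) (s : Fin 3 → ℝ) : MeasurableSet (slabCell v s) := by
  unfold slabCell
  rw [ofPred_forall]
  refine MeasurableSet.iInter fun i => ?_
  exact measurableSet_Ico.preimage (by fun_prop : Measurable fun x : E3 => inner ℝ (v i) x - s i)

lemma slab_mixture (v : Fin 3 → E3) (x y : E3) :
    Integrable (fun s : Fin 3 → ℝ => (slabCell v s).indicator (1 : E3 → ℝ) x *
      (slabCell v s).indicator (1 : E3 → ℝ) y) ∧
    ∫ s : Fin 3 → ℝ, (slabCell v s).indicator (1 : E3 → ℝ) x *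
      (slabCell v s).indicator (1 : E3 → ℝ) y = tri v (x - y) := by
  simp only [slabCell_indicator, ← Finset.prod_mul_distrib]
  constructor
  · exact Integrable.fintype_prod (μ := fun _ => volume) (f := fun i s =>
      (Ico (0 : ℝ) 1).indicator (1 : ℝ → ℝ) (inner ℝ (v i) x - s) *
      (Ico (0 : ℝ) 1).indicator 1 (inner ℝ (v i) y - s)) fun i => integrable_Ico_overlap _ _
  · rw [integral_fintype_prod_volume_eq_prod (f := fun i s =>
      (Ico (0 : ℝ) 1).indicator (1 : ℝ → ℝ) (inner ℝ (v i) x - s) *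
      (Ico (0 : ℝ) 1).indicator 1 (inner ℝ (v i) y - s))]
    simp only [integral_Ico_overlap, tri, inner_sub_right]

lemma measurable_slabCell_indicator (v : Fin 3 → E3) :
    Measurable fun p : (Fin 3 → ℝ) × E3 => (slabCell v p.1).indicator (1 : E3 → ℝ) p.2 := by
  simp only [slabCell_indicator]
  refine Finset.measurable_prod _ fun i _ => ?_
  exact (measurable_one.indicator measurableSet_Ico).comp
    (by fun_prop : Measurable fun p : (Fin 3 → ℝ) × E3 => inner ℝ (v i) p.2 - p.1 i)

lemma PD.tri_mul {k : E3 → E3 → ℝ} (hk : PD k) (hm : Measurable (Function.uncurry k))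
    (h0 : ∀ x y, 0 ≤ k x y) (c : ℝ) (hc : ∀ x y, k x y ≤ c) (v : Fin 3 → E3) :
    PD (fun x y => tri v (x - y) * k x y) := by
  have i0 : ∀ (s : Fin 3 → ℝ) x, 0 ≤ (slabCell v s).indicator (1 : E3 → ℝ) x :=
    fun s x => indicator_nonneg (fun _ _ => zero_le_one) _
  refine PD.mix (L := (volume : Measure (Fin 3 → ℝ))) (f := fun s x y =>
    (slabCell v s).indicator (1 : E3 → ℝ) x * (slabCell v s).indicator (1 : E3 → ℝ) y * k x y)
    (fun s => PD.indicator hk (measurableSet_slabCell v s)) ?_ ?_ ?_ ?_ ?_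
  · refine Adm.of_bdd ?_ (fun x y => mul_nonneg (tri_nonneg _ _) (h0 x y)) c fun x y =>
      (mul_le_of_le_one_left (h0 x y) (tri_le_one _ _)).trans (hc x y)
    have h1 : Measurable fun p : E3 × E3 => p.1 - p.2 := by fun_prop
    exact ((measurable_tri v).comp h1).mul hm
  · have h1 : Measurable fun p : (Fin 3 → ℝ) × E3 × E3 => (p.1, p.2.1) := by fun_prop
    have h2 : Measurable fun p : (Fin 3 → ℝ) × E3 × E3 => (p.1, p.2.2) := by fun_prop
    have h3 : Measurable fun p : (Fin 3 → ℝ) × E3 × E3 => k p.2.1 p.2.2 := hm.comp measurable_snd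
    exact (((measurable_slabCell_indicator v).comp h1).mul
      ((measurable_slabCell_indicator v).comp h2)).mul h3
  · exact fun s x y => mul_nonneg (mul_nonneg (i0 _ _) (i0 _ _)) (h0 x y)
  · exact fun x y => (slab_mixture v x y).1.mul_const _
  · intro x y
    rw [integral_mul_const, (slab_mixture v x y).2]

lemma En_lower {k : E3 → E3 → ℝ} (hk : Adm k) (X : Finset E3) {C : Set E3} (c : ℝ)
    (hc : ∀ x, ∫ y in C, k x y ≤ c) : -(X.card * c) ≤ En k X C := by
  unfold En
  have h1 : 0 ≤ ∑ x ∈ X, ∑ y ∈ X, k x y :=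
    Finset.sum_nonneg fun x _ => Finset.sum_nonneg fun y _ => hk.nonneg x y
  have h2 : 0 ≤ ∫ p, k p.1 p.2 ∂((volume.restrict C).prod (volume.restrict C)) :=
    integral_nonneg fun p => hk.nonneg _ _
  have h3 : ∑ x ∈ X, (∫ y in C, k x y) ≤ X.card * c := by
    simpa using Finset.sum_le_card_nsmul X _ c fun x _ => hc x
  linarith

lemma integrable_yukawa_sub (x : E3) : Integrable fun y => rexp (-(1 * ‖x - y‖)) * kap x y := by
  simpa [kap] using integrable_yukawa.comp_sub_left x

lemma integral_yukawa_sub (x : E3) : ∫ y, rexp (-(1 * ‖x - y‖)) * kap x y = cYuk := by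
  simp only [kap, one_mul]
  exact integral_sub_left_eq_self (fun y : E3 => rexp (-‖y‖) * ‖y‖⁻¹) volume x

/-- Stability of the localized Coulomb interaction. -/
lemma En_locK_lower (v : Fin 3 → E3) (X : Finset E3) {C : Set E3} (hC : MeasurableSet C)
    (hC' : volume C ≠ ⊤) : -(X.card * (1 / 2 + cYuk)) ≤ En (locK v) X C := by
  have hm : Measurable fun p : E3 × E3 => tri v (p.1 - p.2) := (measurable_tri v).comp (by fun_prop)
  have a1 : Adm fun x y => tri v (x - y) * (rexp (-(1 * ‖x - y‖)) * kap x y) := by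
    have := adm_exp_kap (b := 1) zero_le_one
    refine Adm.of_le (hm.mul this.meas) (fun x y => mul_nonneg (tri_nonneg _ _) (this.nonneg x y))
      fun x y => (mul_le_of_le_one_left (this.nonneg x y) (tri_le_one _ _)).trans ?_
    refine mul_le_of_le_one_left (kap_nonneg _ _) ?_
    simp
  have a2 : Adm fun x y => tri v (x - y) * kapLong 1 x y := by
    have := adm_kapLong (b := 1) zero_le_one
    exact Adm.of_bdd (hm.mul this.meas) (fun x y => mul_nonneg (tri_nonneg _ _) (this.nonneg x y)) 1
      fun x y => (mul_le_of_le_one_left (this.nonneg x y) (tri_le_one _ _)).trans (kapLong_le 1 x y)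
  have a3 : Adm fun x y : E3 => if x = y then (1 : ℝ) else 0 := by
    refine Adm.of_bdd ?_ (fun x y => by positivity) 1 fun x y => by split_ifs <;> simp
    unfold Function.uncurry
    exact Measurable.ite (measurableSet_eq_fun (by fun_prop) (by fun_prop)) (by fun_prop)
      (by fun_prop)
  have e : (fun x y => locK v x y + if x = y then 1 else 0) = fun x y =>
      tri v (x - y) * (rexp (-(1 * ‖x - y‖)) * kap x y) + tri v (x - y) * kapLong 1 x y := by
    funext x y
    have := kap_split 1 x y
    unfold locK
    rw [← mul_add, ← this]
    split_ifs with h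
    · simp [h, tri_zero]
    · simp
  have h := En_add (adm_locK v) a3 X hC'
  rw [e, En_add a1 a2 X hC', En_diag] at h
  have p2 := PD.tri_mul (PD.kapLong zero_le_one) (measurable_kapLong 1) (kapLong_nonneg zero_le_one)
    1 (kapLong_le 1) v X C hC hC'
  have p1 := En_lower a1 X (C := C) cYuk fun x => by
    rw [← integral_yukawa_sub x]
    refine (setIntegral_mono (a1.integrableOn hC' x) (integrable_yukawa_sub x).integrableOn
      fun y => ?_).trans (setIntegral_le_integral (integrable_yukawa_sub x)
        (Eventually.of_forall fun y => mul_nonneg (exp_pos _).le (kap_nonneg _ _)))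
    exact mul_le_of_le_one_left (mul_nonneg (exp_pos _).le (kap_nonneg _ _)) (tri_le_one _ _)
  linarith

lemma locK_zero : locK 0 = kap := by
  funext x y; simp [locK, tri]

lemma measurable_kapE_comp {α : Type*} [MeasurableSpace α] {f g : α → E3} (hf : Measurable f)
    (hg : Measurable g) : Measurable fun a => kapE (f a) (g a) :=
  (hf.sub hg).enorm.inv

/-- Twice the pair interaction of a configuration, in `ℝ≥0∞`. -/
def pairE {N : ℕ} (z : Fin N → E3) : ℝ≥0∞ := ∑ i, ∑ j, if i = j then 0 else kapE (z i) (z j)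

lemma measurable_pairE {N : ℕ} : Measurable (pairE : (Fin N → E3) → ℝ≥0∞) := by
  unfold pairE
  refine Finset.measurable_sum _ fun i _ => Finset.measurable_sum _ fun j _ => ?_
  split_ifs
  · fun_prop
  · exact measurable_kapE_comp (measurable_pi_apply i) (measurable_pi_apply j)

/-- Mutual Coulomb energy of two measures. -/
def mutE (μ ν : Measure E3) : ℝ≥0∞ := ∫⁻ x, ∫⁻ y, kapE x y ∂ν ∂μ

lemma measurable_pot (ν : Measure E3) [SFinite ν] : Measurable fun x => ∫⁻ y, kapE x y ∂ν :=
  Measurable.lintegral_prod_right measurable_kapE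

lemma mutE_comm (μ ν : Measure E3) [SFinite μ] [SFinite ν] : mutE μ ν = mutE ν μ := by
  unfold mutE
  rw [lintegral_lintegral_swap measurable_kapE.aemeasurable]
  simp only [kapE_comm]

lemma mutE_add_left (μ μ' ν : Measure E3) : mutE (μ + μ') ν = mutE μ ν + mutE μ' ν :=
  lintegral_add_measure _ _ _

lemma mutE_add_right (μ ν ν' : Measure E3) [SFinite ν] :
    mutE μ (ν + ν') = mutE μ ν + mutE μ ν' := by
  unfold mutE
  simp only [lintegral_add_measure]
  exact lintegral_add_left (measurable_pot ν) _

lemma mutE_map_add (μ : Measure E3) [SFinite μ] (a : E3) :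
    mutE (μ.map (fun x => x + a)) (μ.map (fun x => x + a)) = mutE μ μ := by
  unfold mutE
  rw [lintegral_map (measurable_pot _) (by fun_prop)]
  refine lintegral_congr fun x => ?_
  rw [lintegral_map (measurable_kapE_comp (by fun_prop) (by fun_prop)) (by fun_prop)]
  simp [kapE]

lemma mutE_smul {c : ℝ≥0∞} (hc : c ≠ ⊤) (μ : Measure E3) :
    mutE (c • μ) (c • μ) = c * c * mutE μ μ := by
  unfold mutE
  rw [lintegral_smul_measure]
  simp only [lintegral_smul_measure, smul_eq_mul]
  rw [lintegral_const_mul' _ _ hc, mul_assoc]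

lemma mutE_sum_ge {ι : Type*} (s : Finset ι) (m : ι → Measure E3) :
    ∑ b ∈ s, mutE (m b) (m b) ≤ mutE (∑ b ∈ s, m b) (∑ b ∈ s, m b) := by
  unfold mutE
  rw [lintegral_finsetSum_measure]
  refine Finset.sum_le_sum fun b hb => lintegral_mono fun x => lintegral_mono' ?_ le_rfl
  exact Finset.single_le_sum (f := m) (fun _ _ => Measure.zero_le _) hb

lemma mutE_ne_top {μ ν : Measure E3} [IsFiniteMeasure μ] [IsFiniteMeasure ν] (hν : ν ≤ volume) :
    mutE μ ν ≠ ⊤ := by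
  have : mutE μ ν ≤ ∫⁻ _, (ENNReal.ofReal cYuk + ν univ) ∂μ :=
    lintegral_mono fun x => lintegral_kapE_le hν x
  refine ne_top_of_le_ne_top ?_ this
  simp
  finiteness

/-- `St N μ w`: some `N`-particle state has density `μ ≤ 1` and twice its indirect energy is at most
`w`. -/
def St (N : ℕ) (μ : Measure E3) (w : ℝ) : Prop :=
  μ ≤ volume ∧ ∃ P : Measure (Fin N → E3), IsProbabilityMeasure P ∧
    ∑ j, P.map (fun z => z j) = μ ∧ ∫⁻ z, pairE z ∂P ≠ ⊤ ∧
    (∫⁻ z, pairE z ∂P).toReal ≤ (mutE μ μ).toReal + w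

lemma sum_map_univ {N : ℕ} (P : Measure (Fin N → E3)) [IsProbabilityMeasure P] :
    (∑ j, P.map (fun z => z j)) univ = N := by
  have h : ∀ j : Fin N, IsProbabilityMeasure (P.map (fun z => z j)) := fun j =>
    Measure.isProbabilityMeasure_map (measurable_pi_apply j).aemeasurable
  simp

lemma St.univ_eq {N : ℕ} {μ : Measure E3} {w : ℝ} (h : St N μ w) : μ univ = N := by
  obtain ⟨-, P, hP, rfl, -⟩ := h
  exact sum_map_univ P

lemma St.isFinite {N : ℕ} {μ : Measure E3} {w : ℝ} (h : St N μ w) : IsFiniteMeasure μ :=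
  ⟨by rw [h.univ_eq]; simp⟩

lemma lintegral_sum_map {N : ℕ} (P : Measure (Fin N → E3)) {f : E3 → ℝ≥0∞} (hf : Measurable f) :
    ∫⁻ z, ∑ j, f (z j) ∂P = ∫⁻ x, f x ∂(∑ j, P.map (fun z => z j)) := by
  rw [lintegral_finsetSum (f := fun j (z : Fin N → E3) => f (z j)) _
      fun j _ => hf.comp (measurable_pi_apply j),
    lintegral_finsetSum_measure]
  refine Finset.sum_congr rfl fun j _ => ?_
  rw [lintegral_map hf (by fun_prop)]

lemma pairE_append {N M : ℕ} (a : Fin N → E3) (b : Fin M → E3) :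
    pairE (Fin.append a b) = pairE a + pairE b + 2 * ∑ i, ∑ j, kapE (a i) (b j) := by
  unfold pairE
  have h1 : ∀ (i : Fin N) (j : Fin M), Fin.castAdd M i ≠ Fin.natAdd N j := by
    intro i j h
    have := congrArg Fin.val h
    simp at this
    have := i.2
    omega
  simp only [Fin.sum_univ_add, Fin.append_left, Fin.append_right, Fin.castAdd_inj, Fin.natAdd_inj,
    h1, (h1 _ _).symm, if_false, Finset.sum_add_distrib]
  have : ∑ x, ∑ y, kapE (b x) (a y) = ∑ x, ∑ y, kapE (a x) (b y) := by
    rw [Finset.sum_comm]; simp only [kapE_comm]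
  rw [this]
  ring

lemma measurable_append {N M : ℕ} :
    Measurable fun p : (Fin N → E3) × (Fin M → E3) => Fin.append p.1 p.2 := by
  refine measurable_pi_lambda _ fun i => ?_
  refine Fin.addCases (fun i => ?_) (fun i => ?_) i
  · simp only [Fin.append_left]; fun_prop
  · simp only [Fin.append_right]; fun_prop

lemma St.add {N M : ℕ} {μ ν : Measure E3} {w w' : ℝ} (h : St N μ w) (h' : St M ν w')
    (hle : μ + ν ≤ volume) : St (N + M) (μ + ν) (w + w') := by
  have i1 := h.isFinite
  have i2 := h'.isFinite
  obtain ⟨hμ, P, hP, hPm, hPf, hPw⟩ := h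
  obtain ⟨hν, Q, hQ, hQm, hQf, hQw⟩ := h'
  have cross : ∫⁻ p, ∑ i, ∑ j, kapE (p.1 i) (p.2 j) ∂(P.prod Q) = mutE μ ν := by
    have hm : Measurable fun p : (Fin N → E3) × (Fin M → E3) => ∑ i, ∑ j, kapE (p.1 i) (p.2 j) :=
      Finset.measurable_sum _ fun i _ => Finset.measurable_sum _ fun j _ =>
        measurable_kapE_comp (by fun_prop) (by fun_prop)
    rw [lintegral_prod _ hm.aemeasurable]
    have : ∀ z : Fin N → E3, ∫⁻ y : Fin M → E3, ∑ i, ∑ j, kapE (z i) (y j) ∂Q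
        = ∑ i, ∫⁻ y, kapE (z i) y ∂ν := by
      intro z
      rw [lintegral_finsetSum _ fun i _ => Finset.measurable_sum _ fun j _ =>
        measurable_kapE_comp (by fun_prop) (by fun_prop)]
      refine Finset.sum_congr rfl fun i _ => ?_
      rw [← hQm]
      exact lintegral_sum_map Q (measurable_kapE_comp (by fun_prop) (by fun_prop))
    simp only [this]
    rw [lintegral_sum_map P (measurable_pot ν), hPm, mutE]
  have hprob : IsProbabilityMeasure ((P.prod Q).map fun p => Fin.append p.1 p.2) :=
    Measure.isProbabilityMeasure_map measurable_append.aemeasurable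
  have en : ∫⁻ z, pairE z ∂((P.prod Q).map fun p => Fin.append p.1 p.2)
      = ∫⁻ z, pairE z ∂P + ∫⁻ z, pairE z ∂Q + 2 * mutE μ ν := by
    rw [lintegral_map measurable_pairE measurable_append]
    simp only [pairE_append]
    have m1 : Measurable fun p : (Fin N → E3) × (Fin M → E3) => pairE p.1 :=
      measurable_pairE.comp measurable_fst
    have m2 : Measurable fun p : (Fin N → E3) × (Fin M → E3) => pairE p.2 :=
      measurable_pairE.comp measurable_snd
    rw [lintegral_add_left (f := fun p : (Fin N → E3) × (Fin M → E3) => pairE p.1 + pairE p.2)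
        (m1.add m2), lintegral_add_left m1, lintegral_const_mul' _ _ (by simp),
      cross]
    congr 2
    · rw [lintegral_prod _ m1.aemeasurable]; simp
    · rw [lintegral_prod _ m2.aemeasurable]; simp
  refine ⟨hle, _, hprob, ?_, ?_, ?_⟩
  · rw [Fin.sum_univ_add, ← hPm, ← hQm]
    congr 1
    · refine Finset.sum_congr rfl fun i _ => ?_
      rw [Measure.map_map (by fun_prop) measurable_append]
      simp only [Function.comp_def, Fin.append_left]
      have : (fun x : (Fin N → E3) × (Fin M → E3) => x.1 i) = (fun z => z i) ∘ Prod.fst := rfl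
      rw [this, ← Measure.map_map (by fun_prop) (by fun_prop)]
      simp
    · refine Finset.sum_congr rfl fun i _ => ?_
      rw [Measure.map_map (by fun_prop) measurable_append]
      simp only [Function.comp_def, Fin.append_right]
      have : (fun x : (Fin N → E3) × (Fin M → E3) => x.2 i) = (fun z => z i) ∘ Prod.snd := rfl
      rw [this, ← Measure.map_map (by fun_prop) (by fun_prop)]
      simp
  · rw [en]
    have := mutE_ne_top (μ := μ) hν
    finiteness
  · have f1 := mutE_ne_top (μ := μ) hμ
    have f2 := mutE_ne_top (μ := μ) hν
    have f3 := mutE_ne_top (μ := ν) hν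
    rw [en, mutE_add_left, mutE_add_right, mutE_add_right, mutE_comm ν μ,
      ENNReal.toReal_add (by finiteness) (by finiteness),
      ENNReal.toReal_add (by finiteness) (by finiteness),
      ENNReal.toReal_add (by finiteness) (by finiteness),
      ENNReal.toReal_add (by finiteness) (by finiteness),
      ENNReal.toReal_add (by finiteness) (by finiteness), ENNReal.toReal_mul]
    simp only [ENNReal.toReal_ofNat]
    linarith

lemma St.zero : St 0 0 0 := by
  refine ⟨Measure.zero_le _, Measure.dirac (fun i => i.elim0), inferInstance, by simp, ?_, ?_⟩
  · simp [pairE]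
  · simp [pairE]

lemma St.sum {ι : Type*} (s : Finset ι) {N : ι → ℕ} {μ : ι → Measure E3} {w : ι → ℝ}
    (h : ∀ i ∈ s, St (N i) (μ i) (w i)) (hle : ∑ i ∈ s, μ i ≤ volume) :
    St (∑ i ∈ s, N i) (∑ i ∈ s, μ i) (∑ i ∈ s, w i) := by
  induction s using Finset.induction_on with
  | empty => simpa using St.zero
  | insert a s ha ih =>
    rw [Finset.sum_insert ha] at hle ⊢
    rw [Finset.sum_insert ha, Finset.sum_insert ha]
    exact (h a (by simp)).add (ih (fun i hi => h i (by simp [hi]))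
      ((Measure.le_add_left le_rfl).trans hle)) hle

lemma St.mono {N : ℕ} {μ : Measure E3} {w w' : ℝ} (h : St N μ w) (hw : w ≤ w') : St N μ w' := by
  obtain ⟨h1, P, h2, h3, h4, h5⟩ := h
  exact ⟨h1, P, h2, h3, h4, by linarith⟩

lemma St.single {ν : Measure E3} [IsProbabilityMeasure ν] (hν : ν ≤ volume) : St 1 ν 0 := by
  have hm : Measurable fun (x : E3) (_ : Fin 1) => x := by fun_prop
  refine ⟨hν, ν.map (fun x _ => x), Measure.isProbabilityMeasure_map hm.aemeasurable, ?_, ?_, ?_⟩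
  · simp only [Fin.sum_univ_one]
    rw [Measure.map_map (by fun_prop) hm]
    simp [Function.comp_def]
  · simp [pairE]
  · simp [pairE]

/-- The fluid state. -/
lemma St.fluid {N : ℕ} {μ : Measure E3} (hμ : μ ≤ volume) (hN : μ univ = N) : St N μ 0 := by
  rcases Nat.eq_zero_or_pos N with rfl | hpos
  · have : μ = 0 := by simpa using hN
    rw [this]; exact St.zero
  have h0 : (N : ℝ≥0∞) ≠ 0 := by simpa using hpos.ne'
  have hp : IsProbabilityMeasure ((N : ℝ≥0∞)⁻¹ • μ) := ⟨by
    simp [hN, ENNReal.inv_mul_cancel h0 (ENNReal.natCast_ne_top N)]⟩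
  have hle : (N : ℝ≥0∞)⁻¹ • μ ≤ volume := by
    refine le_trans ?_ hμ
    intro s
    simp only [Measure.smul_apply, smul_eq_mul]
    refine mul_le_of_le_one_left' ?_
    simpa using Nat.succ_le_iff.2 hpos
  have hs : ∑ _i : Fin N, (N : ℝ≥0∞)⁻¹ • μ = μ := by
    rw [Finset.sum_const, Finset.card_univ, Fintype.card_fin, ← Nat.cast_smul_eq_nsmul ℝ≥0∞,
      smul_smul, ENNReal.mul_inv_cancel h0 (ENNReal.natCast_ne_top N), one_smul]
  have := St.sum (Finset.univ : Finset (Fin N)) (N := fun _ => 1) (w := fun _ => 0)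
    (fun i _ => St.single hle) (by rw [hs]; exact hμ)
  rw [hs] at this
  simpa using this

lemma St.pack {ι : Type*} (s : Finset ι) {N : ι → ℕ} {μ : ι → Measure E3} {w : ι → ℝ}
    (h : ∀ i ∈ s, St (N i) (μ i) (w i)) {ν : Measure E3} (hν : ν ≤ volume) {M : ℕ}
    (hM : ν univ = M) (hle : ∑ i ∈ s, μ i ≤ ν) : St M ν (∑ i ∈ s, w i) := by
  have h1 := St.sum s h (hle.trans hν)
  have hf : IsFiniteMeasure (∑ i ∈ s, μ i) := h1.isFinite
  have e := Measure.sub_add_cancel_of_le hle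
  have hu := congrArg (fun m => m univ) e
  simp only [Measure.add_apply, h1.univ_eq, hM] at hu
  have hN : ∑ i ∈ s, N i ≤ M := by
    have : ((∑ i ∈ s, N i : ℕ) : ℝ≥0∞) ≤ M := by rw [← hu]; exact le_add_self
    exact_mod_cast this
  obtain ⟨R, rfl⟩ := Nat.exists_eq_add_of_le hN
  have hR : (ν - ∑ i ∈ s, μ i) univ = R := by
    have h3 : ((∑ i ∈ s, N i : ℕ) : ℝ≥0∞) ≠ ⊤ := ENNReal.natCast_ne_top _
    rw [Nat.cast_add, add_comm] at hu
    exact (ENNReal.add_right_inj h3).1 hu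
  have h2 := St.fluid (Measure.sub_le.trans hν) hR
  have := h1.add h2 (by rw [add_comm, e]; exact hν)
  rw [add_comm (∑ i ∈ s, μ i), e] at this
  simpa using this

lemma St.translate {N : ℕ} {μ : Measure E3} {w : ℝ} (h : St N μ w) (a : E3) :
    St N (μ.map (fun x => x + a)) w := by
  obtain ⟨h1, P, h2, h3, h4, h5⟩ := h
  have hm : Measurable fun (z : Fin N → E3) i => z i + a := by fun_prop
  have hp : ∀ z : Fin N → E3, pairE (fun i => z i + a) = pairE z := by
    intro z; simp [pairE, kapE]
  have hfin : IsFiniteMeasure μ := St.isFinite ⟨h1, P, h2, h3, h4, h5⟩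
  have hI := mutE_map_add μ a
  refine ⟨?_, P.map _, Measure.isProbabilityMeasure_map hm.aemeasurable, ?_, ?_, ?_⟩
  · calc μ.map (fun x => x + a) ≤ Measure.map (fun x => x + a) volume :=
          Measure.map_mono h1 (by fun_prop)
      _ = volume := map_add_right_eq_self _ _
  · have ha : Measurable fun x : E3 => x + a := by fun_prop
    rw [← h3, ← Measure.mapₗ_apply_of_measurable ha, map_sum]
    refine Finset.sum_congr rfl fun i _ => ?_
    rw [Measure.mapₗ_apply_of_measurable ha, Measure.map_map (by fun_prop) hm,
      Measure.map_map (by fun_prop) (by fun_prop)]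
    rfl
  · rw [lintegral_map measurable_pairE hm]; simpa only [hp] using h4
  · rw [lintegral_map measurable_pairE hm, hI]; simpa only [hp] using h5

/-- Lebesgue measure on `[0, 1)`. -/
abbrev unifIco : Measure ℝ := volume.restrict (Ico 0 1)

instance : IsProbabilityMeasure unifIco := ⟨by simp⟩

lemma fract_add_eq {a t : ℝ} (ha : a ∈ Ico (0 : ℝ) 1) (ht : t ∈ Ico (0 : ℝ) 1) :
    Int.fract (a + t) = if t < 1 - a then a + t else a + t - 1 := by
  have h1 := ha.1
  have h2 := ha.2
  have h3 := ht.1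
  have h4 := ht.2
  split_ifs with h
  · rw [Int.fract_eq_iff]
    exact ⟨by linarith, by linarith, 0, by simp⟩
  · rw [Int.fract_eq_iff]
    exact ⟨by linarith, by linarith, 1, by push_cast; ring⟩

lemma measurePreserving_fract_add (a : ℝ) :
    MeasurePreserving (fun t => Int.fract (a + t)) unifIco unifIco := by
  have hm : ∀ b : ℝ, Measurable fun t : ℝ => Int.fract (b + t) := fun b =>
    measurable_fract.comp (by fun_prop)
  have ha : Int.fract a ∈ Ico (0 : ℝ) 1 := ⟨Int.fract_nonneg _, Int.fract_lt_one _⟩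
  have h0 : (fun t => Int.fract (a + t)) = fun t => Int.fract (Int.fract a + t) := by
    funext t
    rw [Int.fract_eq_fract]
    exact ⟨⌊a⌋, by rw [Int.fract]; ring⟩
  rw [h0]
  set b := Int.fract a
  refine ⟨hm b, Measure.ext fun A hA => ?_⟩
  have hb1 := ha.1
  have hb2 := ha.2
  rw [Measure.map_apply (hm b) hA, Measure.restrict_apply (hm b hA), Measure.restrict_apply hA]
  have e1 : (fun t => Int.fract (b + t)) ⁻¹' A ∩ Ico 0 1 =
      ((fun t => b + t) ⁻¹' (A ∩ Ico b 1)) ∪ ((fun t => b - 1 + t) ⁻¹' (A ∩ Ico 0 b)) := by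
    ext t
    constructor
    · rintro ⟨h1, h2⟩
      rw [mem_preimage, fract_add_eq ha h2] at h1
      split_ifs at h1 with h
      · exact Or.inl ⟨h1, by linarith [h2.1], by linarith⟩
      · refine Or.inr ⟨?_, ?_, ?_⟩
        · change b - 1 + t ∈ A
          rwa [show b - 1 + t = b + t - 1 by ring]
        · linarith
        · linarith [h2.2]
    · rintro (⟨h1, h2, h3⟩ | ⟨h1, h2, h3⟩)
      · have ht : t ∈ Ico (0 : ℝ) 1 := ⟨by linarith, by linarith⟩
        refine ⟨?_, ht⟩
        rw [mem_preimage, fract_add_eq ha ht, if_pos (by linarith)]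
        exact h1
      · have ht : t ∈ Ico (0 : ℝ) 1 := ⟨by linarith, by linarith⟩
        refine ⟨?_, ht⟩
        rw [mem_preimage, fract_add_eq ha ht, if_neg (by linarith)]
        change b - 1 + t ∈ A at h1
        rwa [show b - 1 + t = b + t - 1 by ring] at h1
  have e2 : A ∩ Ico 0 1 = (A ∩ Ico b 1) ∪ (A ∩ Ico 0 b) := by
    rw [← inter_union_distrib_left, union_comm, Ico_union_Ico_eq_Ico hb1 hb2.le]
  have m1 : MeasurableSet (A ∩ Ico 0 b) := hA.inter measurableSet_Ico
  rw [e1, e2, measure_union _ (m1.preimage (by fun_prop)), measure_union _ m1,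
    measure_preimage_add, measure_preimage_add]
  · refine Set.disjoint_left.2 fun t h1 h2 => ?_
    exact absurd h1.2.1 (not_le.2 h2.2.2)
  · refine Set.disjoint_left.2 fun t h1 h2 => ?_
    have := h1.2.1
    have := h1.2.2
    have := h2.2.1
    simp only at *
    linarith

lemma ofReal_max_zero (a : ℝ) : ENNReal.ofReal (max a 0) = ENNReal.ofReal a := by
  rcases le_total a 0 with h | h
  · rw [max_eq_right h, ENNReal.ofReal_of_nonpos h, ENNReal.ofReal_zero]
  · rw [max_eq_left h]

lemma volume_floor_eq (a b : ℝ) :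
    unifIco {t | ⌊a + t⌋ = ⌊b + t⌋} = ENNReal.ofReal (max (1 - |a - b|) 0) := by
  wlog h : a ≤ b generalizing a b
  · rw [abs_sub_comm, ← this b a (le_of_not_ge h)]
    simp only [eq_comm]
  have e : {t | ⌊a + t⌋ = ⌊b + t⌋} = (fun t => Int.fract (a + t)) ⁻¹' {u | ⌊u + (b - a)⌋ = 0} := by
    ext t
    have : b + t = Int.fract (a + t) + (b - a) + ⌊a + t⌋ := by rw [Int.fract]; ring
    simp only [mem_ofPred_eq, mem_preimage]
    rw [this, Int.floor_add_intCast]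
    omega
  have hm : MeasurableSet {u : ℝ | ⌊u + (b - a)⌋ = 0} :=
    (measurableSet_singleton (0 : ℤ)).preimage (Int.measurable_floor.comp (by fun_prop))
  rw [e, (measurePreserving_fract_add a).measure_preimage hm.nullMeasurableSet,
    Measure.restrict_apply hm]
  have e2 : {u : ℝ | ⌊u + (b - a)⌋ = 0} ∩ Ico 0 1 = Ico 0 (1 - (b - a)) := by
    ext u
    simp only [Int.floor_eq_zero_iff, mem_inter_iff, mem_ofPred_eq, mem_Ico]
    constructor
    · rintro ⟨⟨h1, h2⟩, h3, h4⟩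
      exact ⟨h3, by linarith⟩
    · rintro ⟨h3, h4⟩
      exact ⟨⟨by linarith, by linarith⟩, h3, by linarith⟩
  rw [e2, Real.volume_Ico, sub_zero, abs_of_nonpos (by linarith), neg_sub,
    ofReal_max_zero]

/-- Lebesgue measure on the unit cube of `ℝ³`. -/
abbrev unifCube : Measure (Fin 3 → ℝ) := Measure.pi fun _ => unifIco

lemma measurePreserving_fract_cube (a : Fin 3 → ℝ) :
    MeasurePreserving (fun (θ : Fin 3 → ℝ) i => Int.fract (a i + θ i)) unifCube unifCube :=
  measurePreserving_pi _ _ fun i => measurePreserving_fract_add (a i)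

lemma volume_floor_cube (a b : Fin 3 → ℝ) :
    unifCube {θ | (fun i => ⌊a i + θ i⌋) = fun i => ⌊b i + θ i⌋}
      = ENNReal.ofReal (∏ i, max (1 - |a i - b i|) 0) := by
  have : {θ : Fin 3 → ℝ | (fun i => ⌊a i + θ i⌋) = fun i => ⌊b i + θ i⌋}
      = Set.pi univ fun i => {t | ⌊a i + t⌋ = ⌊b i + t⌋} := by
    ext θ; simp [funext_iff]
  rw [this, Measure.pi_pi, ENNReal.ofReal_prod_of_nonneg fun i _ => le_max_right _ _]
  simp only [volume_floor_eq]

lemma unifCube_eq : unifCube = volume.restrict (Set.pi univ fun _ : Fin 3 => Ico (0 : ℝ) 1) := by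
  rw [volume_pi, Measure.restrict_pi_pi]

/-- The self-energy of a translation-invariant kernel on the unit cube. -/
lemma lintegral_unifCube_sub {k : (Fin 3 → ℝ) → ℝ≥0∞} (hk : Measurable k) :
    ∫⁻ θ, ∫⁻ η, k (θ - η) ∂unifCube ∂unifCube
      = ∫⁻ ζ, ENNReal.ofReal (∏ i, max (1 - |ζ i|) 0) * k ζ := by
  set B : Set (Fin 3 → ℝ) := Set.pi univ fun _ : Fin 3 => Ico (0 : ℝ) 1 with hB
  have mB : MeasurableSet B := MeasurableSet.univ_pi fun _ => measurableSet_Ico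
  have e1 : ∀ θ : Fin 3 → ℝ, ∫⁻ η in B, k (θ - η) = ∫⁻ ζ, B.indicator 1 (θ - ζ) * k ζ := by
    intro θ
    rw [← lintegral_indicator mB,
      ← lintegral_sub_left_eq_self (μ := volume) (fun ζ => B.indicator 1 (θ - ζ) * k ζ) θ]
    refine lintegral_congr fun η => ?_
    by_cases h : η ∈ B <;> simp [h]
  rw [unifCube_eq, ← hB]
  simp only [e1]
  rw [lintegral_lintegral_swap]
  · refine lintegral_congr fun ζ => ?_
    have m1 : Measurable fun θ : Fin 3 → ℝ => B.indicator (1 : (Fin 3 → ℝ) → ℝ≥0∞) (θ - ζ) :=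
      (measurable_one.indicator mB).comp (by fun_prop : Measurable fun θ : Fin 3 → ℝ => θ - ζ)
    rw [lintegral_mul_const _ m1]
    congr 1
    rw [← lintegral_indicator mB]
    have : ∀ θ : Fin 3 → ℝ, B.indicator (fun θ => B.indicator (1 : (Fin 3 → ℝ) → ℝ≥0∞) (θ - ζ)) θ
        = (Set.pi univ fun i => Ico (max 0 (ζ i)) (min 1 (1 + ζ i))).indicator 1 θ := by
      intro θ
      simp only [indicator_apply, hB, Set.mem_pi, mem_univ, true_imp_iff, mem_Ico, Pi.sub_apply,
        max_le_iff, lt_min_iff, Pi.one_apply]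
      have : (∀ i, (0 ≤ θ i ∧ ζ i ≤ θ i) ∧ θ i < 1 ∧ θ i < 1 + ζ i) ↔
          (∀ i, 0 ≤ θ i ∧ θ i < 1) ∧ ∀ i, 0 ≤ θ i - ζ i ∧ θ i - ζ i < 1 := by
        rw [← forall_and]
        refine forall_congr' fun i => ?_
        constructor
        · rintro ⟨⟨h1, h2⟩, h3, h4⟩
          exact ⟨⟨h1, h3⟩, by linarith, by linarith⟩
        · rintro ⟨⟨h1, h3⟩, h2, h4⟩
          exact ⟨⟨h1, by linarith⟩, h3, by linarith⟩
      rw [if_congr this rfl rfl, ite_and]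
    simp only [this]
    rw [lintegral_indicator_one (MeasurableSet.univ_pi fun _ => measurableSet_Ico),
      volume_pi_pi, ENNReal.ofReal_prod_of_nonneg fun i _ => le_max_right _ _]
    refine Finset.prod_congr rfl fun i _ => ?_
    rw [Real.volume_Ico]
    rcases le_total 0 (ζ i) with h | h
    · rw [max_eq_right h, min_eq_left (by linarith), abs_of_nonneg h, ofReal_max_zero]
    · rw [max_eq_left h, min_eq_right (by linarith), abs_of_nonpos h, ofReal_max_zero]
      congr 1
      ring
  · refine Measurable.aemeasurable (Measurable.mul ?_ (hk.comp measurable_snd))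
    exact (measurable_one.indicator mB).comp
      (by fun_prop : Measurable fun p : (Fin 3 → ℝ) × (Fin 3 → ℝ) => p.1 - p.2)

/-- The integer part of `T x + θ`. -/
def floorPt (T : E3 ≃L[ℝ] (Fin 3 → ℝ)) (x : E3) (θ : Fin 3 → ℝ) : Fin 3 → ℤ :=
  fun i => ⌊T x i + θ i⌋

/-- The point of the fundamental cell of `T` with coordinates `T x + θ` modulo integers. -/
def fractPt (T : E3 ≃L[ℝ] (Fin 3 → ℝ)) (x : E3) (θ : Fin 3 → ℝ) : E3 :=
  T.symm fun i => Int.fract (T x i + θ i)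

/-- The uniform probability measure on the fundamental cell of `T`. -/
def cellMeas (T : E3 ≃L[ℝ] (Fin 3 → ℝ)) : Measure E3 := unifCube.map T.symm

lemma measurable_floorPt (T : E3 ≃L[ℝ] (Fin 3 → ℝ)) (x : E3) : Measurable (floorPt T x) :=
  measurable_pi_lambda _ fun _ => Int.measurable_floor.comp (by fun_prop)

lemma measurable_fractPt (T : E3 ≃L[ℝ] (Fin 3 → ℝ)) (x : E3) : Measurable (fractPt T x) :=
  T.symm.continuous.measurable.comp
    (measurable_pi_lambda _ fun _ => measurable_fract.comp (by fun_prop))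

instance (T : E3 ≃L[ℝ] (Fin 3 → ℝ)) : IsProbabilityMeasure (cellMeas T) :=
  Measure.isProbabilityMeasure_map T.symm.continuous.measurable.aemeasurable

lemma map_fractPt (T : E3 ≃L[ℝ] (Fin 3 → ℝ)) (x : E3) :
    unifCube.map (fractPt T x) = cellMeas T := by
  have h := (measurePreserving_fract_cube (T x))
  rw [cellMeas, ← h.map_eq, Measure.map_map T.symm.continuous.measurable h.measurable, h.map_eq]
  rfl

lemma fractPt_mem (T : E3 ≃L[ℝ] (Fin 3 → ℝ)) (x : E3) (θ : Fin 3 → ℝ) (i : Fin 3) :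
    T (fractPt T x θ) i ∈ Ico (0 : ℝ) 1 := by
  simp [fractPt, Int.fract_nonneg, Int.fract_lt_one]

lemma fractPt_sub_of_floorPt_eq (T : E3 ≃L[ℝ] (Fin 3 → ℝ)) {x y : E3} {θ : Fin 3 → ℝ}
    (h : floorPt T x θ = floorPt T y θ) : fractPt T x θ - fractPt T y θ = x - y := by
  apply T.injective
  rw [map_sub, map_sub]
  funext i
  have hi : ⌊T x i + θ i⌋ = ⌊T y i + θ i⌋ := congrFun h i
  simp only [fractPt, Pi.sub_apply, ContinuousLinearEquiv.apply_symm_apply]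
  rw [Int.fract, Int.fract, hi]
  ring

lemma ae_mem_unitCube : ∀ᵐ θ ∂unifCube, ∀ i, θ i ∈ Ico (0 : ℝ) 1 := by
  rw [unifCube_eq]
  filter_upwards [ae_restrict_mem (MeasurableSet.univ_pi fun _ => measurableSet_Ico)] with θ hθ
  exact fun i => hθ i (mem_univ i)

section trial

variable {G : Type*} [AddCommGroup G] (T : E3 ≃L[ℝ] (Fin 3 → ℝ)) {N : ℕ}
  (x : Fin N → E3) (lab : (Fin 3 → ℤ) → G) (a : G → E3)

/-- The configuration in which all points sharing a lattice cell are moved together, by an amount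
depending on the cell and on the shift `s`. -/
def trialPt (s : G) (θ : Fin 3 → ℝ) (j : Fin N) : E3 :=
  fractPt T (x j) θ + a (lab (floorPt T (x j) θ) + s)

lemma measurable_trialPt (s : G) : Measurable (trialPt T x lab a s) := by
  refine measurable_pi_lambda _ fun j => (measurable_fractPt T (x j)).add ?_
  exact (measurable_of_countable fun l : Fin 3 → ℤ => a (lab l + s)).comp
    (measurable_floorPt T (x j))

variable [Fintype G]

/-- The law of `trialPt` for uniform `s` and `θ`. -/
def trialMeas : Measure (Fin N → E3) :=
  (Fintype.card G : ℝ≥0∞)⁻¹ • ∑ s, unifCube.map (trialPt T x lab a s)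

lemma card_mul_inv : (Fintype.card G : ℝ≥0∞)⁻¹ * Fintype.card G = 1 :=
  ENNReal.inv_mul_cancel (by simp) (by simp)

lemma isProb_trialMeas : IsProbabilityMeasure (trialMeas T x lab a) := by
  have h : ∀ s, IsProbabilityMeasure (unifCube.map (trialPt T x lab a s)) := fun s =>
    Measure.isProbabilityMeasure_map (measurable_trialPt T x lab a s).aemeasurable
  exact ⟨by simp [trialMeas, card_mul_inv]⟩

lemma map_sum_measure {α β ι : Type*} [MeasurableSpace α] [MeasurableSpace β] (s : Finset ι)
    (μ : ι → Measure α) {f : α → β} (hf : Measurable f) :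
    (∑ i ∈ s, μ i).map f = ∑ i ∈ s, (μ i).map f := by
  simp only [← Measure.mapₗ_apply_of_measurable hf, map_sum]

lemma trialMeas_marginal (j : Fin N) : (trialMeas T x lab a).map (fun z => z j)
    = (Fintype.card G : ℝ≥0∞)⁻¹ • ∑ b, (cellMeas T).map (fun u => u + a b) := by
  have hj : Measurable fun z : Fin N → E3 => z j := measurable_pi_apply j
  rw [trialMeas, Measure.map_smul, map_sum_measure _ _ hj]
  congr 1
  refine Measure.ext fun A hA => ?_
  have e1 : ∀ s, ((unifCube.map (trialPt T x lab a s)).map (fun z => z j)) A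
      = ∫⁻ θ, A.indicator 1 (fractPt T (x j) θ + a (lab (floorPt T (x j) θ) + s)) ∂unifCube := by
    intro s
    rw [Measure.map_map hj (measurable_trialPt T x lab a s), ← lintegral_indicator_one hA,
      lintegral_map (measurable_one.indicator hA) (hj.comp (measurable_trialPt T x lab a s))]
    rfl
  have e2 : ∀ b, ((cellMeas T).map (fun u => u + a b)) A
      = ∫⁻ θ, A.indicator 1 (fractPt T (x j) θ + a b) ∂unifCube := by
    intro b
    have hm : Measurable fun u : E3 => u + a b := by fun_prop
    rw [← map_fractPt T (x j), Measure.map_map hm (measurable_fractPt T (x j)),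
      ← lintegral_indicator_one hA, lintegral_map (measurable_one.indicator hA)
        (hm.comp (measurable_fractPt T (x j)))]
    rfl
  have m1 : ∀ s, Measurable fun θ => A.indicator (1 : E3 → ℝ≥0∞)
      (fractPt T (x j) θ + a (lab (floorPt T (x j) θ) + s)) := fun s =>
    (measurable_one.indicator hA).comp (hj.comp (measurable_trialPt T x lab a s))
  have m2 : ∀ b, Measurable fun θ => A.indicator (1 : E3 → ℝ≥0∞) (fractPt T (x j) θ + a b) :=
    fun b => (measurable_one.indicator hA).comp ((measurable_fractPt T (x j)).add_const _)
  rw [Measure.finsetSum_apply, Measure.finsetSum_apply]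
  simp only [e1, e2]
  rw [← lintegral_finsetSum _ fun s _ => m1 s, ← lintegral_finsetSum _ fun s _ => m2 s]
  refine lintegral_congr fun θ => ?_
  exact Fintype.sum_equiv (Equiv.addLeft _) _ _ fun s => rfl

lemma floorPt_eq_prob (T : E3 ≃L[ℝ] (Fin 3 → ℝ)) (v : Fin 3 → E3)
    (hT : ∀ x i, T x i = inner ℝ (v i) x) (y z : E3) :
    unifCube {θ | floorPt T y θ = floorPt T z θ} = ENNReal.ofReal (tri v (y - z)) := by
  have h := volume_floor_cube (T y) (T z)
  simp only [tri, ← hT, map_sub, Pi.sub_apply]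
  exact h

lemma lintegral_pairE_trialMeas (v : Fin 3 → E3) (hT : ∀ x i, T x i = inner ℝ (v i) x)
    {D : ℝ} (hD : 0 < D) (hx : Function.Injective x)
    (hlab : ∀ i j (θ : Fin 3 → ℝ), (∀ k, θ k ∈ Ico (0 : ℝ) 1) →
      lab (floorPt T (x i) θ) = lab (floorPt T (x j) θ) → floorPt T (x i) θ = floorPt T (x j) θ)
    (hsep : ∀ b b', b ≠ b' → ∀ u w, (∀ k, T u k ∈ Ico (0 : ℝ) 1) → (∀ k, T w k ∈ Ico (0 : ℝ) 1) →
      D ≤ ‖(u + a b) - (w + a b')‖) :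
    ∫⁻ z, pairE z ∂(trialMeas T x lab a)
      ≤ ENNReal.ofReal (∑ i, ∑ j, locK v (x i) (x j) + N ^ 2 / D) := by
  have key : ∀ s, ∫⁻ z, pairE z ∂(unifCube.map (trialPt T x lab a s))
      ≤ ENNReal.ofReal (∑ i, ∑ j, locK v (x i) (x j) + N ^ 2 / D) := by
    intro s
    rw [lintegral_map measurable_pairE (measurable_trialPt T x lab a s)]
    have hmE : ∀ i j, MeasurableSet {θ | floorPt T (x i) θ = floorPt T (x j) θ} := fun i j =>
      measurableSet_eq_fun (measurable_floorPt T (x i)) (measurable_floorPt T (x j))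
    calc ∫⁻ θ, pairE (trialPt T x lab a s θ) ∂unifCube
        ≤ ∫⁻ θ, ∑ i, ∑ j, ({θ | floorPt T (x i) θ = floorPt T (x j) θ}.indicator
            (fun _ => ENNReal.ofReal (kap (x i) (x j))) θ + ENNReal.ofReal (1 / D)) ∂unifCube := by
          refine lintegral_mono_ae ?_
          filter_upwards [ae_mem_unitCube] with θ hθ
          refine Finset.sum_le_sum fun i _ => Finset.sum_le_sum fun j _ => ?_
          split_ifs with hij
          · exact zero_le
          by_cases hf : floorPt T (x i) θ = floorPt T (x j) θ
          · rw [indicator_of_mem (by exact hf), ← kapE_of_ne (hx.ne hij)]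
            refine le_trans (le_of_eq ?_) le_self_add
            unfold kapE trialPt
            rw [hf, add_sub_add_right_eq_sub, fractPt_sub_of_floorPt_eq T hf]
          · refine le_trans ?_ le_add_self
            have h1 : lab (floorPt T (x i) θ) + s ≠ lab (floorPt T (x j) θ) + s := fun h =>
              hf (hlab i j θ hθ (add_right_cancel h))
            have h2 := hsep _ _ h1 _ _ (fractPt_mem T (x i) θ) (fractPt_mem T (x j) θ)
            unfold kapE trialPt
            rw [← ofReal_norm, ← ENNReal.ofReal_inv_of_pos (hD.trans_le h2), one_div]
            exact ENNReal.ofReal_le_ofReal (inv_anti₀ hD h2)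
      _ = ∑ i, ∑ j, (ENNReal.ofReal (locK v (x i) (x j)) + ENNReal.ofReal (1 / D)) := by
          have hm : ∀ i j, Measurable fun θ =>
              ({θ | floorPt T (x i) θ = floorPt T (x j) θ}.indicator
              (fun _ => ENNReal.ofReal (kap (x i) (x j))) θ + ENNReal.ofReal (1 / D)) := fun i j =>
            (measurable_const.indicator (hmE i j)).add_const _
          rw [lintegral_finsetSum _ fun i _ => Finset.measurable_sum _ fun j _ => hm i j]
          refine Finset.sum_congr rfl fun i _ => ?_
          rw [lintegral_finsetSum _ fun j _ => hm i j]
          refine Finset.sum_congr rfl fun j _ => ?_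
          rw [lintegral_add_right _ measurable_const, lintegral_indicator_const (hmE i j),
            floorPt_eq_prob T v hT, locK, ENNReal.ofReal_mul (tri_nonneg _ _), mul_comm]
          simp
      _ = _ := by
          have h0 : ∀ i j, 0 ≤ locK v (x i) (x j) + 1 / D := fun i j =>
            add_nonneg (locK_nonneg _ _ _) (by positivity)
          simp only [← ENNReal.ofReal_add (locK_nonneg v _ _) (one_div_pos.2 hD).le]
          simp only [← ENNReal.ofReal_sum_of_nonneg fun j _ => h0 _ j]
          rw [← ENNReal.ofReal_sum_of_nonneg fun i _ => Finset.sum_nonneg fun j _ => h0 i j]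
          congr 1
          simp only [Finset.sum_add_distrib, Finset.sum_const, Finset.card_univ, Fintype.card_fin,
            nsmul_eq_mul]
          ring
  rw [trialMeas, lintegral_smul_measure, lintegral_finsetSum_measure, smul_eq_mul]
  calc _ ≤ (Fintype.card G : ℝ≥0∞)⁻¹ * ∑ _s : G,
        ENNReal.ofReal (∑ i, ∑ j, locK v (x i) (x j) + N ^ 2 / D) := by
        gcongr with s; exact key s
    _ = _ := by
        rw [Finset.sum_const, Finset.card_univ, nsmul_eq_mul, ← mul_assoc, card_mul_inv, one_mul]

/-- The energy of the random-shift trial state. -/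
lemma St.trial (v : Fin 3 → E3) (hT : ∀ x i, T x i = inner ℝ (v i) x) {D : ℝ} (hD : 0 < D)
    (hx : Function.Injective x)
    (hlab : ∀ i j (θ : Fin 3 → ℝ), (∀ k, θ k ∈ Ico (0 : ℝ) 1) →
      lab (floorPt T (x i) θ) = lab (floorPt T (x j) θ) → floorPt T (x i) θ = floorPt T (x j) θ)
    (hsep : ∀ b b', b ≠ b' → ∀ u w, (∀ k, T u k ∈ Ico (0 : ℝ) 1) → (∀ k, T w k ∈ Ico (0 : ℝ) 1) →
      D ≤ ‖(u + a b) - (w + a b')‖)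
    (hle : ∑ b, ((N : ℝ≥0∞) * (Fintype.card G : ℝ≥0∞)⁻¹) • (cellMeas T).map (fun u => u + a b)
      ≤ volume) :
    St N (∑ b, ((N : ℝ≥0∞) * (Fintype.card G : ℝ≥0∞)⁻¹) • (cellMeas T).map (fun u => u + a b))
      (∑ i, ∑ j, locK v (x i) (x j) + N ^ 2 / D
        - N ^ 2 / Fintype.card G * (mutE (cellMeas T) (cellMeas T)).toReal) := by
  set κ : ℝ≥0∞ := (N : ℝ≥0∞) * (Fintype.card G : ℝ≥0∞)⁻¹ with hκ
  have hn : (Fintype.card G : ℝ≥0∞) ≠ 0 := by simp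
  have hκt : κ ≠ ⊤ := by finiteness
  have hP := isProb_trialMeas T x lab a
  have hμ : ∑ j, (trialMeas T x lab a).map (fun z => z j)
      = ∑ b, κ • (cellMeas T).map (fun u => u + a b) := by
    simp only [trialMeas_marginal]
    rw [Finset.sum_const, Finset.card_univ, Fintype.card_fin, ← Nat.cast_smul_eq_nsmul ℝ≥0∞,
      smul_smul, ← hκ, Finset.smul_sum]
  have hE := lintegral_pairE_trialMeas T x lab a v hT hD hx hlab hsep
  have hf : IsFiniteMeasure (∑ b, κ • (cellMeas T).map (fun u => u + a b)) := by
    rw [← hμ]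
    exact ⟨by rw [sum_map_univ]; simp⟩
  have h0 : 0 ≤ ∑ i, ∑ j, locK v (x i) (x j) + N ^ 2 / D :=
    add_nonneg (Finset.sum_nonneg fun i _ => Finset.sum_nonneg fun j _ => locK_nonneg _ _ _)
      (by positivity)
  refine ⟨hle, _, hP, hμ, ne_top_of_le_ne_top ENNReal.ofReal_ne_top hE, ?_⟩
  have h1 := ENNReal.toReal_mono ENNReal.ofReal_ne_top hE
  rw [ENNReal.toReal_ofReal h0] at h1
  have h2 := mutE_sum_ge Finset.univ fun b => κ • (cellMeas T).map (fun u => u + a b)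
  simp only [mutE_smul hκt, mutE_map_add] at h2
  have h3 := ENNReal.toReal_mono (mutE_ne_top hle) h2
  have h4 : (∑ _b : G, κ * κ * mutE (cellMeas T) (cellMeas T)).toReal
      = N ^ 2 / Fintype.card G * (mutE (cellMeas T) (cellMeas T)).toReal := by
    have : (Fintype.card G : ℝ) ≠ 0 := by exact_mod_cast hn
    simp only [Finset.sum_const, Finset.card_univ, nsmul_eq_mul, ENNReal.toReal_mul,
      ENNReal.toReal_natCast, hκ, ENNReal.toReal_inv]
    field_simp
  rw [h4] at h3
  linarith

end trial

/-- The fundamental cell of `T`. -/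
def cell (T : E3 ≃L[ℝ] (Fin 3 → ℝ)) : Set E3 := {x | ∀ i, T x i ∈ Ico (0 : ℝ) 1}

/-- The volume of the fundamental cell of `T`. -/
def cellVol (T : E3 ≃L[ℝ] (Fin 3 → ℝ)) : ℝ := (volume (cell T)).toReal

lemma cell_eq_preimage (T : E3 ≃L[ℝ] (Fin 3 → ℝ)) :
    cell T = T ⁻¹' (Set.pi univ fun _ => Ico (0 : ℝ) 1) := by
  ext x; simp [cell]

lemma measurableSet_cell (T : E3 ≃L[ℝ] (Fin 3 → ℝ)) : MeasurableSet (cell T) := by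
  rw [cell_eq_preimage]
  exact (MeasurableSet.univ_pi fun _ => measurableSet_Ico).preimage T.continuous.measurable

lemma exists_map_symm_volume (T : E3 ≃L[ℝ] (Fin 3 → ℝ)) : 0 < cellVol T ∧
    volume (cell T) = ENNReal.ofReal (cellVol T) ∧
    (volume : Measure (Fin 3 → ℝ)).map T.symm = ENNReal.ofReal (cellVol T)⁻¹ • volume := by
  have hh : ((volume : Measure (Fin 3 → ℝ)).map T.symm).IsAddHaarMeasure :=
    T.symm.isAddHaarMeasure_map _
  obtain ⟨c, hc0, hct, hc⟩ : ∃ c : ℝ≥0∞, c ≠ 0 ∧ c ≠ ⊤ ∧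
      (volume : Measure (Fin 3 → ℝ)).map T.symm = c • (volume : Measure E3) :=
    ⟨_, ENNReal.coe_ne_zero.2 (Measure.addHaarScalarFactor_pos_of_isAddHaarMeasure _ _).ne',
      ENNReal.coe_ne_top, Measure.isAddLeftInvariant_eq_smul _ _⟩
  have h1 : ((volume : Measure (Fin 3 → ℝ)).map T.symm) (cell T) = 1 := by
    rw [Measure.map_apply T.symm.continuous.measurable (measurableSet_cell T)]
    have : T.symm ⁻¹' cell T = Set.pi univ fun _ => Ico (0 : ℝ) 1 := by
      rw [cell_eq_preimage, ← preimage_comp]; ext x; simp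
    rw [this, volume_pi_pi]
    simp
  rw [hc, Measure.smul_apply, smul_eq_mul] at h1
  have hv : volume (cell T) = c⁻¹ := (ENNReal.eq_inv_of_mul_eq_one_left (by rwa [mul_comm] at h1))
  have hct' : c⁻¹ ≠ ⊤ := ENNReal.inv_ne_top.2 hc0
  have hpos : 0 < cellVol T := by
    rw [cellVol, hv]
    exact ENNReal.toReal_pos (ENNReal.inv_ne_zero.2 hct) hct'
  refine ⟨hpos, ?_, ?_⟩
  · rw [cellVol, ENNReal.ofReal_toReal (by rwa [hv])]
  · rw [hc, ENNReal.ofReal_inv_of_pos hpos, cellVol, ENNReal.ofReal_toReal (by rwa [hv]), hv,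
      inv_inv]

lemma cellVol_pos (T : E3 ≃L[ℝ] (Fin 3 → ℝ)) : 0 < cellVol T := (exists_map_symm_volume T).1

lemma volume_cell (T : E3 ≃L[ℝ] (Fin 3 → ℝ)) : volume (cell T) = ENNReal.ofReal (cellVol T) :=
  (exists_map_symm_volume T).2.1

lemma cellMeas_eq (T : E3 ≃L[ℝ] (Fin 3 → ℝ)) :
    cellMeas T = ENNReal.ofReal (cellVol T)⁻¹ • volume.restrict (cell T) := by
  rw [cellMeas, unifCube_eq, ← Measure.restrict_smul, ← (exists_map_symm_volume T).2.2,
    Measure.restrict_map T.symm.continuous.measurable (measurableSet_cell T)]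
  congr 2
  rw [cell_eq_preimage, ← preimage_comp]; ext x; simp

/-- The integral of the localized Coulomb kernel. -/
def pbar (v : Fin 3 → E3) : ℝ := ∫ z, tri v z * ‖z‖⁻¹

lemma mutE_cellMeas (T : E3 ≃L[ℝ] (Fin 3 → ℝ)) (v : Fin 3 → E3)
    (hT : ∀ x i, T x i = inner ℝ (v i) x) :
    (mutE (cellMeas T) (cellMeas T)).toReal = pbar v / cellVol T := by
  have hTm : Measurable T.symm := T.symm.continuous.measurable
  have hk : Measurable fun ζ : Fin 3 → ℝ => ‖T.symm ζ‖ₑ⁻¹ := hTm.enorm.inv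
  have h1 : mutE (cellMeas T) (cellMeas T)
      = ∫⁻ ζ, ENNReal.ofReal (∏ i, max (1 - |ζ i|) 0) * ‖T.symm ζ‖ₑ⁻¹ := by
    rw [← lintegral_unifCube_sub hk, mutE]
    conv_lhs => rw [cellMeas, lintegral_map (measurable_pot _) hTm]
    refine lintegral_congr fun θ => ?_
    rw [lintegral_map (measurable_kapE_comp (by fun_prop) (by fun_prop)) hTm]
    simp [kapE]
  have h2 : ∫⁻ ζ, ENNReal.ofReal (∏ i, max (1 - |ζ i|) 0) * ‖T.symm ζ‖ₑ⁻¹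
      = ∫⁻ z, ENNReal.ofReal (tri v z) * ‖z‖ₑ⁻¹
        ∂((volume : Measure (Fin 3 → ℝ)).map T.symm) := by
    have hm : Measurable fun z : E3 => ENNReal.ofReal (tri v z) * ‖z‖ₑ⁻¹ :=
      (measurable_tri v).ennreal_ofReal.mul measurable_enorm.inv
    rw [lintegral_map hm hTm]
    refine lintegral_congr fun ζ => ?_
    simp only [tri, ← hT, ContinuousLinearEquiv.apply_symm_apply]
  have h3 : ∫⁻ z, ENNReal.ofReal (tri v z) * ‖z‖ₑ⁻¹ = ∫⁻ z, ENNReal.ofReal (tri v z * ‖z‖⁻¹) := by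
    refine lintegral_congr_ae ?_
    filter_upwards [ae_ne_point 0] with z hz
    rw [ENNReal.ofReal_mul (tri_nonneg v z), ENNReal.ofReal_inv_of_pos (norm_pos_iff.2 hz.symm),
      ofReal_norm]
  have h4 : ∀ z, 0 ≤ tri v z * ‖z‖⁻¹ := fun z => mul_nonneg (tri_nonneg v z) (by positivity)
  rw [h1, h2, (exists_map_symm_volume T).2.2, lintegral_smul_measure, h3, smul_eq_mul,
    ENNReal.toReal_mul, ENNReal.toReal_ofReal (inv_nonneg.2 (cellVol_pos T).le), pbar,
    integral_eq_lintegral_of_nonneg_ae (Eventually.of_forall h4)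
      ((measurable_tri v).mul (by fun_prop)).aestronglyMeasurable]
  ring

lemma integral_kap_eq_toReal (x : E3) (C : Set E3) :
    (∫ y in C, kap x y) = (∫⁻ y in C, kapE x y).toReal := by
  have hm : Measurable fun y => kap x y := by unfold kap; fun_prop
  rw [integral_eq_lintegral_of_nonneg_ae (Eventually.of_forall fun y => kap_nonneg x y)
    hm.aestronglyMeasurable]
  congr 1
  refine lintegral_congr_ae (ae_restrict_of_ae ?_)
  filter_upwards [ae_ne_point x] with y hy
  rw [kapE_of_ne hy]

lemma integral_kap_prod_eq_toReal {C : Set E3} (hC : volume C ≠ ⊤) :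
    (∫ p, kap p.1 p.2 ∂((volume.restrict C).prod (volume.restrict C)))
      = (mutE (volume.restrict C) (volume.restrict C)).toReal := by
  have hf : IsFiniteMeasure (volume.restrict C) := ⟨by simpa using hC.lt_top⟩
  have hi := adm_kap.integrable_prod hC
  have e := integral_prod _ hi
  simp only [Function.uncurry] at e
  rw [e]
  simp only [integral_kap_eq_toReal]
  rw [integral_toReal (measurable_pot _).aemeasurable]
  · rfl
  · refine Eventually.of_forall fun x => ?_
    refine (lintegral_kapE_le Measure.restrict_le_self x).trans_lt ?_
    simp only [Measure.restrict_apply_univ]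
    finiteness

lemma pairE_of_injective {N : ℕ} {z : Fin N → E3} (hz : Function.Injective z) :
    pairE z = ENNReal.ofReal (∑ i, ∑ j, kap (z i) (z j)) := by
  rw [ENNReal.ofReal_sum_of_nonneg fun i _ => Finset.sum_nonneg fun j _ => kap_nonneg _ _, pairE]
  refine Finset.sum_congr rfl fun i _ => ?_
  rw [ENNReal.ofReal_sum_of_nonneg fun j _ => kap_nonneg _ _]
  refine Finset.sum_congr rfl fun j _ => ?_
  split_ifs with h
  · simp [h, kap]
  · exact kapE_of_ne (hz.ne h)

lemma pairE_of_not_injective {N : ℕ} {z : Fin N → E3} (hz : ¬ Function.Injective z) :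
    pairE z = ⊤ := by
  obtain ⟨i, j, h1, h2⟩ : ∃ i j, z i = z j ∧ i ≠ j := by
    simpa [Function.Injective] using hz
  have h3 : (⊤ : ℝ≥0∞) ≤ ∑ j, if i = j then 0 else kapE (z i) (z j) := by
    refine le_trans (le_of_eq ?_) (Finset.single_le_sum (fun _ _ => zero_le) (Finset.mem_univ j))
    simp [h2, h1, kapE]
  have h4 : ∑ j, (if i = j then 0 else kapE (z i) (z j)) ≤ pairE z :=
    Finset.single_le_sum (f := fun i => ∑ j, if i = j then 0 else kapE (z i) (z j))
      (fun _ _ => zero_le) (Finset.mem_univ i)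
  exact top_le_iff.1 (h3.trans h4)

lemma two_En_image {k : E3 → E3 → ℝ} {N : ℕ} {z : Fin N → E3} (hz : Function.Injective z)
    (C : Set E3) : 2 * En k (Finset.univ.image z) C = ∑ i, ∑ j, k (z i) (z j)
      - 2 * ∑ j, (∫ y in C, k (z j) y)
      + ∫ p, k p.1 p.2 ∂((volume.restrict C).prod (volume.restrict C)) := by
  unfold En
  simp only [Finset.sum_image fun a _ b _ h => hz h]
  ring

/-- The indirect energy is bounded below by the jellium energy. -/
lemma lintegral_pairE_lower {N : ℕ} {C : Set E3} (hC : volume C ≠ ⊤)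
    (P : Measure (Fin N → E3)) [IsProbabilityMeasure P]
    (hP : ∑ j, P.map (fun z => z j) = volume.restrict C) {β : ℝ}
    (hβ : ∀ z : Fin N → E3, Function.Injective z → β ≤ 2 * En kap (Finset.univ.image z) C) :
    2 * mutE (volume.restrict C) (volume.restrict C) + ENNReal.ofReal β ≤
      ∫⁻ z, pairE z ∂P + mutE (volume.restrict C) (volume.restrict C) + ENNReal.ofReal (-β) := by
  have hf : IsFiniteMeasure (volume.restrict C) := ⟨by simpa using hC.lt_top⟩
  set μ := volume.restrict C with hμ
  have hpot : ∀ x, ∫⁻ y in C, kapE x y ≠ ⊤ := fun x => by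
    refine ne_top_of_le_ne_top ?_ (lintegral_kapE_le Measure.restrict_le_self x)
    simp only [Measure.restrict_apply_univ]
    finiteness
  have hmm : mutE μ μ ≠ ⊤ := mutE_ne_top Measure.restrict_le_self
  have hpt : ∀ z : Fin N → E3, 2 * ∑ j, ∫⁻ y, kapE (z j) y ∂μ + ENNReal.ofReal β
      ≤ pairE z + (mutE μ μ + ENNReal.ofReal (-β)) := by
    intro z
    by_cases hz : Function.Injective z
    · have h := hβ z hz
      rw [two_En_image hz, integral_kap_prod_eq_toReal hC] at h
      have hI : ∀ x, (∫ y, kap x y ∂μ) = (∫⁻ y, kapE x y ∂μ).toReal := fun x =>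
        integral_kap_eq_toReal x C
      simp only [← hμ, hI] at h
      rw [pairE_of_injective hz, ← ENNReal.ofReal_toReal hmm]
      have e : 2 * ∑ j, ∫⁻ y, kapE (z j) y ∂μ
          = ENNReal.ofReal (2 * ∑ j, (∫⁻ y, kapE (z j) y ∂μ).toReal) := by
        rw [ENNReal.ofReal_mul zero_le_two,
          ENNReal.ofReal_sum_of_nonneg fun j _ => ENNReal.toReal_nonneg]
        simp only [hμ, ENNReal.ofReal_toReal (hpot _)]
        simp
      have h0 : 0 ≤ ∑ i, ∑ j, kap (z i) (z j) :=
        Finset.sum_nonneg fun i _ => Finset.sum_nonneg fun j _ => kap_nonneg _ _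
      have h1 : 0 ≤ 2 * ∑ j, (∫⁻ y, kapE (z j) y ∂μ).toReal :=
        mul_nonneg zero_le_two (Finset.sum_nonneg fun _ _ => ENNReal.toReal_nonneg)
      rw [e]
      rcases le_total 0 β with hb | hb
      · rw [ENNReal.ofReal_of_nonpos (by linarith : -β ≤ 0), add_zero,
          ← ENNReal.ofReal_add h1 hb, ← ENNReal.ofReal_add h0 ENNReal.toReal_nonneg]
        exact ENNReal.ofReal_le_ofReal (by linarith)
      · rw [ENNReal.ofReal_of_nonpos hb, add_zero,
          ← ENNReal.ofReal_add ENNReal.toReal_nonneg (by linarith), ← ENNReal.ofReal_add h0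
          (add_nonneg ENNReal.toReal_nonneg (by linarith))]
        exact ENNReal.ofReal_le_ofReal (by linarith)
    · rw [pairE_of_not_injective hz]; simp
  have h := lintegral_mono (μ := P) hpt
  have m1 : Measurable fun z : Fin N → E3 => 2 * ∑ j, ∫⁻ y, kapE (z j) y ∂μ :=
    (Finset.measurable_sum _ fun j _ =>
      (measurable_pot μ).comp (measurable_pi_apply j)).const_mul _
  rw [lintegral_add_left m1, lintegral_add_left measurable_pairE,
    lintegral_const_mul' _ _ (by simp),
    lintegral_sum_map P (measurable_pot μ), hP] at h
  simpa [← add_assoc, mutE] using h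

lemma St.lower {N : ℕ} {C : Set E3} (hC : volume C ≠ ⊤) {w β : ℝ}
    (h : St N (volume.restrict C) w)
    (hβ : ∀ z : Fin N → E3, Function.Injective z → β ≤ 2 * En kap (Finset.univ.image z) C) :
    β ≤ w := by
  have hf : IsFiniteMeasure (volume.restrict C) := ⟨by simpa using hC.lt_top⟩
  obtain ⟨-, P, hP, hm, hfin, hw⟩ := h
  have h1 := lintegral_pairE_lower hC P hm hβ
  have hmm : mutE (volume.restrict C) (volume.restrict C) ≠ ⊤ :=
    mutE_ne_top Measure.restrict_le_self
  have h2 := ENNReal.toReal_mono (by finiteness) h1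
  rw [ENNReal.toReal_add (by finiteness) (by finiteness),
    ENNReal.toReal_add (by finiteness) (by finiteness),
    ENNReal.toReal_add (by finiteness) (by finiteness), ENNReal.toReal_mul] at h2
  simp only [ENNReal.toReal_ofNat, ENNReal.toReal_ofReal'] at h2
  have : max β 0 - max (-β) 0 = β := by
    rcases le_total 0 β with hb | hb
    · rw [max_eq_left hb, max_eq_right (by linarith), sub_zero]
    · rw [max_eq_right hb, max_eq_left (by linarith)]; ring
  linarith

/-- The open cube `(a, b)³`. -/
def box (a b : ℝ) : Set E3 := {y | ∀ i, y i ∈ Ioo a b}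

lemma cube0_eq_box (K : ℕ) : cube0 K = box 0 K := rfl

lemma box_eq_preimage (a b : ℝ) :
    box a b = (MeasurableEquiv.toLp 2 (Fin 3 → ℝ)).symm ⁻¹' (Set.pi univ fun _ => Ioo a b) := by
  ext x; simp [box]

lemma measurableSet_box (a b : ℝ) : MeasurableSet (box a b) := by
  rw [box_eq_preimage]
  exact (MeasurableSet.univ_pi fun _ => measurableSet_Ioo).preimage (MeasurableEquiv.measurable _)

lemma volume_box (a b : ℝ) : volume (box a b) = ENNReal.ofReal (b - a) ^ 3 := by
  rw [box_eq_preimage, (EuclideanSpace.volume_preserving_symm_measurableEquiv_toLp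
    (Fin 3)).measure_preimage (MeasurableSet.univ_pi fun _ => measurableSet_Ioo).nullMeasurableSet,
    volume_pi_pi]
  simp

lemma volume_cube0 (K : ℕ) : volume (cube0 K) = ((K ^ 3 : ℕ) : ℝ≥0∞) := by
  rw [cube0_eq_box, volume_box]; simp

lemma volume_cube0_ne_top (K : ℕ) : volume (cube0 K) ≠ ⊤ := by
  rw [volume_cube0]; exact ENNReal.natCast_ne_top _

lemma measurableSet_cube0 (K : ℕ) : MeasurableSet (cube0 K) := measurableSet_box _ _

lemma sum_restrict_le {ι : Type*} (s : Finset ι) {A : ι → Set E3} {C : Set E3}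
    (hd : (s : Set ι).PairwiseDisjoint A) (hm : ∀ i ∈ s, MeasurableSet (A i))
    (hs : ∀ i ∈ s, A i ⊆ C) :
    ∑ i ∈ s, (volume : Measure E3).restrict (A i) ≤ volume.restrict C := by
  refine Measure.le_iff.2 fun B hB => ?_
  rw [Measure.finsetSum_apply, Measure.restrict_apply hB]
  simp only [Measure.restrict_apply hB]
  rw [← measure_biUnion_finset (hd.mono fun i => inter_subset_right)
    fun i hi => hB.inter (hm i hi)]
  exact measure_mono (iUnion₂_subset fun i hi => inter_subset_inter_right _ (hs i hi))

lemma map_add_restrict (A : Set E3) (a : E3) :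
    ((volume : Measure E3).restrict A).map (fun x => x + a)
      = volume.restrict {y | y - a ∈ A} := by
  have hm : Measurable fun x : E3 => x + a := by fun_prop
  refine Measure.ext fun B hB => ?_
  rw [Measure.map_apply hm hB, Measure.restrict_apply (hB.preimage hm), Measure.restrict_apply hB,
    ← measure_preimage_add_right volume a (B ∩ {y | y - a ∈ A})]
  congr 1
  ext x; simp

/-- The lattice vector `K s`. -/
def gridVec (K : ℕ) (s : Fin 3 → ℕ) : E3 := WithLp.toLp 2 fun i => (K : ℝ) * s i

lemma grid_unique {K : ℕ} {s t : Fin 3 → ℕ} {y : E3} (hs : y - gridVec K s ∈ cube0 K)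
    (ht : y - gridVec K t ∈ cube0 K) : s = t := by
  funext i
  have h1 := hs i
  have h2 := ht i
  simp only [gridVec, PiLp.sub_apply, mem_Ioo] at h1 h2
  have key : ∀ p q : ℕ, y i - K * p < K → 0 < y i - K * q → q ≤ p := by
    intro p q h3 h4
    by_contra h
    have h5 : p + 1 ≤ q := by omega
    have h6 : (K : ℝ) * (p + 1) ≤ K * q := by
      gcongr; exact_mod_cast h5
    linarith
  exact le_antisymm (key _ _ h2.2 h1.1) (key _ _ h1.2 h2.1)

lemma grid_subset {K n : ℕ} {s : Fin 3 → ℕ} (hs : ∀ i, s i < n) {y : E3}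
    (hy : y - gridVec K s ∈ cube0 K) : y ∈ cube0 (n * K) := by
  intro i
  have h1 := hy i
  simp only [gridVec, PiLp.sub_apply, mem_Ioo] at h1
  have h2 : (K : ℝ) * (s i + 1) ≤ K * n := by
    gcongr; exact_mod_cast hs i
  have h3 : (0 : ℝ) ≤ K * s i := by positivity
  push_cast
  exact ⟨by linarith, by linarith⟩

lemma cube0_mono {K M : ℕ} (h : K ≤ M) : cube0 K ⊆ cube0 M := fun y hy i =>
  ⟨(hy i).1, (hy i).2.trans_le (by exact_mod_cast h)⟩

/-- `UEG K w`: some state of density `1` on the cube of side `K` has twice its indirect energy at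
most `w`. -/
def UEG (K : ℕ) (w : ℝ) : Prop := St (K ^ 3) (volume.restrict (cube0 K)) w

lemma UEG.zero (K : ℕ) : UEG K 0 :=
  St.fluid Measure.restrict_le_self (by simp [volume_cube0])

lemma UEG.min_zero {K : ℕ} {w : ℝ} (h : UEG K w) : UEG K (min w 0) := by
  rcases min_choice w 0 with h1 | h1 <;> rw [h1]
  · exact h
  · exact UEG.zero K

lemma measurableSet_translate {A : Set E3} (hA : MeasurableSet A) (a : E3) :
    MeasurableSet {y | y - a ∈ A} :=
  hA.preimage (by fun_prop : Measurable fun y : E3 => y - a)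

lemma UEG.pack {K n M : ℕ} {w : ℝ} (h : UEG K w) (hn : n * K ≤ M) : UEG M ((n : ℝ) ^ 3 * w) := by
  have h1 : ∀ s : Fin 3 → Fin n, St (K ^ 3)
      (volume.restrict {y | y - gridVec K (fun i => s i) ∈ cube0 K}) w := fun s => by
    rw [← map_add_restrict]
    exact St.translate h _
  have h2 := St.pack Finset.univ (fun s _ => h1 s) (ν := volume.restrict (cube0 M))
    Measure.restrict_le_self (M := M ^ 3) (by simp [volume_cube0]) ?_
  · simpa [UEG] using h2
  · refine sum_restrict_le _ ?_ (fun s _ => measurableSet_translate (measurableSet_cube0 K) _) ?_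
    · intro s _ t _ hst
      refine Set.disjoint_left.2 fun y hs ht => hst ?_
      have := grid_unique hs ht
      funext i
      exact Fin.ext (congrFun this i)
    · intro s _ y hy
      exact cube0_mono hn (grid_subset (fun i => (s i).2) hy)

lemma kap_lower {N : ℕ} {C : Set E3} (hm : MeasurableSet C) (hC : volume C ≠ ⊤)
    {z : Fin N → E3} (hz : Function.Injective z) :
    -(2 * (N * (1 / 2 + cYuk))) ≤ 2 * En kap (Finset.univ.image z) C := by
  have := En_locK_lower 0 (Finset.univ.image z) hm hC
  rw [locK_zero, Finset.card_image_of_injective _ hz, Finset.card_univ, Fintype.card_fin] at this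
  linarith

/-- The energy per unit volume of the uniform electron gas (doubled). -/
def eUEG : ℝ := sInf {x | ∃ K : ℕ, 1 ≤ K ∧ ∃ w, UEG K w ∧ x = w / (K : ℝ) ^ 3}

lemma bddBelow_UEG : BddBelow {x | ∃ K : ℕ, 1 ≤ K ∧ ∃ w, UEG K w ∧ x = w / (K : ℝ) ^ 3} := by
  refine ⟨-(2 * (1 / 2 + cYuk)), ?_⟩
  rintro x ⟨K, hK, w, hw, rfl⟩
  have hK' : (0 : ℝ) < K := by exact_mod_cast hK
  have h := St.lower (volume_cube0_ne_top K) hw fun z hz =>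
    kap_lower (measurableSet_cube0 K) (volume_cube0_ne_top K) hz
  rw [le_div_iff₀ (by positivity)]
  push_cast at h
  linarith

lemma eUEG_mul_le {K : ℕ} (hK : 1 ≤ K) {w : ℝ} (h : UEG K w) : eUEG * (K : ℝ) ^ 3 ≤ w := by
  have hK' : (0 : ℝ) < K := by exact_mod_cast hK
  rw [← le_div_iff₀ (by positivity)]
  exact csInf_le bddBelow_UEG ⟨K, hK, w, h, rfl⟩

lemma eUEG_nonpos : eUEG ≤ 0 := by
  simpa using eUEG_mul_le le_rfl (UEG.zero 1)

lemma eventually_UEG {ε : ℝ} (hε : 0 < ε) :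
    ∀ᶠ M : ℕ in atTop, UEG M ((eUEG + ε) * (M : ℝ) ^ 3) := by
  obtain ⟨_, ⟨K, hK, w, hw, rfl⟩, hlt⟩ := exists_lt_of_csInf_lt
    (s := {x | ∃ K : ℕ, 1 ≤ K ∧ ∃ w, UEG K w ∧ x = w / (K : ℝ) ^ 3})
    ⟨_, 1, le_rfl, 0, UEG.zero 1, rfl⟩ (show eUEG < eUEG + ε / 2 by linarith)
  have hK' : (0 : ℝ) < K := by exact_mod_cast hK
  set g := min w 0 / (K : ℝ) ^ 3 with hg
  have hg0 : g ≤ 0 := div_nonpos_of_nonpos_of_nonneg (min_le_right _ _) (by positivity)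
  have hg1 : g < eUEG + ε / 2 := lt_of_le_of_lt (by rw [hg]; gcongr; exact min_le_left _ _) hlt
  filter_upwards [eventually_ge_atTop K, eventually_ge_atTop ⌈6 * K * (-g) / ε⌉₊] with M h1 h2
  refine (hw.min_zero.pack (Nat.div_mul_le_self M K)).mono ?_
  have hM : (K : ℝ) ≤ M := by exact_mod_cast h1
  have h3 : 6 * K * (-g) ≤ ε * M := by
    have := (Nat.le_ceil _).trans (Nat.cast_le (α := ℝ).2 h2)
    rwa [div_le_iff₀ hε, mul_comm (M : ℝ)] at this
  have h4 : (M : ℝ) - K ≤ (M / K : ℕ) * K := by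
    have := Nat.div_add_mod M K
    have h5 := Nat.mod_lt M (by omega : 0 < K)
    have h6 : M ≤ (M / K) * K + K := by rw [mul_comm]; omega
    have h7 : (M : ℝ) ≤ (M / K : ℕ) * K + K := by exact_mod_cast h6
    linarith
  have h5 : ((M : ℝ) - K) ^ 3 ≤ ((M / K : ℕ) * K : ℝ) ^ 3 :=
    pow_le_pow_left₀ (by linarith) h4 3
  have h6 : (M : ℝ) ^ 3 - 3 * K * M ^ 2 ≤ ((M : ℝ) - K) ^ 3 := by nlinarith [mul_pos hK' hK']
  have h7 : min w 0 = g * (K : ℝ) ^ 3 := by rw [hg]; field_simp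
  rw [h7]
  have h8 : ((M / K : ℕ) : ℝ) ^ 3 * (g * K ^ 3) = g * ((M / K : ℕ) * K : ℝ) ^ 3 := by ring
  rw [h8]
  have h9 : g * ((M / K : ℕ) * K : ℝ) ^ 3 ≤ g * ((M : ℝ) ^ 3 - 3 * K * M ^ 2) :=
    mul_le_mul_of_nonpos_left (h6.trans h5) hg0
  have h10 : 6 * K * (-g) * (M : ℝ) ^ 2 ≤ ε * M * M ^ 2 := by gcongr
  have h11 : g * (M : ℝ) ^ 3 ≤ (eUEG + ε / 2) * M ^ 3 := by gcongr
  nlinarith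

section
variable (T : E3 ≃L[ℝ] (Fin 3 → ℝ))

/-- The lattice cell of `T` with index `l`. -/
def cellAt (l : Fin 3 → ℤ) : Set E3 := {x | ∀ i, ⌊T x i⌋ = l i}

/-- The corner of the lattice cell with index `l`. -/
def corner (l : Fin 3 → ℤ) : E3 := T.symm fun i => (l i : ℝ)

lemma cellAt_eq (l : Fin 3 → ℤ) : cellAt T l = {x | x - corner T l ∈ cell T} := by
  ext x
  refine forall_congr' fun i => ?_
  simp only [corner, map_sub, ContinuousLinearEquiv.apply_symm_apply, Pi.sub_apply, mem_Ico,
    Int.floor_eq_iff]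
  constructor <;> rintro ⟨h1, h2⟩ <;> constructor <;> linarith

lemma measurableSet_cellAt (l : Fin 3 → ℤ) : MeasurableSet (cellAt T l) := by
  rw [cellAt_eq]; exact measurableSet_translate (measurableSet_cell T) _

lemma volume_translate (A : Set E3) (a : E3) : volume {y | y - a ∈ A} = volume A := by
  have := measure_preimage_add_right (volume : Measure E3) (-a) A
  simp only [← sub_eq_add_neg] at this
  exact this

lemma volume_cellAt (l : Fin 3 → ℤ) : volume (cellAt T l) = ENNReal.ofReal (cellVol T) := by
  rw [cellAt_eq, volume_translate, volume_cell]

lemma cellAt_disjoint {l l' : Fin 3 → ℤ} (h : l ≠ l') : Disjoint (cellAt T l) (cellAt T l') :=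
  Set.disjoint_left.2 fun _ hx hx' => h (funext fun i => (hx i).symm.trans (hx' i))

/-- A bound for the diameter of the cells of `T`. -/
def cellDiam : ℝ := 2 * ‖(T.symm : (Fin 3 → ℝ) →L[ℝ] E3)‖ + 1

lemma cellDiam_pos : 0 < cellDiam T := by unfold cellDiam; positivity

lemma norm_lt_cellDiam {z : E3} (h : ∀ i, |T z i| ≤ 2) : ‖z‖ < cellDiam T := by
  have h1 : ‖T z‖ ≤ 2 := (pi_norm_le_iff_of_nonneg zero_le_two).2 fun i => by
    simpa using h i
  have h2 : ‖z‖ ≤ ‖(T.symm : (Fin 3 → ℝ) →L[ℝ] E3)‖ * ‖T z‖ := by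
    simpa using (T.symm : (Fin 3 → ℝ) →L[ℝ] E3).le_opNorm (T z)
  unfold cellDiam
  nlinarith [norm_nonneg (T.symm : (Fin 3 → ℝ) →L[ℝ] E3)]

lemma abs_coord_le_norm (z : E3) (i : Fin 3) : |z i| ≤ ‖z‖ := by
  simpa using PiLp.norm_apply_le z i

lemma abs_coord_sub_lt {x y : E3} (h : ∀ i, |T x i - T y i| ≤ 2) (i : Fin 3) :
    |x i - y i| < cellDiam T := by
  have := (abs_coord_le_norm (x - y) i).trans_lt
    (norm_lt_cellDiam T (z := x - y) (by simpa using h))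
  simpa using this

lemma abs_sub_le_of_cellAt {l : Fin 3 → ℤ} {x y : E3} (hx : x ∈ cellAt T l) (hy : y ∈ cellAt T l)
    (i : Fin 3) : |T x i - T y i| ≤ 2 := by
  have h1 := Int.floor_eq_iff.1 (hx i)
  have h2 := Int.floor_eq_iff.1 (hy i)
  rw [abs_le]; constructor <;> linarith

lemma card_mul_cellVol_le (F : Finset (Fin 3 → ℤ)) {A : Set E3} (h : ∀ l ∈ F, cellAt T l ⊆ A) :
    ENNReal.ofReal (F.card * cellVol T) ≤ volume A := by
  calc ENNReal.ofReal (F.card * cellVol T) = ∑ l ∈ F, volume (cellAt T l) := by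
        simp [volume_cellAt, ENNReal.ofReal_mul]
    _ = volume (⋃ l ∈ F, cellAt T l) := (measure_biUnion_finset
        (fun l _ l' _ h => cellAt_disjoint T h) fun l _ => measurableSet_cellAt T l).symm
    _ ≤ _ := measure_mono (iUnion₂_subset h)

lemma le_card_mul_cellVol (F : Finset (Fin 3 → ℤ)) {A : Set E3}
    (h : ∀ x ∈ A, ∃ l ∈ F, x ∈ cellAt T l) :
    volume A ≤ ENNReal.ofReal (F.card * cellVol T) := by
  calc volume A ≤ volume (⋃ l ∈ F, cellAt T l) := measure_mono fun x hx => by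
        simpa using h x hx
    _ ≤ ∑ l ∈ F, volume (cellAt T l) := measure_biUnion_finset_le _ _
    _ = _ := by simp [volume_cellAt, ENNReal.ofReal_mul]

lemma finite_cells_of_bounded {A : Set E3} (hA : Bornology.IsBounded A) :
    {l | (A ∩ cellAt T l).Nonempty}.Finite := by
  obtain ⟨R, hR⟩ := hA.exists_norm_le
  set c := ‖(T : E3 →L[ℝ] (Fin 3 → ℝ))‖ * R with hc
  refine (Set.finite_Icc (fun _ => ⌊-c⌋ : Fin 3 → ℤ) fun _ => ⌊c⌋).subset ?_
  rintro l ⟨x, hx, hl⟩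
  have h1 : ∀ i, |T x i| ≤ c := fun i => by
    calc |T x i| ≤ ‖T x‖ := by simpa using norm_le_pi_norm (T x) i
      _ ≤ ‖(T : E3 →L[ℝ] (Fin 3 → ℝ))‖ * ‖x‖ := (T : E3 →L[ℝ] (Fin 3 → ℝ)).le_opNorm x
      _ ≤ c := by rw [hc]; gcongr; exact hR x hx
  refine ⟨fun i => ?_, fun i => ?_⟩
  · rw [← hl i]; exact Int.floor_le_floor (abs_le.1 (h1 i)).1
  · rw [← hl i]; exact Int.floor_le_floor (abs_le.1 (h1 i)).2

lemma isBounded_box (a b : ℝ) : Bornology.IsBounded (box a b) := by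
  refine (isBounded_iff_forall_norm_le).2 ⟨Real.sqrt (3 * (|a| + |b|) ^ 2), fun x hx => ?_⟩
  rw [EuclideanSpace.norm_eq]
  refine Real.sqrt_le_sqrt ?_
  have : ∀ i, ‖x i‖ ^ 2 ≤ (|a| + |b|) ^ 2 := fun i => by
    refine pow_le_pow_left₀ (norm_nonneg _) ?_ 2
    rw [Real.norm_eq_abs, abs_le]
    have := hx i
    constructor
    · linarith [this.1, neg_abs_le a, abs_nonneg b]
    · linarith [this.2, le_abs_self b, abs_nonneg a]
  calc ∑ i, ‖x i‖ ^ 2 ≤ ∑ _i : Fin 3, (|a| + |b|) ^ 2 := Finset.sum_le_sum fun i _ => this i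
    _ = _ := by simp

/-- The cells contained in the cube of side `K`. -/
lemma exists_inner_cells {K : ℕ} : ∃ F : Finset (Fin 3 → ℤ),
    (∀ l ∈ F, cellAt T l ⊆ cube0 K) ∧ F.card * cellVol T ≤ (K : ℝ) ^ 3 ∧
    (2 * cellDiam T ≤ K → ((K : ℝ) - 2 * cellDiam T) ^ 3 ≤ F.card * cellVol T) := by
  have hfin := finite_cells_of_bounded T (isBounded_box 0 K)
  set F := hfin.toFinset.filter fun l => cellAt T l ⊆ cube0 K
  have hF : ∀ l ∈ F, cellAt T l ⊆ cube0 K := fun l hl => (Finset.mem_filter.1 hl).2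
  have hc : 0 ≤ F.card * cellVol T := mul_nonneg (by positivity) (cellVol_pos T).le
  refine ⟨F, hF, ?_, fun hK => ?_⟩
  · have := card_mul_cellVol_le T F hF
    rw [volume_cube0, ← ENNReal.ofReal_natCast, ENNReal.ofReal_le_ofReal_iff (by positivity)] at this
    exact_mod_cast this
  · have h1 : volume (box (cellDiam T) (K - cellDiam T)) ≤ ENNReal.ofReal (F.card * cellVol T) := by
      refine le_card_mul_cellVol T F fun x hx => ?_
      have hx' : x ∈ cellAt T fun i => ⌊T x i⌋ := fun i => rfl
      have hd := cellDiam_pos T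
      refine ⟨_, Finset.mem_filter.2 ⟨?_, fun y hy i => ?_⟩, hx'⟩
      · rw [Set.Finite.mem_toFinset]
        exact ⟨x, fun i => ⟨by linarith [(hx i).1], by linarith [(hx i).2]⟩, hx'⟩
      · have h2 := abs_lt.1 (abs_coord_sub_lt T (abs_sub_le_of_cellAt T hy hx') i)
        exact ⟨by linarith [(hx i).1], by linarith [(hx i).2]⟩
    rw [volume_box, ← ENNReal.ofReal_pow (by linarith), ENNReal.ofReal_le_ofReal_iff hc] at h1
    convert h1 using 2
    ring

end

lemma cellMeas_map_add (T : E3 ≃L[ℝ] (Fin 3 → ℝ)) (l : Fin 3 → ℤ) (a : E3) :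
    (cellMeas T).map (fun u => u + (corner T l + a))
      = ENNReal.ofReal (cellVol T)⁻¹ • volume.restrict {y | y - a ∈ cellAt T l} := by
  rw [cellMeas_eq, Measure.map_smul, map_add_restrict]
  congr 3
  ext y
  rw [cellAt_eq]
  simp only [mem_ofPred_eq]
  rw [show y - (corner T l + a) = y - a - corner T l by abel]

lemma smul_measure_le {c : ℝ≥0∞} (hc : c ≤ 1) (μ : Measure E3) : c • μ ≤ μ := by
  intro s
  simp only [Measure.smul_apply, smul_eq_mul]
  exact mul_le_of_le_one_left' hc

lemma sep_of_grid {K : ℕ} {p q : ℕ} (h : p ≠ q) {u w : E3} {d : ℝ} (hd : |u 0 - w 0| ≤ d)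
    (s t : Fin 3 → ℕ) (hs : s 0 = p) (ht : t 0 = q) (c : E3) :
    (K : ℝ) - d ≤ ‖(u + (c + gridVec K s)) - (w + (c + gridVec K t))‖ := by
  have h1 := abs_coord_le_norm ((u + (c + gridVec K s)) - (w + (c + gridVec K t))) 0
  refine le_trans ?_ h1
  simp only [gridVec, PiLp.sub_apply, PiLp.add_apply, hs, ht]
  have h2 : (1 : ℝ) ≤ |(p : ℝ) - q| := by
    have : (1 : ℤ) ≤ |(p : ℤ) - q| := Int.one_le_abs (by omega)
    exact_mod_cast this
  have h3 : (K : ℝ) ≤ |(K : ℝ) * (p - q)| := by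
    rw [abs_mul, abs_of_nonneg (Nat.cast_nonneg K)]
    nlinarith [Nat.cast_nonneg (α := ℝ) K]
  have h4 := abs_sub_abs_le_abs_sub ((K : ℝ) * (p - q)) (w 0 - u 0)
  rw [abs_sub_comm (w 0)] at h4
  have e : u 0 + (c 0 + K * p) - (w 0 + (c 0 + K * q)) = K * (p - q) - (w 0 - u 0) := by ring
  rw [e]
  linarith

lemma UEG_trial (T : E3 ≃L[ℝ] (Fin 3 → ℝ)) (v : Fin 3 → E3)
    (hT : ∀ x i, T x i = inner ℝ (v i) x) {N : ℕ} {x : Fin N → E3} (hx : Function.Injective x)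
    {n : ℕ} [NeZero n] (lab : (Fin 3 → ℤ) → Fin n)
    (hlab : ∀ i j (θ : Fin 3 → ℝ), (∀ k, θ k ∈ Ico (0 : ℝ) 1) →
      lab (floorPt T (x i) θ) = lab (floorPt T (x j) θ) → floorPt T (x i) θ = floorPt T (x j) θ)
    (hN : N ≤ n * cellVol T) {K : ℕ} (hK : cellDiam T < K) (F : Finset (Fin 3 → ℤ))
    (hF : ∀ l ∈ F, cellAt T l ⊆ cube0 K) :
    UEG (n * K) (F.card * n ^ 2 * (∑ i, ∑ j, locK v (x i) (x j) + N ^ 2 / (K - cellDiam T)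
      - N ^ 2 / n * (pbar v / cellVol T))) := by
  have hn : (0 : ℝ) < n := by exact_mod_cast Nat.pos_of_ne_zero (NeZero.ne n)
  set pos : Fin n × Fin n → Fin n → Fin 3 → ℕ := fun r b => ![b, r.1, r.2] with hpos
  have pos_inj : ∀ r b r' b', pos r b = pos r' b' → r = r' ∧ b = b' := by
    intro r b r' b' h
    have h0 := congrFun h 0
    have h1 := congrFun h 1
    have h2 := congrFun h 2
    simp only [hpos, Matrix.cons_val] at h0 h1 h2
    exact ⟨Prod.ext (Fin.ext h1) (Fin.ext h2), Fin.ext h0⟩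
  set κ : ℝ≥0∞ := (N : ℝ≥0∞) * (Fintype.card (Fin n) : ℝ≥0∞)⁻¹ with hκ
  have hκ1 : κ * ENNReal.ofReal (cellVol T)⁻¹ ≤ 1 := by
    have e : κ * ENNReal.ofReal (cellVol T)⁻¹ = ENNReal.ofReal (N / n * (cellVol T)⁻¹) := by
      rw [hκ, Fintype.card_fin, ENNReal.ofReal_mul (by positivity), ENNReal.ofReal_div_of_pos hn]
      simp [div_eq_mul_inv]
    rw [e]
    refine ENNReal.ofReal_le_one.2 ?_
    rw [← div_eq_mul_inv, div_div]
    exact div_le_one_of_le₀ hN (mul_pos hn (cellVol_pos T)).le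
  set a : (Fin 3 → ℤ) → Fin n × Fin n → Fin n → E3 := fun l r b =>
    corner T l + gridVec K (pos r b) with ha
  have hterm : ∀ l r b, κ • (cellMeas T).map (fun u => u + a l r b)
      ≤ volume.restrict {y | y - gridVec K (pos r b) ∈ cellAt T l} := by
    intro l r b
    rw [ha]
    simp only [cellMeas_map_add, smul_smul]
    exact smul_measure_le hκ1 _
  have htot : ∑ p ∈ F ×ˢ (Finset.univ : Finset (Fin n × Fin n)),
      ∑ b, κ • (cellMeas T).map (fun u => u + a p.1 p.2 b) ≤ volume.restrict (cube0 (n * K)) := by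
    refine (Finset.sum_le_sum fun p _ => Finset.sum_le_sum fun b _ => hterm p.1 p.2 b).trans ?_
    rw [← Finset.sum_product' (f := fun (p : (Fin 3 → ℤ) × Fin n × Fin n) b =>
      (volume : Measure E3).restrict {y | y - gridVec K (pos p.2 b) ∈ cellAt T p.1})]
    refine sum_restrict_le _ ?_ (fun p _ => measurableSet_translate (measurableSet_cellAt T _) _) ?_
    · rintro ⟨⟨l, r⟩, b⟩ h1 ⟨⟨l', r'⟩, b'⟩ h2 hne
      simp only [Finset.coe_product, mem_prod, Finset.mem_coe] at h1 h2
      refine Set.disjoint_left.2 fun y hy hy' => hne ?_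
      obtain ⟨rfl, rfl⟩ := pos_inj _ _ _ _
        (grid_unique (hF l h1.1.1 hy) (hF l' h2.1.1 hy'))
      have : l = l' := by
        by_contra h
        exact Set.disjoint_left.1 (cellAt_disjoint T h) hy hy'
      rw [this]
    · rintro ⟨⟨l, r⟩, b⟩ h1 y hy
      simp only [Finset.mem_product] at h1
      refine grid_subset (fun i => ?_) (hF l h1.1.1 hy)
      fin_cases i <;> simp [hpos]
  have hSt : ∀ l r, (∑ b, κ • (cellMeas T).map (fun u => u + a l r b)) ≤ volume →
      St N (∑ b, κ • (cellMeas T).map (fun u => u + a l r b))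
      (∑ i, ∑ j, locK v (x i) (x j) + N ^ 2 / (K - cellDiam T)
        - N ^ 2 / n * (pbar v / cellVol T)) := by
    intro l r hle
    have h := St.trial T x lab (a l r) v hT (sub_pos.2 hK) hx hlab ?_ hle
    · rw [hκ]
      rw [mutE_cellMeas T v hT] at h
      simpa only [Fintype.card_fin] using h
    · intro b b' hb u w hu hw
      refine sep_of_grid (p := b) (q := b') (fun h => hb (Fin.ext h)) ?_ _ _ rfl rfl _
      refine (abs_coord_sub_lt T (fun i => ?_) 0).le
      have h1 := hu i
      have h2 := hw i
      rw [abs_le]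
      constructor <;> linarith [h1.1, h1.2, h2.1, h2.2]
  have hone : ∀ p ∈ F ×ˢ (Finset.univ : Finset (Fin n × Fin n)),
      ∑ b, κ • (cellMeas T).map (fun u => u + a p.1 p.2 b) ≤ volume := fun p hp =>
    (Finset.single_le_sum (f := fun p : (Fin 3 → ℤ) × Fin n × Fin n =>
      ∑ b, κ • (cellMeas T).map (fun u => u + a p.1 p.2 b)) (fun _ _ => Measure.zero_le _) hp).trans
      (htot.trans Measure.restrict_le_self)
  have := St.pack (F ×ˢ (Finset.univ : Finset (Fin n × Fin n)))
    (fun p hp => hSt p.1 p.2 (hone p hp)) (ν := volume.restrict (cube0 (n * K)))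
    Measure.restrict_le_self (M := (n * K) ^ 3) (by simp [volume_cube0]) htot
  refine St.mono this (le_of_eq ?_)
  rw [Finset.sum_const, nsmul_eq_mul]
  congr 1
  simp [sq]

/-- Lower bound on the localized interaction of a configuration spread over `n` cells. -/
lemma eUEG_le_trial (T : E3 ≃L[ℝ] (Fin 3 → ℝ)) (v : Fin 3 → E3)
    (hT : ∀ x i, T x i = inner ℝ (v i) x) {N : ℕ} {x : Fin N → E3} (hx : Function.Injective x)
    {n : ℕ} [NeZero n] (lab : (Fin 3 → ℤ) → Fin n)
    (hlab : ∀ i j (θ : Fin 3 → ℝ), (∀ k, θ k ∈ Ico (0 : ℝ) 1) →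
      lab (floorPt T (x i) θ) = lab (floorPt T (x j) θ) → floorPt T (x i) θ = floorPt T (x j) θ)
    (hN : N ≤ n * cellVol T) :
    eUEG * (n * cellVol T) ≤ ∑ i, ∑ j, locK v (x i) (x j) - N ^ 2 / n * (pbar v / cellVol T) := by
  have hn : (0 : ℝ) < n := by exact_mod_cast Nat.pos_of_ne_zero (NeZero.ne n)
  choose F hF1 hF2 hF3 using fun K : ℕ => exists_inner_cells T (K := K)
  set S := ∑ i, ∑ j, locK v (x i) (x j)
  set d := cellDiam T
  have hd : 0 < d := cellDiam_pos T
  set δ := cellVol T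
  have hcast : Tendsto (fun K : ℕ => (K : ℝ)) atTop atTop := tendsto_natCast_atTop_atTop
  have l1 : Tendsto (fun K : ℕ => S + N ^ 2 / ((K : ℝ) - d) - N ^ 2 / n * (pbar v / δ)) atTop
      (𝓝 (S + 0 - N ^ 2 / n * (pbar v / δ))) := by
    refine (tendsto_const_nhds.add ?_).sub_const _
    exact tendsto_const_nhds.div_atTop (tendsto_atTop_add_const_right _ _ hcast)
  have l2 : Tendsto (fun K : ℕ => (F K).card * δ / (K : ℝ) ^ 3) atTop (𝓝 1) := by
    have l3 : Tendsto (fun K : ℕ => (1 - 2 * d / (K : ℝ)) ^ 3) atTop (𝓝 1) := by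
      have : Tendsto (fun K : ℕ => 2 * d / (K : ℝ)) atTop (𝓝 0) :=
        tendsto_const_nhds.div_atTop hcast
      simpa using (this.const_sub 1).pow 3
    refine tendsto_of_tendsto_of_tendsto_of_le_of_le' l3 tendsto_const_nhds ?_ ?_
    · filter_upwards [hcast.eventually_ge_atTop (2 * d), hcast.eventually_gt_atTop 0] with K h1 h2
      rw [le_div_iff₀ (by positivity), ← mul_pow]
      have := hF3 K h1
      rwa [sub_mul, one_mul, div_mul_cancel₀ _ h2.ne']
    · filter_upwards [hcast.eventually_gt_atTop 0] with K h2
      exact div_le_one_of_le₀ (hF2 K) (by positivity)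
  have l4 := l2.mul l1
  rw [one_mul, add_zero] at l4
  refine ge_of_tendsto l4 ?_
  filter_upwards [hcast.eventually_gt_atTop d, hcast.eventually_gt_atTop 0] with K h1 h2
  have h3 := UEG_trial T v hT hx lab hlab hN h1 (F K) (hF1 K)
  have hK : 1 ≤ n * K := by
    have : 0 < K := by exact_mod_cast h2
    exact Nat.mul_pos (Nat.pos_of_ne_zero (NeZero.ne n)) this
  have h4 := eUEG_mul_le hK h3
  have hδ : 0 < δ := cellVol_pos T
  push_cast at h4
  rw [div_mul_eq_mul_div, le_div_iff₀ (by positivity)]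
  have h5 : eUEG * n * (K : ℝ) ^ 3 ≤ (F K).card *
      (S + N ^ 2 / ((K : ℝ) - d) - N ^ 2 / n * (pbar v / δ)) := by
    have h6 : (0 : ℝ) < n ^ 2 := by positivity
    refine le_of_mul_le_mul_left ?_ h6
    calc _ = eUEG * ((n : ℝ) * K) ^ 3 := by ring
      _ ≤ _ := h4
      _ = _ := by ring
  calc _ = (eUEG * n * (K : ℝ) ^ 3) * δ := by ring
    _ ≤ _ := mul_le_mul_of_nonneg_right h5 hδ.le
    _ = _ := by ring

section
variable (T : E3 ≃L[ℝ] (Fin 3 → ℝ)) (v : Fin 3 → E3)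

lemma pbar_nonneg (v : Fin 3 → E3) : 0 ≤ pbar v :=
  integral_nonneg fun z => mul_nonneg (tri_nonneg v z) (by positivity)

lemma integral_locK (v : Fin 3 → E3) (x : E3) : (∫ y, locK v x y) = pbar v :=
  integral_sub_left_eq_self (fun z => tri v z * ‖z‖⁻¹) volume x

lemma locK_eq_zero (hT : ∀ x i, T x i = inner ℝ (v i) x)
    {x y : E3} (h : cellDiam T ≤ ‖x - y‖) : locK v x y = 0 := by
  by_contra h0
  refine absurd (norm_lt_cellDiam T (z := x - y) fun i => ?_) (not_lt.2 h)
  by_contra! h1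
  refine h0 (mul_eq_zero_of_left (Finset.prod_eq_zero (Finset.mem_univ i) ?_) _)
  rw [← hT]
  exact max_eq_right (by linarith)

lemma integrable_locK (hT : ∀ x i, T x i = inner ℝ (v i) x)
    (x : E3) : Integrable (locK v x) := by
  have h := (adm_locK v).integrableOn (C := Metric.ball x (cellDiam T)) measure_ball_lt_top.ne x
  refine (integrableOn_iff_integrable_of_support_subset fun y hy => ?_).1 h
  by_contra h1
  rw [Metric.mem_ball, not_lt, dist_comm, dist_eq_norm] at h1
  exact hy (locK_eq_zero T v hT h1)

lemma setIntegral_locK_le (hT : ∀ x i, T x i = inner ℝ (v i) x)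
    (x : E3) (C : Set E3) : (∫ y in C, locK v x y) ≤ pbar v := by
  rw [← integral_locK v x]
  exact setIntegral_le_integral (integrable_locK T v hT x)
    (Eventually.of_forall (locK_nonneg v x))

lemma setIntegral_locK_inner (hT : ∀ x i, T x i = inner ℝ (v i) x)
    {M : ℝ} {x : E3} (hx : x ∈ box (cellDiam T) (M - cellDiam T)) :
    (∫ y in box 0 M, locK v x y) = pbar v := by
  rw [← integral_locK v x]
  refine setIntegral_eq_integral_of_forall_compl_eq_zero fun y hy => locK_eq_zero T v hT ?_
  by_contra! h
  refine hy fun i => ?_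
  have h1 := abs_lt.1 ((abs_coord_le_norm (x - y) i).trans_lt h)
  simp only [PiLp.sub_apply] at h1
  exact ⟨by linarith [(hx i).1, h1.1, h1.2], by linarith [(hx i).2, h1.1, h1.2]⟩

lemma setIntegral_locK_outer (hT : ∀ x i, T x i = inner ℝ (v i) x)
    {M : ℝ} {x : E3} (hx : x ∉ box (-cellDiam T) (M + cellDiam T)) :
    (∫ y in box 0 M, locK v x y) = 0 := by
  refine setIntegral_eq_zero_of_forall_eq_zero fun y hy => locK_eq_zero T v hT ?_
  by_contra! h
  refine hx fun i => ?_
  have h1 := abs_lt.1 ((abs_coord_le_norm (x - y) i).trans_lt h)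
  simp only [PiLp.sub_apply] at h1
  exact ⟨by linarith [(hy i).1, h1.1, h1.2], by linarith [(hy i).2, h1.1, h1.2]⟩

lemma volume_box_ne_top (a b : ℝ) : volume (box a b) ≠ ⊤ := by
  rw [volume_box]; exact ENNReal.pow_ne_top ENNReal.ofReal_ne_top

lemma integral_prod_locK_ge (hT : ∀ x i, T x i = inner ℝ (v i) x)
    (M : ℝ) :
    (max (M - 2 * cellDiam T) 0) ^ 3 * pbar v
      ≤ ∫ p, locK v p.1 p.2 ∂((volume.restrict (box 0 M)).prod (volume.restrict (box 0 M))) := by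
  have hC := volume_box_ne_top 0 M
  have hi := (adm_locK v).integrable_prod hC
  have e := integral_prod _ hi
  simp only [Function.uncurry] at e
  have hd := cellDiam_pos T
  have hsub : box (cellDiam T) (M - cellDiam T) ⊆ box 0 M := fun x hx i =>
    ⟨by linarith [(hx i).1], by linarith [(hx i).2]⟩
  rw [e]
  have h1 : ∫ x in box (cellDiam T) (M - cellDiam T), (∫ y in box 0 M, locK v x y)
      = (max (M - 2 * cellDiam T) 0) ^ 3 * pbar v := by
    rw [setIntegral_congr_fun (measurableSet_box _ _)
      fun x hx => setIntegral_locK_inner T v hT hx, setIntegral_const, smul_eq_mul, Measure.real,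
      volume_box, ENNReal.toReal_pow, ENNReal.toReal_ofReal']
    congr 3
    ring
  rw [← h1]
  exact setIntegral_mono_set hi.integral_prod_left
    (Eventually.of_forall fun x => integral_nonneg fun y => locK_nonneg v x y)
    hsub.eventuallyLE

/-- The number of cells used to spread a configuration in the cube of side `M`. -/
def numCells (M : ℝ) : ℕ := ⌈(M + 4 * cellDiam T) ^ 3 / cellVol T⌉₊

lemma exists_label {M : ℝ} (hM : 0 ≤ M) {N : ℕ} {x : Fin N → E3}
    (hx : ∀ j, x j ∈ box (-cellDiam T) (M + cellDiam T)) [NeZero (numCells T M)] :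
    ∃ lab : (Fin 3 → ℤ) → Fin (numCells T M),
      ∀ i j (θ : Fin 3 → ℝ), (∀ k, θ k ∈ Ico (0 : ℝ) 1) →
      lab (floorPt T (x i) θ) = lab (floorPt T (x j) θ) → floorPt T (x i) θ = floorPt T (x j) θ := by
  have hd := cellDiam_pos T
  set d := cellDiam T
  set A := box (-(2 * d)) (M + 2 * d)
  set G := (finite_cells_of_bounded T (isBounded_box (-(2 * d)) (M + 2 * d))).toFinset.filter
    fun l => cellAt T l ⊆ A
  have hG : G.card ≤ numCells T M := by
    have h1 := card_mul_cellVol_le T G (A := A) fun l hl => (Finset.mem_filter.1 hl).2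
    have h0 : 0 ≤ M + 2 * d - -(2 * d) := by linarith
    rw [volume_box, ← ENNReal.ofReal_pow h0, ENNReal.ofReal_le_ofReal_iff (by positivity),
      ← le_div_iff₀ (cellVol_pos T)] at h1
    have h2 : (G.card : ℝ) ≤ numCells T M := by
      refine h1.trans (le_trans (le_of_eq ?_) (Nat.le_ceil _))
      congr 2
      ring
    exact_mod_cast h2
  have hmem : ∀ j (θ : Fin 3 → ℝ), (∀ k, θ k ∈ Ico (0 : ℝ) 1) → floorPt T (x j) θ ∈ G := by
    intro j θ hθ
    have hsub : cellAt T (floorPt T (x j) θ) ⊆ A := by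
      intro y hy i
      have h1 := abs_coord_sub_lt T (x := y) (y := x j) (fun k => ?_) i
      · have h2 := abs_lt.1 h1
        exact ⟨by linarith [(hx j i).1], by linarith [(hx j i).2]⟩
      · have h3 := Int.floor_eq_iff.1 (hy k)
        have h4 := Int.floor_eq_iff.1 (show ⌊T (x j) k + θ k⌋ = floorPt T (x j) θ k from rfl)
        have h5 := hθ k
        rw [abs_le]
        constructor <;> linarith [h5.1, h5.2]
    refine Finset.mem_filter.2 ⟨?_, hsub⟩
    rw [Set.Finite.mem_toFinset]
    obtain ⟨y, hy⟩ : (cellAt T (floorPt T (x j) θ)).Nonempty := by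
      refine nonempty_of_measure_ne_zero (μ := volume) ?_
      rw [volume_cellAt]
      simpa using cellVol_pos T
    exact ⟨y, hsub hy, hy⟩
  obtain ⟨f⟩ : Nonempty (G ↪ Fin (numCells T M)) :=
    Function.Embedding.nonempty_of_card_le (by simpa using hG)
  refine ⟨fun l => if h : l ∈ G then f ⟨l, h⟩ else 0, fun i j θ hθ h => ?_⟩
  simp only [dif_pos (hmem i θ hθ), dif_pos (hmem j θ hθ)] at h
  exact congrArg Subtype.val (f.injective h)

lemma sum_locK_lower (hT : ∀ x i, T x i = inner ℝ (v i) x)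
    {M : ℝ} (hM : 0 ≤ M) (X : Finset E3)
    (hX : ∀ x ∈ X, x ∈ box (-cellDiam T) (M + cellDiam T)) (hN : X.card ≤ M ^ 3) :
    eUEG * (numCells T M * cellVol T)
        + X.card ^ 2 * pbar v / (numCells T M * cellVol T) ≤ ∑ x ∈ X, ∑ y ∈ X, locK v x y := by
  have hd := cellDiam_pos T
  have hδ := cellVol_pos T
  have h1 : 0 < (M + 4 * cellDiam T) ^ 3 / cellVol T := by positivity
  have hn : 0 < numCells T M := Nat.ceil_pos.2 h1
  have : NeZero (numCells T M) := ⟨hn.ne'⟩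
  set x : Fin X.card → E3 := fun i => X.equivFin.symm i
  have hx : Function.Injective x := Subtype.val_injective.comp X.equivFin.symm.injective
  have hsum : ∀ f : E3 → ℝ, ∑ y ∈ X, f y = ∑ i, f (x i) := fun f => by
    rw [← Finset.sum_coe_sort, ← Equiv.sum_comp X.equivFin.symm]
  obtain ⟨lab, hlab⟩ := exists_label T hM (x := x) fun j => hX _ (X.equivFin.symm j).2
  have h2 : (M + 4 * cellDiam T) ^ 3 ≤ numCells T M * cellVol T :=
    (div_le_iff₀ hδ).1 (Nat.le_ceil _)
  have h3 : M ^ 3 ≤ (M + 4 * cellDiam T) ^ 3 := by gcongr; linarith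
  have h := eUEG_le_trial T v hT hx lab hlab (hN.trans (h3.trans h2))
  simp only [hsum]
  have e : (X.card : ℝ) ^ 2 * pbar v / (numCells T M * cellVol T)
      = X.card ^ 2 / numCells T M * (pbar v / cellVol T) := by
    rw [div_mul_div_comm]
  linarith

lemma two_En_locK_lower (hT : ∀ x i, T x i = inner ℝ (v i) x)
    {M : ℝ} (hM : 0 ≤ M) (X : Finset E3) (hN : X.card ≤ M ^ 3) :
    eUEG * ((M + 4 * cellDiam T) ^ 3 + cellVol T)
      + pbar v * ((max (M - 2 * cellDiam T) 0) ^ 3 - ((M + 4 * cellDiam T) ^ 3 + cellVol T))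
      ≤ 2 * En (locK v) X (box 0 M) := by
  have hd := cellDiam_pos T
  have hδ := cellVol_pos T
  have hp := pbar_nonneg v
  set Y := X.filter (· ∈ box (-cellDiam T) (M + cellDiam T))
  have hY : (Y.card : ℝ) ≤ M ^ 3 :=
    le_trans (by exact_mod_cast Finset.card_filter_le _ _) hN
  have h1 := sum_locK_lower T v hT hM Y (fun x hx => (Finset.mem_filter.1 hx).2) hY
  have h2 : ∑ x ∈ Y, ∑ y ∈ Y, locK v x y ≤ ∑ x ∈ X, ∑ y ∈ X, locK v x y :=
    (Finset.sum_le_sum fun x _ => Finset.sum_le_sum_of_subset_of_nonneg (Finset.filter_subset _ _)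
      fun y _ _ => locK_nonneg v x y).trans
    (Finset.sum_le_sum_of_subset_of_nonneg (Finset.filter_subset _ _)
      fun x _ _ => Finset.sum_nonneg fun y _ => locK_nonneg v x y)
  have h3 : ∑ x ∈ X, (∫ y in box 0 M, locK v x y) ≤ Y.card * pbar v := by
    calc ∑ x ∈ X, (∫ y in box 0 M, locK v x y) = ∑ x ∈ Y, (∫ y in box 0 M, locK v x y) := by
          rw [Finset.sum_filter]
          refine Finset.sum_congr rfl fun x _ => ?_
          split_ifs with h
          · rfl
          · exact setIntegral_locK_outer T v hT h
      _ ≤ ∑ _x ∈ Y, pbar v := Finset.sum_le_sum fun x _ => setIntegral_locK_le T v hT x _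
      _ = _ := by simp
  have h4 := integral_prod_locK_ge T v hT M
  set V := numCells T M * cellVol T
  have hV0 : (M + 4 * cellDiam T) ^ 3 ≤ V := (div_le_iff₀ hδ).1 (Nat.le_ceil _)
  have hL : 0 < (M + 4 * cellDiam T) ^ 3 := by positivity
  have hV1 : V ≤ (M + 4 * cellDiam T) ^ 3 + cellVol T := by
    have := (Nat.ceil_lt_add_one (a := (M + 4 * cellDiam T) ^ 3 / cellVol T) (by positivity)).le
    calc V ≤ ((M + 4 * cellDiam T) ^ 3 / cellVol T + 1) * cellVol T :=
          mul_le_mul_of_nonneg_right this hδ.le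
      _ = _ := by field_simp
  have hV : 0 < V := hL.trans_le hV0
  have h5 : eUEG * ((M + 4 * cellDiam T) ^ 3 + cellVol T) ≤ eUEG * V :=
    mul_le_mul_of_nonpos_left hV1 eUEG_nonpos
  have h6 : 2 * Y.card * pbar v - V * pbar v ≤ Y.card ^ 2 * pbar v / V := by
    rw [le_div_iff₀ hV]
    nlinarith [mul_nonneg hp (sq_nonneg ((Y.card : ℝ) - V))]
  have h7 : pbar v * V ≤ pbar v * ((M + 4 * cellDiam T) ^ 3 + cellVol T) :=
    mul_le_mul_of_nonneg_left hV1 hp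
  unfold En
  linarith

lemma eventually_En_locK (hT : ∀ x i, T x i = inner ℝ (v i) x)
    {ε : ℝ} (hε : 0 < ε) : ∀ᶠ M : ℕ in atTop, ∀ X : Finset E3,
    X.card = M ^ 3 → (eUEG - ε) * (M : ℝ) ^ 3 ≤ 2 * En (locK v) X (cube0 M) := by
  have hcast : Tendsto (fun K : ℕ => (K : ℝ)) atTop atTop := tendsto_natCast_atTop_atTop
  set d := cellDiam T
  set δ := cellVol T
  have t1 : ∀ c : ℝ, Tendsto (fun K : ℕ => c / (K : ℝ)) atTop (𝓝 0) := fun c =>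
    tendsto_const_nhds.div_atTop hcast
  have t2 : Tendsto (fun K : ℕ => δ / (K : ℝ) ^ 3) atTop (𝓝 0) :=
    tendsto_const_nhds.div_atTop ((tendsto_pow_atTop three_ne_zero).comp hcast)
  have t3 : Tendsto (fun K : ℕ => (1 + 4 * d / (K : ℝ)) ^ 3 + δ / (K : ℝ) ^ 3) atTop (𝓝 1) := by
    simpa using (((t1 (4 * d)).const_add 1).pow 3).add t2
  have t4 : Tendsto (fun K : ℕ => (1 - 2 * d / (K : ℝ)) ^ 3) atTop (𝓝 1) := by
    simpa using ((t1 (2 * d)).const_sub 1).pow 3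
  have t5 := (t3.const_mul eUEG).add ((t4.sub t3).const_mul (pbar v))
  rw [sub_self, mul_zero, add_zero, mul_one] at t5
  filter_upwards [t5.eventually_const_le (sub_lt_self eUEG hε),
    hcast.eventually_ge_atTop (2 * d), hcast.eventually_gt_atTop 0] with M h1 h2 h3 X hX
  have h := two_En_locK_lower T v hT h3.le X (by rw [hX]; push_cast; exact le_rfl)
  rw [max_eq_left (sub_nonneg.2 h2)] at h
  rw [cube0_eq_box]
  refine le_trans ?_ h
  refine (mul_le_mul_of_nonneg_right h1 (by positivity)).trans (le_of_eq ?_)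
  have h3' := h3.ne'
  change (_ : ℝ) = eUEG * (((M : ℝ) + 4 * d) ^ 3 + δ) +
    pbar v * (((M : ℝ) - 2 * d) ^ 3 - (((M : ℝ) + 4 * d) ^ 3 + δ))
  field_simp

end

/-- The Gamma distribution with density `ℓ exp (-ℓ)`. -/
def gammaLaw : Measure ℝ :=
  (volume.restrict (Ioi 0)).withDensity fun ℓ => ENNReal.ofReal (ℓ * rexp (-ℓ))

lemma hasDerivAt_tail (y ℓ : ℝ) :
    HasDerivAt (fun ℓ => -((ℓ - y + 1) * rexp (-ℓ))) ((ℓ - y) * rexp (-ℓ)) ℓ := by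
  have h1 : HasDerivAt (fun ℓ : ℝ => ℓ - y + 1) 1 ℓ := ((hasDerivAt_id ℓ).sub_const y).add_const 1
  have h2 : HasDerivAt (fun ℓ : ℝ => rexp (-ℓ)) (rexp (-ℓ) * -1) ℓ := (hasDerivAt_neg ℓ).exp
  convert! (h1.mul h2).neg using 1
  ring

lemma tendsto_tail (y : ℝ) : Tendsto (fun ℓ => -((ℓ - y + 1) * rexp (-ℓ))) atTop (𝓝 0) := by
  have h1 : Tendsto (fun ℓ : ℝ => ℓ ^ 1 * rexp (-ℓ)) atTop (𝓝 0) :=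
    tendsto_pow_mul_exp_neg_atTop_nhds_zero 1
  have h2 : Tendsto (fun ℓ : ℝ => (1 - y) * rexp (-ℓ)) atTop (𝓝 ((1 - y) * 0)) :=
    (tendsto_exp_neg_atTop_nhds_zero).const_mul _
  have h := (h1.add h2).neg
  simp only [mul_zero, add_zero, neg_zero] at h
  refine h.congr fun ℓ => ?_
  ring

lemma integrableOn_tail (y : ℝ) : IntegrableOn (fun ℓ => (ℓ - y) * rexp (-ℓ)) (Ioi y) :=
  integrableOn_Ioi_deriv_of_nonneg' (fun ℓ _ => hasDerivAt_tail y ℓ)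
    (fun _ hℓ => mul_nonneg (sub_nonneg.2 (le_of_lt hℓ)) (exp_pos _).le) (tendsto_tail y)

lemma integral_tail (y : ℝ) : (∫ ℓ in Ioi y, (ℓ - y) * rexp (-ℓ)) = rexp (-y) := by
  rw [integral_Ioi_of_hasDerivAt_of_nonneg' (fun ℓ _ => hasDerivAt_tail y ℓ)
    (fun _ hℓ => mul_nonneg (sub_nonneg.2 (le_of_lt hℓ)) (exp_pos _).le) (tendsto_tail y)]
  simp

instance : IsProbabilityMeasure gammaLaw := ⟨by
  have h := integral_tail 0
  have hi := integrableOn_tail 0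
  simp only [sub_zero, neg_zero, exp_zero] at h hi
  rw [gammaLaw, withDensity_apply _ MeasurableSet.univ, Measure.restrict_univ,
    ← ofReal_integral_eq_lintegral_ofReal hi, h, ENNReal.ofReal_one]
  filter_upwards [ae_restrict_mem measurableSet_Ioi] with ℓ hℓ
  exact mul_nonneg (le_of_lt hℓ) (exp_pos _).le⟩

lemma gammaLaw_pos : ∀ᵐ ℓ ∂gammaLaw, 0 < ℓ :=
  withDensity_absolutelyContinuous _ _ (ae_restrict_mem measurableSet_Ioi)

lemma integral_gammaLaw {y : ℝ} (hy : 0 ≤ y) :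
    (∫ ℓ, max (1 - y / ℓ) 0 ∂gammaLaw) = rexp (-y) := by
  rw [gammaLaw, integral_withDensity_eq_integral_toReal_smul (by fun_prop)
    (Eventually.of_forall fun _ => ENNReal.ofReal_lt_top), ← integral_tail y]
  have h1 : (∫ ℓ in Ioi y, (ℓ - y) * rexp (-ℓ))
      = ∫ ℓ in Ioi (0 : ℝ), (Ioi y).indicator (fun ℓ => (ℓ - y) * rexp (-ℓ)) ℓ := by
    rw [setIntegral_indicator measurableSet_Ioi, inter_eq_right.2 (Ioi_subset_Ioi hy)]
  rw [h1]
  refine setIntegral_congr_fun measurableSet_Ioi fun ℓ hℓ => ?_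
  have hℓ' : 0 < ℓ := hℓ
  simp only [smul_eq_mul, indicator, mem_Ioi]
  rw [ENNReal.toReal_ofReal (mul_nonneg hℓ'.le (exp_pos _).le)]
  split_ifs with h
  · rw [max_eq_left (sub_nonneg.2 ((div_le_one hℓ').2 h.le))]
    field_simp
  · rw [max_eq_right (sub_nonpos.2 ((one_le_div hℓ').2 (not_lt.1 h))), mul_zero]

/-- The uniform law on the unit ball. -/
def ballLaw : Measure E3 :=
  (volume (Metric.ball (0 : E3) 1))⁻¹ • volume.restrict (Metric.ball 0 1)

instance : IsProbabilityMeasure ballLaw := ⟨by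
  rw [ballLaw, Measure.smul_apply, Measure.restrict_apply_univ, smul_eq_mul]
  exact ENNReal.inv_mul_cancel (Metric.measure_ball_pos _ _ one_pos).ne' measure_ball_lt_top.ne⟩

lemma ballLaw_absolutelyContinuous : ballLaw ≪ volume :=
  Measure.AbsolutelyContinuous.smul_left Measure.restrict_le_self.absolutelyContinuous _

lemma ballLaw_norm_le : ∀ᵐ g ∂ballLaw, ‖g‖ ≤ 1 := by
  refine Measure.ae_smul_measure ?_ _
  filter_upwards [ae_restrict_mem Metric.isOpen_ball.measurableSet] with g hg
  exact (mem_ball_zero_iff.1 hg).le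

lemma integral_ballLaw_comp (R : E3 ≃ₗᵢ[ℝ] E3) (f : E3 → ℝ) :
    (∫ g, f (R g) ∂ballLaw) = ∫ g, f g ∂ballLaw := by
  have h := (LinearIsometryEquiv.measurePreserving R).setIntegral_preimage_emb
    R.toMeasurableEquiv.measurableEmbedding f (Metric.ball 0 1)
  have e : R ⁻¹' Metric.ball 0 1 = Metric.ball 0 1 := by
    ext x; simp
  rw [e] at h
  rw [ballLaw, integral_smul_measure, integral_smul_measure, h]

lemma integral_ballLaw_inner (f : ℝ → ℝ) (z : E3) :
    (∫ g, f (inner ℝ g z) ∂ballLaw) = ∫ g, f (‖z‖ * g 0) ∂ballLaw := by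
  set w : E3 := EuclideanSpace.single 0 ‖z‖ with hw
  have hn : ‖z‖ = ‖w‖ := by simp [hw]
  obtain ⟨R, hR⟩ : ∃ R : E3 ≃ₗᵢ[ℝ] E3, R z = w := ⟨_, Submodule.reflection_sub hn⟩
  have h := integral_ballLaw_comp R fun g => f (inner ℝ g w)
  simp only [← hR, LinearIsometryEquiv.inner_map_map] at h
  rw [h, hR]
  refine integral_congr_ae (Eventually.of_forall fun g => ?_)
  simp only [hw]
  congr 1
  rw [EuclideanSpace.inner_single_right]
  simp

/-- A law of directions whose triangle functions average to a mixture of exponentials. -/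
def dirLaw (ε : ℝ) : Measure E3 :=
  (ballLaw.prod gammaLaw).map fun p => (ε / p.2) • p.1

lemma measurable_dir (ε : ℝ) : Measurable fun p : E3 × ℝ => (ε / p.2) • p.1 :=
  (measurable_const.div measurable_snd).smul measurable_fst

instance (ε : ℝ) : IsProbabilityMeasure (dirLaw ε) :=
  Measure.isProbabilityMeasure_map (measurable_dir ε).aemeasurable

lemma dirLaw_absolutelyContinuous {ε : ℝ} (hε : 0 < ε) : dirLaw ε ≪ volume := by
  refine Measure.AbsolutelyContinuous.mk fun s hs h0 => ?_
  rw [dirLaw, Measure.map_apply (measurable_dir ε) hs,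
    Measure.prod_apply_symm (measurable_dir ε hs)]
  refine lintegral_eq_zero_of_ae_eq_zero ?_
  filter_upwards [gammaLaw_pos] with ℓ hℓ
  refine ballLaw_absolutelyContinuous ?_
  have h := Measure.addHaar_preimage_smul (volume : Measure E3) (div_pos hε hℓ).ne' s
  rw [h0, mul_zero] at h
  exact h

lemma integral_dirLaw {ε : ℝ} (hε : 0 < ε) (z : E3) :
    (∫ v, max (1 - |inner ℝ v z|) 0 ∂dirLaw ε)
      = ∫ g : E3, rexp (-(ε * |g 0| * ‖z‖)) ∂ballLaw := by
  have hm : Measurable fun v : E3 => max (1 - |inner ℝ v z|) 0 := by fun_prop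
  rw [dirLaw, integral_map (measurable_dir ε).aemeasurable hm.aestronglyMeasurable, integral_prod]
  · calc _ = ∫ g : E3, rexp (-(ε * |inner ℝ g z|)) ∂ballLaw := by
          refine integral_congr_ae (Eventually.of_forall fun g => ?_)
          beta_reduce
          rw [← integral_gammaLaw (y := ε * |inner ℝ g z|) (by positivity)]
          refine integral_congr_ae ?_
          filter_upwards [gammaLaw_pos] with ℓ hℓ
          rw [real_inner_smul_left, abs_mul, abs_of_pos (div_pos hε hℓ)]
          congr 2
          ring
      _ = _ := by
          rw [integral_ballLaw_inner fun t => rexp (-(ε * |t|))]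
          refine integral_congr_ae (Eventually.of_forall fun g => ?_)
          simp only [abs_mul, abs_norm]
          congr 2
          ring
  · refine Integrable.of_bound (hm.comp (measurable_dir ε)).aestronglyMeasurable 1
      (Eventually.of_forall fun p => ?_)
    rw [Real.norm_eq_abs, abs_of_nonneg (le_max_right _ _)]
    exact max_le (by linarith [abs_nonneg (inner ℝ ((ε / p.2) • p.1) z)]) zero_le_one

/-- A triple of vectors as a family. -/
def vec3 (p : E3 × E3 × E3) : Fin 3 → E3 := ![p.2.2, p.2.1, p.1]

lemma continuous_vec3 : Continuous vec3 := by
  refine continuous_pi fun i => ?_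
  fin_cases i
  · exact continuous_snd.snd
  · exact continuous_snd.fst
  · exact continuous_fst

lemma ae_linearIndependent_cons {ν : Measure E3} (hν : ν ≪ volume) {n : ℕ} (hn : n < 3)
    {b : Fin n → E3} (hb : LinearIndependent ℝ b) :
    ∀ᵐ x ∂ν, LinearIndependent ℝ (Fin.cons x b : Fin (n + 1) → E3) := by
  have h : (volume : Measure E3) (Submodule.span ℝ (Set.range b)) = 0 := by
    refine Measure.addHaar_submodule _ _ fun h => ?_
    have h1 := finrank_range_le_card (R := ℝ) b
    rw [Set.finrank, h, finrank_top, finrank_euclideanSpace, Fintype.card_fin,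
      Fintype.card_fin] at h1
    omega
  have h2 : ∀ᵐ x ∂ν, x ∉ Submodule.span ℝ (Set.range b) :=
    measure_eq_zero_iff_ae_notMem.1 (hν h)
  filter_upwards [h2] with x hx
  exact linearIndependent_finCons.2 ⟨hb, hx⟩

lemma vec3_eq_cons (x y z : E3) : vec3 (x, y, z) = Fin.cons z (Fin.cons y (Fin.cons x ![])) := by
  funext i
  fin_cases i <;> rfl

lemma ae_linearIndependent {ν : Measure E3} [IsProbabilityMeasure ν] (hν : ν ≪ volume) :
    ∀ᵐ p ∂ν.prod (ν.prod ν), LinearIndependent ℝ (vec3 p) := by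
  have ho₀ : IsOpen {f : Fin 3 → E3 | LinearIndependent ℝ f} :=
    isOpen_setOfPred_linearIndependent
  have ho : IsOpen {p | LinearIndependent ℝ (vec3 p)} := ho₀.preimage continuous_vec3
  have ho' : ∀ x, MeasurableSet {q : E3 × E3 | LinearIndependent ℝ (vec3 (x, q))} := fun x =>
    (ho.preimage (Continuous.prodMk_right x)).measurableSet
  refine (Measure.ae_prod_iff_ae_ae ho.measurableSet).2 ?_
  have h0 : LinearIndependent ℝ (![] : Fin 0 → E3) := linearIndependent_empty_type
  have h1 := ae_linearIndependent_cons hν (by norm_num) h0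
  filter_upwards [h1] with x hx
  refine (Measure.ae_prod_iff_ae_ae (ho' x)).2 ?_
  have h2 := ae_linearIndependent_cons hν (by norm_num) hx
  filter_upwards [h2] with y hy
  have h3 := ae_linearIndependent_cons hν (by norm_num) hy
  filter_upwards [h3] with z hz
  rw [vec3_eq_cons]
  exact hz

lemma exists_coordinates {v : Fin 3 → E3} (hv : LinearIndependent ℝ v) :
    ∃ T : E3 ≃L[ℝ] (Fin 3 → ℝ), ∀ x i, T x i = inner ℝ (v i) x := by
  set f : E3 →ₗ[ℝ] (Fin 3 → ℝ) := LinearMap.pi fun i => (innerSL ℝ (v i) : E3 →ₗ[ℝ] ℝ) with hf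
  have happ : ∀ x i, f x i = inner ℝ (v i) x := fun x i => by simp [hf]
  have hspan := hv.span_eq_top_of_card_eq_finrank' (by simp)
  have hinj : Function.Injective f := by
    rw [← LinearMap.ker_eq_bot, LinearMap.ker_eq_bot']
    intro x hx
    have h : ∀ y ∈ Submodule.span ℝ (Set.range v), inner ℝ y x = 0 := by
      intro y hy
      induction hy using Submodule.span_induction with
      | mem y hy => obtain ⟨i, rfl⟩ := hy; rw [← happ, hx]; rfl
      | zero => simp
      | add y z _ _ h1 h2 => rw [inner_add_left, h1, h2, add_zero]
      | smul c y _ h1 => rw [real_inner_smul_left, h1, mul_zero]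
    exact inner_self_eq_zero.1 (h x (by rw [hspan]; trivial))
  exact ⟨(f.linearEquivOfInjective hinj (by simp)).toContinuousLinearEquiv, fun x i => happ x i⟩

/-- The law of three independent directions. -/
def dirLaw3 (ε : ℝ) : Measure (E3 × E3 × E3) := (dirLaw ε).prod ((dirLaw ε).prod (dirLaw ε))

instance (ε : ℝ) : IsProbabilityMeasure (dirLaw3 ε) := by unfold dirLaw3; infer_instance

/-- The law of three independent points of the ball. -/
def ballLaw3 : Measure (E3 × E3 × E3) := ballLaw.prod (ballLaw.prod ballLaw)

instance : IsProbabilityMeasure ballLaw3 := by unfold ballLaw3; infer_instance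

/-- The random decay rate obtained from three points of the ball. -/
def rate (ε : ℝ) (g : E3 × E3 × E3) : ℝ := ε * (|g.1 0| + |g.2.1 0| + |g.2.2 0|)

lemma rate_nonneg {ε : ℝ} (hε : 0 < ε) (g : E3 × E3 × E3) : 0 ≤ rate ε g := by
  unfold rate; positivity

lemma rate_le {ε : ℝ} (hε : 0 < ε) : ∀ᵐ g ∂ballLaw3, rate ε g ≤ 3 * ε := by
  have h0 : ∀ᵐ g ∂ballLaw, |g 0| ≤ 1 := by
    filter_upwards [ballLaw_norm_le] with g hg using (abs_coord_le_norm g 0).trans hg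
  have h1 : ∀ᵐ g ∂ballLaw3, |g.1 0| ≤ 1 := Measure.quasiMeasurePreserving_fst.ae h0
  have h2 : ∀ᵐ g ∂ballLaw3, |g.2.1 0| ≤ 1 :=
    Measure.quasiMeasurePreserving_snd.ae (Measure.quasiMeasurePreserving_fst.ae h0)
  have h3 : ∀ᵐ g ∂ballLaw3, |g.2.2 0| ≤ 1 :=
    Measure.quasiMeasurePreserving_snd.ae (Measure.quasiMeasurePreserving_snd.ae h0)
  filter_upwards [h1, h2, h3] with g a b c
  unfold rate
  nlinarith

lemma integral_tri_dirLaw3 {ε : ℝ} (hε : 0 < ε) (z : E3) :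
    (∫ p, tri (vec3 p) z ∂dirLaw3 ε) = ∫ g, rexp (-(rate ε g * ‖z‖)) ∂ballLaw3 := by
  have e1 : ∀ p, tri (vec3 p) z = max (1 - |inner ℝ p.1 z|) 0 *
      (max (1 - |inner ℝ p.2.1 z|) 0 * max (1 - |inner ℝ p.2.2 z|) 0) := fun p => by
    simp only [tri, vec3, Fin.prod_univ_three, Matrix.cons_val]
    ring
  have e2 : ∀ g, rexp (-(rate ε g * ‖z‖)) = rexp (-(ε * |g.1 0| * ‖z‖)) *
      (rexp (-(ε * |g.2.1 0| * ‖z‖)) * rexp (-(ε * |g.2.2 0| * ‖z‖))) := fun g => by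
    rw [← exp_add, ← exp_add, rate]
    congr 1
    ring
  simp only [e1, e2]
  rw [dirLaw3, ballLaw3,
    integral_prod_mul (fun v : E3 => max (1 - |inner ℝ v z|) 0)
      (fun q : E3 × E3 => max (1 - |inner ℝ q.1 z|) 0 * max (1 - |inner ℝ q.2 z|) 0),
    integral_prod_mul (fun v : E3 => max (1 - |inner ℝ v z|) 0)
      (fun v : E3 => max (1 - |inner ℝ v z|) 0),
    integral_prod_mul (fun g : E3 => rexp (-(ε * |g 0| * ‖z‖)))
      (fun q : E3 × E3 => rexp (-(ε * |q.1 0| * ‖z‖)) * rexp (-(ε * |q.2 0| * ‖z‖))),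
    integral_prod_mul (fun g : E3 => rexp (-(ε * |g 0| * ‖z‖)))
      (fun g : E3 => rexp (-(ε * |g 0| * ‖z‖)))]
  simp only [integral_dirLaw hε z]

lemma En_exp_kap_le {b : ℝ} (hb : 0 ≤ b) (X : Finset E3) {C : Set E3} (hC : MeasurableSet C)
    (hC' : volume C ≠ ⊤) :
    En (fun x y => rexp (-(b * ‖x - y‖)) * kap x y) X C ≤ En kap X C + b / 2 * X.card := by
  have a1 : Adm fun x y : E3 => b * (if x = y then 1 else 0 : ℝ) := by
    refine Adm.of_bdd ?_ (fun x y => by split_ifs <;> simp [hb]) b fun x y => by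
      split_ifs <;> simp [hb]
    exact (Measurable.ite (measurableSet_eq_fun measurable_fst measurable_snd)
      measurable_const measurable_const).const_mul b
  have h1 := En_add adm_kap a1 X hC'
  have h2 := En_add (adm_exp_kap hb) (adm_kapLong hb) X hC'
  simp only [kap_split] at h1
  rw [En_const_mul, En_diag] at h1
  have h3 := PD.kapLong hb X C hC hC'
  linarith

lemma measurable_locK_vec3 :
    Measurable fun q : (E3 × E3 × E3) × E3 × E3 => locK (vec3 q.1) q.2.1 q.2.2 := by
  have h : Measurable fun q : (E3 × E3 × E3) × E3 × E3 => (vec3 q.1, q.2) :=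
    (continuous_vec3.measurable.comp measurable_fst).prodMk measurable_snd
  have h' : Measurable ((fun p : (Fin 3 → E3) × E3 × E3 => locK p.1 p.2.1 p.2.2) ∘
      fun q : (E3 × E3 × E3) × E3 × E3 => (vec3 q.1, q.2)) := measurable_locK.comp h
  exact h'

lemma integral_En_locK {ε : ℝ} (hε : 0 < ε) (X : Finset E3) {C : Set E3} (hC : MeasurableSet C)
    (hC' : volume C ≠ ⊤) :
    Integrable (fun p => En (locK (vec3 p)) X C) (dirLaw3 ε) ∧
      (∫ p, En (locK (vec3 p)) X C ∂dirLaw3 ε) ≤ En kap X C + 3 * ε / 2 * X.card := by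
  set k : E3 → E3 → ℝ := fun x y => ∫ p, locK (vec3 p) x y ∂dirLaw3 ε with hk
  have hm := measurable_locK_vec3
  have hi : ∀ x y, Integrable (fun p => locK (vec3 p) x y) (dirLaw3 ε) := fun x y => by
    refine Integrable.of_bound (hm.comp (measurable_id.prodMk measurable_const :
      Measurable fun p : E3 × E3 × E3 => (p, (x, y)))).aestronglyMeasurable (kap x y)
      (Eventually.of_forall fun p => ?_)
    rw [Real.norm_eq_abs, abs_of_nonneg (locK_nonneg _ _ _)]
    exact locK_le _ _ _
  have hadm : Adm k := by
    refine Adm.of_le ?_ (fun x y => integral_nonneg fun p => locK_nonneg _ _ _) fun x y => ?_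
    · exact (hm.comp measurable_swap).stronglyMeasurable.integral_prod_right'
        (f := fun q : (E3 × E3) × (E3 × E3 × E3) => locK (vec3 q.2) q.1.1 q.1.2) |>.measurable
    · refine (integral_mono (hi x y) (integrable_const (kap x y)) fun p => locK_le _ _ _).trans ?_
      simp
  have he : ∀ x y, (∫ g, rexp (-(rate ε g * ‖x - y‖)) * kap x y ∂ballLaw3) = k x y := fun x y => by
    simp only [hk, locK]
    rw [integral_mul_const, integral_mul_const, integral_tri_dirLaw3 hε]
  have hrate : Measurable (rate ε) := by unfold rate; fun_prop
  have hm2 : Measurable fun q : (E3 × E3 × E3) × E3 × E3 =>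
      rexp (-(rate ε q.1 * ‖q.2.1 - q.2.2‖)) * kap q.2.1 q.2.2 := by
    unfold kap; fun_prop
  have hi2 : ∀ x y, Integrable (fun g => rexp (-(rate ε g * ‖x - y‖)) * kap x y) ballLaw3 :=
    fun x y => by
    refine Integrable.mul_const ?_ _
    refine Integrable.of_bound (by fun_prop) 1 (Eventually.of_forall fun g => ?_)
    rw [Real.norm_eq_abs, abs_of_pos (exp_pos _)]
    exact exp_le_one_iff.2 (neg_nonpos.2 (mul_nonneg (rate_nonneg hε g) (norm_nonneg _)))
  have h1 := En_mix hadm hm (fun p x y => locK_nonneg _ x y) hi (fun x y => rfl) X hC'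
  have h2 := En_mix (f := fun g x y => rexp (-(rate ε g * ‖x - y‖)) * kap x y) hadm hm2
    (fun p x y => mul_nonneg (exp_pos _).le (kap_nonneg _ _)) hi2 he X hC'
  refine ⟨h1.1, ?_⟩
  rw [h1.2, ← h2.2]
  have h3 : ∀ᵐ g ∂ballLaw3, En (fun x y => rexp (-(rate ε g * ‖x - y‖)) * kap x y) X C
      ≤ En kap X C + 3 * ε / 2 * X.card := by
    filter_upwards [rate_le hε] with g hg
    refine (En_exp_kap_le (rate_nonneg hε g) X hC hC').trans ?_
    gcongr
  refine (integral_mono_ae h2.1 (integrable_const _) h3).trans ?_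
  simp

/-- Asymptotic lower bound on the energy of configurations with the density of the background. -/
theorem eventually_En_kap {δ : ℝ} (hδ : 0 < δ) : ∀ᶠ M : ℕ in atTop, ∀ X : Finset E3,
    X.card = M ^ 3 → (eUEG - δ) * (M : ℝ) ^ 3 ≤ 2 * En kap X (cube0 M) := by
  set ε := δ / 8 with hε'
  have hε : 0 < ε := by positivity
  have hch : ∀ M : ℕ, ∃ X : Finset E3, X.card = M ^ 3 ∧
      ((eUEG - δ) * (M : ℝ) ^ 3 ≤ 2 * En kap X (cube0 M) →
        ∀ Y : Finset E3, Y.card = M ^ 3 → (eUEG - δ) * (M : ℝ) ^ 3 ≤ 2 * En kap Y (cube0 M)) := by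
    intro M
    by_cases h : ∀ Y : Finset E3, Y.card = M ^ 3 → (eUEG - δ) * (M : ℝ) ^ 3 ≤ 2 * En kap Y (cube0 M)
    · obtain ⟨X, hX⟩ := Infinite.exists_subset_card_eq E3 (M ^ 3)
      exact ⟨X, hX, fun _ => h⟩
    · push Not at h
      obtain ⟨Y, hY, hlt⟩ := h
      exact ⟨Y, hY, fun h => absurd h (not_le.2 hlt)⟩
  choose X hX himp using hch
  have hcast : Tendsto (fun K : ℕ => (K : ℝ)) atTop atTop := tendsto_natCast_atTop_atTop
  set F : ℕ → E3 × E3 × E3 → ℝ := fun M p =>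
    min (2 * En (locK (vec3 p)) (X M) (cube0 M) / (M : ℝ) ^ 3 - (eUEG - ε)) 0 with hF
  have hint : ∀ M, Integrable (fun p => 2 * En (locK (vec3 p)) (X M) (cube0 M) / (M : ℝ) ^ 3)
      (dirLaw3 ε) := fun M =>
    ((integral_En_locK hε (X M) (measurableSet_cube0 M) (volume_cube0_ne_top M)).1.const_mul
      2).div_const _
  have hFint : ∀ M, Integrable (F M) (dirLaw3 ε) := fun M =>
    ((hint M).sub (integrable_const _)).inf (integrable_const 0)
  have hlim : Tendsto (fun M => ∫ p, F M p ∂dirLaw3 ε) atTop (𝓝 (∫ _p, (0 : ℝ) ∂dirLaw3 ε)) := by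
    refine tendsto_integral_of_dominated_convergence (fun _ => 1 + 2 * cYuk + |eUEG - ε|)
      (fun M => (hFint M).aestronglyMeasurable) (integrable_const _) (fun M => ?_) ?_
    · refine Eventually.of_forall fun p => ?_
      rw [Real.norm_eq_abs, abs_of_nonpos (min_le_right _ _), neg_le]
      have h1 := En_locK_lower (vec3 p) (X M) (measurableSet_cube0 M) (volume_cube0_ne_top M)
      rw [hX M] at h1
      push_cast at h1
      have h2 : -(1 + 2 * cYuk) ≤ 2 * En (locK (vec3 p)) (X M) (cube0 M) / (M : ℝ) ^ 3 := by
        have := cYuk_nonneg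
        rcases (by positivity : (0 : ℝ) ≤ (M : ℝ) ^ 3).eq_or_lt with h0 | h0
        · rw [← h0, div_zero]; linarith
        · rw [le_div_iff₀ h0]; linarith
      have := cYuk_nonneg
      refine le_min ?_ ?_
      · linarith [le_abs_self (eUEG - ε)]
      · linarith [abs_nonneg (eUEG - ε)]
    · filter_upwards [ae_linearIndependent (dirLaw_absolutelyContinuous hε)] with p hp
      obtain ⟨T, hT⟩ := exists_coordinates hp
      refine tendsto_const_nhds.congr' ?_
      filter_upwards [eventually_En_locK T _ hT hε, hcast.eventually_gt_atTop 0] with M h1 h2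
      have h3 := h1 (X M) (hX M)
      refine (min_eq_right ?_).symm
      rw [sub_nonneg, le_div_iff₀ (by positivity)]
      exact h3
  rw [integral_zero] at hlim
  filter_upwards [hlim.eventually_const_le (neg_lt_zero.2 hε), hcast.eventually_gt_atTop 0]
    with M h1 h2
  refine himp M ?_
  have h3 := (integral_En_locK hε (X M) (measurableSet_cube0 M) (volume_cube0_ne_top M)).2
  have h4 : (∫ p, F M p ∂dirLaw3 ε) ≤ ∫ p, (2 * En (locK (vec3 p)) (X M) (cube0 M) / (M : ℝ) ^ 3
      - (eUEG - ε)) ∂dirLaw3 ε :=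
    integral_mono (hFint M) ((hint M).sub (integrable_const _)) fun p => min_le_left _ _
  rw [integral_sub (hint M) (integrable_const _), integral_div, integral_const_mul] at h4
  simp only [integral_const, probReal_univ, one_smul] at h4
  rw [hX M] at h3
  push_cast at h3
  have h5 : eUEG - 2 * ε ≤ 2 * (∫ p, En (locK (vec3 p)) (X M) (cube0 M) ∂dirLaw3 ε) / (M : ℝ) ^ 3 := by
    linarith
  rw [le_div_iff₀ (by positivity)] at h5
  have h6 : 0 ≤ δ * (M : ℝ) ^ 3 := by positivity
  rw [hε'] at h5 h3
  linarith

lemma EReal_coe_sum {ι : Type*} (s : Finset ι) (f : ι → ℝ) :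
    ((∑ i ∈ s, f i : ℝ) : EReal) = ∑ i ∈ s, (f i : EReal) := by
  induction s using Finset.induction_on with
  | empty => simp
  | insert a s ha ih => rw [Finset.sum_insert ha, Finset.sum_insert ha, EReal.coe_add, ih]

lemma kap_self (x : E3) : kap x x = 0 := by simp [kap]

lemma sum_Ioi_kap {N : ℕ} (z : Fin N → E3) :
    ∑ j, ∑ k ∈ Finset.Ioi j, kap (z j) (z k) = 1 / 2 * ∑ j, ∑ k, kap (z j) (z k) := by
  have h := Finset.sum_sum_Ioi_add_eq_sum_sum_off_diag fun j k => kap (z j) (z k)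
  have h1 : ∀ i, ∑ j ∈ ({i}ᶜ : Finset (Fin N)), kap (z j) (z i) = ∑ k, kap (z i) (z k) := by
    intro i
    rw [← Finset.sum_compl_add_sum {i}, Finset.sum_singleton, kap_self, add_zero]
    exact Finset.sum_congr rfl fun j _ => kap_comm _ _
  have h2 : ∀ i, ∑ j ∈ Finset.Ioi i, (kap (z j) (z i) + kap (z i) (z j))
      = 2 * ∑ k ∈ Finset.Ioi i, kap (z i) (z k) := by
    intro i
    rw [Finset.mul_sum]
    refine Finset.sum_congr rfl fun j _ => ?_
    rw [kap_comm (z j) (z i)]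
    ring
  simp only [h1, h2] at h
  rw [← Finset.mul_sum] at h
  linarith

lemma coulK_nonneg (x y : E3) : 0 ≤ coulK x y := by
  unfold coulK
  split_ifs
  · exact le_top
  · exact_mod_cast inv_nonneg.2 (norm_nonneg _)

lemma pairEnergy_of_injective {N : ℕ} {z : Fin N → E3} (hz : Function.Injective z) :
    pairEnergy z = ((1 / 2 * ∑ j, ∑ k, kap (z j) (z k) : ℝ) : EReal) := by
  rw [← sum_Ioi_kap, EReal_coe_sum, pairEnergy]
  refine Finset.sum_congr rfl fun j _ => ?_
  rw [EReal_coe_sum]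
  refine Finset.sum_congr rfl fun k hk => ?_
  rw [coulK, if_neg fun h => (Finset.mem_Ioi.1 hk).ne (hz h), kap]

lemma pairEnergy_of_not_injective {N : ℕ} {z : Fin N → E3} (hz : ¬ Function.Injective z) :
    pairEnergy z = ⊤ := by
  obtain ⟨i, j, h1, h2⟩ : ∃ i j, z i = z j ∧ i < j := by
    obtain ⟨i, j, h1, h2⟩ : ∃ i j, z i = z j ∧ i ≠ j := by
      simpa [Function.Injective] using hz
    rcases h2.lt_or_gt with h | h
    · exact ⟨i, j, h1, h⟩
    · exact ⟨j, i, h1.symm, h⟩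
  have h3 : ⊤ ≤ ∑ k ∈ Finset.Ioi i, coulK (z i) (z k) := by
    refine le_trans (le_of_eq ?_) (Finset.single_le_sum (fun k _ => coulK_nonneg (z i) (z k))
      (Finset.mem_Ioi.2 h2))
    rw [coulK, if_pos h1]
  refine top_le_iff.1 (h3.trans ?_)
  exact Finset.single_le_sum (f := fun i => ∑ k ∈ Finset.Ioi i, coulK (z i) (z k))
    (fun i _ => Finset.sum_nonneg fun k _ => coulK_nonneg _ _) (Finset.mem_univ i)

lemma ERealPos_pairEnergy {N : ℕ} (z : Fin N → E3) : ERealPos (pairEnergy z) = 2⁻¹ * pairE z := by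
  by_cases hz : Function.Injective z
  · rw [pairEnergy_of_injective hz, pairE_of_injective hz, ERealPos, if_neg (EReal.coe_ne_top _),
      EReal.toReal_coe, ENNReal.ofReal_mul (by norm_num), one_div,
      ENNReal.ofReal_inv_of_pos (by norm_num)]
    norm_num
  · rw [pairEnergy_of_not_injective hz, pairE_of_not_injective hz, ERealPos, if_pos rfl,
      ENNReal.mul_top (by simp)]

lemma ERealPos_neg_pairEnergy {N : ℕ} (z : Fin N → E3) : ERealPos (-pairEnergy z) = 0 := by
  by_cases hz : Function.Injective z
  · rw [pairEnergy_of_injective hz, ← EReal.coe_neg, ERealPos, if_neg (EReal.coe_ne_top _),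
      EReal.toReal_coe, ENNReal.ofReal_eq_zero]
    have : 0 ≤ ∑ j, ∑ k, kap (z j) (z k) :=
      Finset.sum_nonneg fun j _ => Finset.sum_nonneg fun k _ => kap_nonneg _ _
    linarith
  · rw [pairEnergy_of_not_injective hz]
    simp [ERealPos]

lemma eintegral_pairEnergy {N : ℕ} (P : Measure (Fin N → E3)) :
    eintegral P pairEnergy = ((2⁻¹ * ∫⁻ z, pairE z ∂P : ℝ≥0∞) : EReal) := by
  unfold eintegral
  simp only [ERealPos_pairEnergy, ERealPos_neg_pairEnergy]
  rw [lintegral_zero, lintegral_const_mul' _ _ (by simp)]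
  simp

lemma hartree_indicator {C : Set E3} (hm : MeasurableSet C) (hC : volume C ≠ ⊤) :
    hartree (C.indicator 1) (C.indicator 1)
      = 1 / 2 * ∫ p, kap p.1 p.2 ∂((volume.restrict C).prod (volume.restrict C)) := by
  have hf : IsFiniteMeasure (volume.restrict C) := ⟨by simpa using hC.lt_top⟩
  have hi := adm_kap.integrable_prod hC
  have e := integral_prod _ hi
  simp only [Function.uncurry] at e
  rw [e, hartree]
  congr 1
  have h : ∀ x, (∫ y, C.indicator 1 x * C.indicator 1 y * ‖x - y‖⁻¹)
      = C.indicator (fun x => ∫ y in C, kap x y) x := by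
    intro x
    by_cases hx : x ∈ C
    · simp only [indicator_of_mem hx, Pi.one_apply, one_mul]
      rw [← integral_indicator hm]
      congr 1
      funext y
      by_cases hy : y ∈ C <;> simp [hy, kap]
    · simp [hx]
  simp only [h]
  rw [integral_indicator hm]

lemma jelliumE_of_injective {N : ℕ} {z : Fin N → E3} (hz : Function.Injective z) {C : Set E3}
    (hm : MeasurableSet C) (hC : volume C ≠ ⊤) :
    jelliumE C z = ((En kap (Finset.univ.image z) C : ℝ) : EReal) := by
  rw [jelliumE, pairEnergy_of_injective hz, hartree_indicator hm hC, ← EReal.coe_sub,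
    ← EReal.coe_add]
  congr 1
  have h := two_En_image (k := kap) hz C
  have h1 : ∑ j, (∫ y in C, kap (z j) y) = ∑ j, ∫ y in C, ‖z j - y‖⁻¹ := rfl
  rw [← h1]
  linarith

lemma jelliumE_of_not_injective {N : ℕ} {z : Fin N → E3} (hz : ¬ Function.Injective z)
    (C : Set E3) : jelliumE C z = ⊤ := by
  rw [jelliumE, pairEnergy_of_not_injective hz, EReal.top_sub_coe, EReal.top_add_coe]

lemma integral_sum_comp {N : ℕ} (P : Measure (Fin N → E3)) [IsProbabilityMeasure P] {φ : E3 → ℝ}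
    (hφ : Measurable φ) {c : ℝ} (hc : ∀ x, |φ x| ≤ c) :
    (∫ z, (∑ j, φ (z j)) ∂P) = ∫ x, φ x ∂(∑ j, P.map (fun z => z j)) := by
  have hp : ∀ j : Fin N, IsProbabilityMeasure (P.map (fun z => z j)) := fun j =>
    Measure.isProbabilityMeasure_map (measurable_pi_apply j).aemeasurable
  rw [integral_finsetSum_measure fun j _ =>
    Integrable.of_bound hφ.aestronglyMeasurable c (Eventually.of_forall hc)]
  have hi : ∀ j : Fin N, Integrable (fun z => φ (z j)) P := fun j =>
    Integrable.of_bound (hφ.comp (measurable_pi_apply j)).aestronglyMeasurable c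
      (Eventually.of_forall fun z => hc (z j))
  rw [integral_finsetSum _ fun j _ => hi j]
  refine Finset.sum_congr rfl fun j _ => ?_
  rw [integral_map (measurable_pi_apply j).aemeasurable hφ.aestronglyMeasurable]

lemma integral_mul_indicator_one {C : Set E3} (hm : MeasurableSet C) (φ : E3 → ℝ) :
    (∫ x, φ x * C.indicator 1 x) = ∫ x in C, φ x := by
  rw [← integral_indicator hm]
  congr 1
  funext x
  by_cases hx : x ∈ C <;> simp [hx]

lemma hasDensity_indicator_iff {N : ℕ} {C : Set E3} (hm : MeasurableSet C) (hC : volume C ≠ ⊤)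
    (P : Measure (Fin N → E3)) [IsProbabilityMeasure P] :
    HasDensity P (C.indicator 1) ↔ ∑ j, P.map (fun z => z j) = volume.restrict C := by
  have hf : IsFiniteMeasure (volume.restrict C) := ⟨by simpa using hC.lt_top⟩
  have hs : IsFiniteMeasure (∑ j, P.map (fun z => z j)) :=
    ⟨by rw [sum_map_univ]; exact ENNReal.natCast_lt_top N⟩
  constructor
  · intro h
    refine Measure.ext fun B hB => ?_
    have hφ : Measurable (B.indicator (1 : E3 → ℝ)) := measurable_one.indicator hB
    have hc : ∀ x, |B.indicator (1 : E3 → ℝ) x| ≤ 1 := fun x => by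
      by_cases hx : x ∈ B <;> simp [hx]
    have h1 := h _ hφ ⟨1, hc⟩
    rw [integral_sum_comp P hφ hc, integral_mul_indicator_one hm, integral_indicator_one hB,
      integral_indicator_one hB] at h1
    exact (measureReal_eq_measureReal_iff).1 h1
  · rintro h φ hφ ⟨c, hc⟩
    rw [integral_sum_comp P hφ hc, h, integral_mul_indicator_one hm]

lemma indirectEnergy_le {N : ℕ} {C : Set E3} (hm : MeasurableSet C) (hC : volume C ≠ ⊤) {w : ℝ}
    (h : St N (volume.restrict C) w) :
    indirectEnergy N (C.indicator 1) ≤ ((w / 2 : ℝ) : EReal) := by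
  obtain ⟨-, P, hP, hd, hfin, hw⟩ := h
  have h1 : indirectEnergy N (C.indicator 1) ≤ eintegral P pairEnergy
      - ((hartree (C.indicator 1) (C.indicator 1) : ℝ) : EReal) :=
    sInf_le ⟨P, hP, (hasDensity_indicator_iff hm hC P).2 hd, rfl⟩
  refine h1.trans ?_
  have h2 : 2⁻¹ * ∫⁻ z, pairE z ∂P ≠ ⊤ := ENNReal.mul_ne_top (by simp) hfin
  rw [eintegral_pairEnergy, ← EReal.coe_ennreal_toReal h2, ← EReal.coe_sub, EReal.coe_le_coe_iff,
    hartree_indicator hm hC, integral_kap_prod_eq_toReal hC, ENNReal.toReal_mul,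
    ENNReal.toReal_inv, ENNReal.toReal_ofNat]
  linarith

lemma le_indirectEnergy {N : ℕ} {C : Set E3} (hm : MeasurableSet C) (hC : volume C ≠ ⊤) {β : ℝ}
    (hβ : ∀ z : Fin N → E3, Function.Injective z → β ≤ 2 * En kap (Finset.univ.image z) C) :
    ((β / 2 : ℝ) : EReal) ≤ indirectEnergy N (C.indicator 1) := by
  refine le_sInf ?_
  rintro e ⟨P, hP, hd, rfl⟩
  rw [eintegral_pairEnergy]
  by_cases hfin : ∫⁻ z, pairE z ∂P = ⊤
  · rw [hfin, ENNReal.mul_top (by simp), EReal.coe_ennreal_top, EReal.top_sub_coe]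
    exact le_top
  · have h2 : 2⁻¹ * ∫⁻ z, pairE z ∂P ≠ ⊤ := ENNReal.mul_ne_top (by simp) hfin
    have h3 : St N (volume.restrict C) ((∫⁻ z, pairE z ∂P).toReal
        - (mutE (volume.restrict C) (volume.restrict C)).toReal) :=
      ⟨Measure.restrict_le_self, P, hP, (hasDensity_indicator_iff hm hC P).1 hd, hfin, by linarith⟩
    have h4 := h3.lower hC hβ
    rw [← EReal.coe_ennreal_toReal h2, ← EReal.coe_sub, EReal.coe_le_coe_iff,
      hartree_indicator hm hC, integral_kap_prod_eq_toReal hC, ENNReal.toReal_mul,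
      ENNReal.toReal_inv, ENNReal.toReal_ofNat]
    linarith

lemma le_iInf_jelliumE {N : ℕ} {C : Set E3} (hm : MeasurableSet C) (hC : volume C ≠ ⊤) {β : ℝ}
    (hβ : ∀ z : Fin N → E3, Function.Injective z → β ≤ 2 * En kap (Finset.univ.image z) C) :
    ((β / 2 : ℝ) : EReal) ≤ ⨅ z : Fin N → E3, jelliumE C z := by
  refine le_iInf fun z => ?_
  by_cases hz : Function.Injective z
  · rw [jelliumE_of_injective hz hm hC, EReal.coe_le_coe_iff]
    linarith [hβ z hz]
  · rw [jelliumE_of_not_injective hz]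
    exact le_top

lemma iInf_jelliumE_le {N : ℕ} {C : Set E3} (hm : MeasurableSet C) (hC : volume C ≠ ⊤) {w : ℝ}
    (h : St N (volume.restrict C) w) :
    ⨅ z : Fin N → E3, jelliumE C z ≤ ((w / 2 : ℝ) : EReal) := by
  refine EReal.le_of_forall_lt_iff_le.1 fun a ha => ?_
  rw [EReal.coe_lt_coe_iff] at ha
  by_contra hlt
  rw [not_le] at hlt
  have h1 := h.lower hC (β := 2 * a) fun z hz => by
    have h2 := hlt.le.trans (iInf_le (fun z : Fin N → E3 => jelliumE C z) z)
    rw [jelliumE_of_injective hz hm hC, EReal.coe_le_coe_iff] at h2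
    linarith
  linarith

lemma tendsto_inv_cube_mul {F : ℕ → EReal} {e : ℝ}
    (h : ∀ ε : ℝ, 0 < ε → ∀ᶠ K : ℕ in atTop, (((e - ε) * (K : ℝ) ^ 3 : ℝ) : EReal) ≤ F K ∧
      F K ≤ (((e + ε) * (K : ℝ) ^ 3 : ℝ) : EReal)) :
    Tendsto (fun K : ℕ => ((((K : ℝ) ^ 3)⁻¹ : ℝ) : EReal) * F K) atTop (𝓝 (e : EReal)) := by
  have hlift : ∀ᶠ K : ℕ in atTop, ((F K).toReal : EReal) = F K := by
    filter_upwards [h 1 one_pos] with K hK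
    exact EReal.coe_toReal (ne_top_of_le_ne_top (EReal.coe_ne_top _) hK.2)
      (ne_bot_of_le_ne_bot (EReal.coe_ne_bot _) hK.1)
  have h1 : Tendsto (fun K : ℕ => ((K : ℝ) ^ 3)⁻¹ * (F K).toReal) atTop (𝓝 e) := by
    refine Metric.tendsto_nhds.2 fun ε hε => ?_
    filter_upwards [h (ε / 2) (half_pos hε), hlift, eventually_gt_atTop 0] with K hK hF hpos
    rw [← hF, EReal.coe_le_coe_iff, EReal.coe_le_coe_iff] at hK
    have hK3 : (0 : ℝ) < (K : ℝ) ^ 3 := by positivity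
    rw [← le_div_iff₀ hK3, ← div_le_iff₀ hK3] at hK
    rw [inv_mul_eq_div, Real.dist_eq, abs_lt]
    constructor <;> linarith
  refine ((continuous_coe_real_ereal.tendsto e).comp h1).congr' ?_
  filter_upwards [hlift] with K hF
  simp only [Function.comp_apply]
  rw [EReal.coe_mul, hF]

/-- The thermodynamic limit of the Uniform Electron Gas energy per
unit volume exists and coincides with that of the Jellium ground state energy per
unit volume, along the cubes `C_K = (0,K)³` with `N_K = K³` particles. -/
theorem statement5 :
    ∃ e : ℝ,
      Tendsto
        (fun K : ℕ => ((((K : ℝ) ^ 3)⁻¹ : ℝ) : EReal)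
          * indirectEnergy (K ^ 3) ((cube0 K).indicator 1))
        atTop (nhds ((e : ℝ) : EReal)) ∧
      Tendsto
        (fun K : ℕ => ((((K : ℝ) ^ 3)⁻¹ : ℝ) : EReal)
          * ⨅ X : Fin (K ^ 3) → E3, jelliumE (cube0 K) X)
        atTop (nhds ((e : ℝ) : EReal)) := by
  have hlow : ∀ ε : ℝ, 0 < ε → ∀ᶠ K : ℕ in atTop, ∀ z : Fin (K ^ 3) → E3, Function.Injective z →
      (eUEG - 2 * ε) * (K : ℝ) ^ 3 ≤ 2 * En kap (Finset.univ.image z) (cube0 K) := by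
    intro ε hε
    filter_upwards [eventually_En_kap (δ := 2 * ε) (by positivity)] with K hK z hz
    refine hK _ ?_
    rw [Finset.card_image_of_injective _ hz, Finset.card_univ, Fintype.card_fin]
  have e1 : ∀ ε K : ℝ, (eUEG / 2 - ε) * K ^ 3 = (eUEG - 2 * ε) * K ^ 3 / 2 := fun ε K => by ring
  have e2 : ∀ ε K : ℝ, (eUEG / 2 + ε) * K ^ 3 = (eUEG + 2 * ε) * K ^ 3 / 2 := fun ε K => by ring
  refine ⟨eUEG / 2, tendsto_inv_cube_mul fun ε hε => ?_, tendsto_inv_cube_mul fun ε hε => ?_⟩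
  · filter_upwards [hlow ε hε, eventually_UEG (ε := 2 * ε) (by positivity)] with K h1 h2
    rw [e1, e2]
    exact ⟨le_indirectEnergy (measurableSet_cube0 K) (volume_cube0_ne_top K) h1,
      indirectEnergy_le (measurableSet_cube0 K) (volume_cube0_ne_top K) h2⟩
  · filter_upwards [hlow ε hε, eventually_UEG (ε := 2 * ε) (by positivity)] with K h1 h2
    rw [e1, e2]
    exact ⟨le_iInf_jelliumE (measurableSet_cube0 K) (volume_cube0_ne_top K) h1,
      iInf_jelliumE_le (measurableSet_cube0 K) (volume_cube0_ne_top K) h2⟩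

end
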